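/- For complex ν with Re ν > -1: ∫_{-1}^1 [P_ν(x)]³ (1-x²)^{(ν-1)/2} dx = ((3 - 2cos(νπ))/π) (cos(νπ/2)/2^ν)³ [Γ((1+ν)/2)/Γ(1+ν/2)]⁴. -/

import Mathlib

open Real MeasureTheory intervalIntegral Complex

/-- Complete elliptic integral of the first kind. -/
noncomputable def ellipticK (k : ℝ) : ℝ :=
  ∫ θ in (0:ℝ)..(π/2), (1 - k ^ 2 * Real.sin θ ^ 2) ^ (-(1/2 : ℝ))

/-- Complete elliptic integral of the second kind. -/
noncomputable def ellipticE (k : ℝ) : ℝ :=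
  ∫ θ in (0:ℝ)..(π/2), (1 - k ^ 2 * Real.sin θ ^ 2) ^ ((1/2 : ℝ))

/-- Legendre function of the first kind of degree ν : P_ν(1-2z) = ₂F₁(-ν, ν+1; 1; z). -/
noncomputable def legendreP (ν : ℂ) (x : ℂ) : ℂ :=
  ordinaryHypergeometric (-ν) (ν + 1) 1 ((1 - x) / 2)


namespace L3

lemma HasSum_congr {E : Type*} [AddCommMonoid E] [TopologicalSpace E] {f g : ℕ → E} {a : E}
    (h : HasSum f a) (hfg : ∀ n, g n = f n) : HasSum g a := by
  rwa [funext hfg]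

/-- Coefficients of the Legendre series, `l = ν (ν + 1)`. -/
noncomputable def lco {K : Type*} [Field K] (l : K) (n : ℕ) : K :=
  ∏ k ∈ Finset.range n, (((k : K) * (k + 1) - l) / ((k : K) + 1) ^ 2)

/-- The Legendre series. -/
noncomputable def SS {K : Type*} [RCLike K] (l : K) (z : K) : K := ∑' n : ℕ, lco l n * z ^ n

/-- first derivative -/
noncomputable def SS1 {K : Type*} [RCLike K] (l : K) (z : K) : K :=
  ∑' n : ℕ, ((n : K) + 1) * lco l (n + 1) * z ^ n

/-- second derivative -/
noncomputable def SS2 {K : Type*} [RCLike K] (l : K) (z : K) : K :=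
  ∑' n : ℕ, ((n : K) + 1) * (((n : K) + 2) * lco l (n + 2)) * z ^ n

lemma lco_zero {K : Type*} [Field K] (l : K) : lco l 0 = 1 := by simp [lco]

lemma lco_succ {K : Type*} [Field K] (l : K) (n : ℕ) :
    lco l (n + 1) = lco l n * (((n : K) * (n + 1) - l) / ((n : K) + 1) ^ 2) := by
  rw [lco, lco, Finset.prod_range_succ]

lemma lco_rec {K : Type*} [RCLike K] (l : K) (n : ℕ) :
    ((n : K) + 1) ^ 2 * lco l (n + 1) = ((n : K) * (n + 1) - l) * lco l n := by
  have : (n : K) + 1 ≠ 0 := by exact_mod_cast Nat.succ_ne_zero n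
  rw [lco_succ]; field_simp

lemma lco_ofReal (l : ℝ) (n : ℕ) : ((lco l n : ℝ) : ℂ) = lco (l : ℂ) n := by
  simp [lco]

/-- The constant bounding the coefficients. -/
noncomputable def lC (r : ℝ) : ℝ := 1 + r * Real.exp r

lemma lco_bound_aux {K : Type*} [RCLike K] (l : K) (n : ℕ) :
    ((n : ℝ) + 1) * ‖lco l (n + 1)‖ ≤ ‖l‖ * Real.exp (‖l‖ * (1 - 1 / ((n : ℝ) + 1))) := by
  induction n with
  | zero => simp [lco]
  | succ n ih =>
    have hn : (0 : ℝ) < (n : ℝ) + 1 := by positivity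
    have hrec := lco_rec l (n + 1)
    have h1 : ‖((((n + 1 : ℕ) : K)) + 1)‖ = (n : ℝ) + 2 := by
      have : ((((n + 1 : ℕ) : K)) + 1) = ((n + 2 : ℕ) : K) := by push_cast; ring
      rw [this, RCLike.norm_natCast]; push_cast; ring
    have h2 : ‖(((n + 1 : ℕ) : K)) * (((n + 1 : ℕ) : K) + 1) - l‖ ≤
        ((n : ℝ) + 1) * ((n : ℝ) + 2) + ‖l‖ := by
      refine (norm_sub_le _ _).trans ?_
      rw [norm_mul, h1, RCLike.norm_natCast]; push_cast; rfl
    have h3 : ((n : ℝ) + 2) ^ 2 * ‖lco l (n + 1 + 1)‖ ≤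
        (((n : ℝ) + 1) * ((n : ℝ) + 2) + ‖l‖) * ‖lco l (n + 1)‖ := by
      have := congrArg norm hrec
      rw [norm_mul, norm_mul, norm_pow, h1] at this
      rw [this]; gcongr
    have h4 : ((n : ℝ) + 2) * ‖lco l (n + 1 + 1)‖ ≤
        (1 + ‖l‖ / (((n : ℝ) + 1) * ((n : ℝ) + 2))) * (((n : ℝ) + 1) * ‖lco l (n + 1)‖) := by
      have : (1 + ‖l‖ / (((n : ℝ) + 1) * ((n : ℝ) + 2))) * (((n : ℝ) + 1) * ‖lco l (n + 1)‖)
        = ((((n : ℝ) + 1) * ((n : ℝ) + 2) + ‖l‖) * ‖lco l (n + 1)‖) / ((n : ℝ) + 2) := by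
          field_simp
      rw [this, le_div_iff₀ (by positivity)]
      nlinarith
    have h5 : (1 + ‖l‖ / (((n : ℝ) + 1) * ((n : ℝ) + 2))) ≤
        Real.exp (‖l‖ / (((n : ℝ) + 1) * ((n : ℝ) + 2))) := by
      rw [add_comm]; exact Real.add_one_le_exp _
    push_cast
    calc ((n : ℝ) + 1 + 1) * ‖lco l (n + 1 + 1)‖ = ((n : ℝ) + 2) * ‖lco l (n + 1 + 1)‖ := by ring
      _ ≤ _ := h4
      _ ≤ Real.exp (‖l‖ / (((n : ℝ) + 1) * ((n : ℝ) + 2))) *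
          (‖l‖ * Real.exp (‖l‖ * (1 - 1 / ((n : ℝ) + 1)))) := by gcongr
      _ = ‖l‖ * Real.exp (‖l‖ * (1 - 1 / ((n : ℝ) + 1 + 1))) := by
          rw [mul_left_comm, ← Real.exp_add]
          congr 2
          field_simp
          ring

lemma lco_bound_succ {K : Type*} [RCLike K] (l : K) (n : ℕ) :
    ((n : ℝ) + 1) * ‖lco l (n + 1)‖ ≤ ‖l‖ * Real.exp ‖l‖ := by
  refine (lco_bound_aux l n).trans ?_
  gcongr
  have : 0 ≤ 1 / ((n : ℝ) + 1) := by positivity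
  nlinarith [norm_nonneg l]

lemma lC_pos {r : ℝ} (hr : 0 ≤ r) : 0 < lC r := by unfold lC; positivity

lemma lC_mono {r s : ℝ} (hr : 0 ≤ r) (h : r ≤ s) : lC r ≤ lC s := by
  unfold lC
  have := hr.trans h
  gcongr

lemma lco_bound_succ' {K : Type*} [RCLike K] (l : K) (n : ℕ) :
    ((n : ℝ) + 1) * ‖lco l (n + 1)‖ ≤ lC ‖l‖ :=
  (lco_bound_succ l n).trans (by unfold lC; linarith)

lemma lco_bound {K : Type*} [RCLike K] (l : K) (n : ℕ) : ‖lco l n‖ ≤ lC ‖l‖ := by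
  cases n with
  | zero => simp [lco, lC]; positivity
  | succ n =>
    refine le_trans ?_ (lco_bound_succ' l n)
    have := norm_nonneg (lco l (n + 1))
    nlinarith [(Nat.cast_nonneg n : (0 : ℝ) ≤ n)]

lemma summable_aux {K : Type*} [RCLike K] {a : ℕ → K} {C : ℝ} {z : K} (k : ℕ)
    (ha : ∀ n, ‖a n‖ ≤ C * ((n : ℝ) + 1) ^ k) (hz : ‖z‖ < 1) :
    Summable (fun n => a n * z ^ n) := by
  have h := summable_pow_mul_geometric_of_norm_lt_one k (r := ‖z‖) (by simpa using hz)
  have h0 := summable_geometric_of_lt_one (norm_nonneg z) hz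
  have hC : 0 ≤ C := by
    have := (norm_nonneg _).trans (ha 0); simpa using this
  refine Summable.of_norm_bounded (g := fun n : ℕ => C * 2 ^ k * ((n : ℝ) ^ k * ‖z‖ ^ n + ‖z‖ ^ n))
    ((h.add h0).mul_left _) ?_
  intro n
  rw [norm_mul, norm_pow]
  have : ((n : ℝ) + 1) ^ k ≤ 2 ^ k * ((n : ℝ) ^ k + 1) := by
    rcases Nat.eq_zero_or_pos n with h | h
    · subst h
      simp only [Nat.cast_zero, zero_add, one_pow]
      have : (1 : ℝ) ≤ 2 ^ k := one_le_pow₀ (by norm_num)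
      have h2 : (0 : ℝ) ≤ (0 : ℝ) ^ k := by positivity
      nlinarith
    · have h1 : (1 : ℝ) ≤ n := by exact_mod_cast h
      calc ((n : ℝ) + 1) ^ k ≤ (2 * (n : ℝ)) ^ k := by gcongr; linarith
        _ = 2 ^ k * (n : ℝ) ^ k := by rw [mul_pow]
        _ ≤ _ := by gcongr; linarith
  calc ‖a n‖ * ‖z‖ ^ n ≤ C * ((n : ℝ) + 1) ^ k * ‖z‖ ^ n := by gcongr; exact ha n
    _ ≤ C * (2 ^ k * ((n : ℝ) ^ k + 1)) * ‖z‖ ^ n := by gcongr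
    _ = _ := by ring

lemma deriv_aux {K : Type*} [RCLike K] {a : ℕ → K} {C : ℝ} {z : K} (k : ℕ)
    (ha : ∀ n, ‖a n‖ ≤ C * ((n : ℝ) + 1) ^ k) (hz : ‖z‖ < 1) :
    HasDerivAt (fun z => ∑' n, a n * z ^ n) (∑' n : ℕ, ((n : K) + 1) * a (n + 1) * z ^ n) z := by
  obtain ⟨r, hr1, hr2⟩ := exists_between hz
  have hr0 : 0 ≤ r := (norm_nonneg z).trans hr1.le
  have hC : 0 ≤ C := by
    have := (norm_nonneg _).trans (ha 0); simpa using this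
  have hs : Summable (fun n : ℕ => ‖a (n + 1)‖ * ((n : ℝ) + 1) * r ^ n) := by
    have := summable_aux (K := ℝ) (a := fun n : ℕ => ‖a (n + 1)‖ * ((n : ℝ) + 1))
      (C := C * 2 ^ k) (z := r) (k + 1) (fun n => ?_) (by rwa [Real.norm_of_nonneg hr0])
    · exact this
    rw [Real.norm_of_nonneg (by positivity)]
    have h := ha (n + 1)
    push_cast at h
    calc ‖a (n + 1)‖ * ((n : ℝ) + 1) ≤ C * ((n : ℝ) + 1 + 1) ^ k * ((n : ℝ) + 1) := by gcongr
      _ ≤ C * (2 * ((n : ℝ) + 1)) ^ k * ((n : ℝ) + 1) := by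
        gcongr
        linarith [(Nat.cast_nonneg n : (0 : ℝ) ≤ n)]
      _ = _ := by rw [mul_pow]; ring
  have key := hasDerivAt_tsum_of_isPreconnected (𝕜 := K) (F := K)
    (u := fun n : ℕ => ‖a n‖ * n * r ^ (n - 1)) (t := Metric.ball (0 : K) r)
    (g := fun n z => a n * z ^ n) (g' := fun n z => a n * (n * z ^ (n - 1))) (y₀ := 0) (y := z)
    ?_ Metric.isOpen_ball ?_ ?_ ?_ ?_ ?_ ?_
  · refine key.congr_deriv ?_
    rw [tsum_eq_zero_add' (f := fun n => a n * (n * z ^ (n - 1)))]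
    · simp only [Nat.cast_zero, zero_mul, mul_zero, zero_add]
      refine tsum_congr fun n => ?_
      push_cast
      try simp only [Nat.add_sub_cancel]
      ring
    · refine Summable.of_norm_bounded hs fun n => ?_
      simp only [Nat.add_sub_cancel]
      rw [norm_mul, norm_mul, norm_pow, RCLike.norm_natCast]
      push_cast
      rw [← mul_assoc]
      gcongr
  · refine (summable_nat_add_iff 1).1 ?_
    simpa using hs
  · exact (convex_ball (0 : K) r).isPreconnected
  · intro n y _
    simpa using (hasDerivAt_pow n y).const_mul (a n)
  · intro n y hy
    have hy' : ‖y‖ ≤ r := by simpa using (Metric.mem_ball.1 hy).le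
    rw [norm_mul, norm_mul, norm_pow, RCLike.norm_natCast, ← mul_assoc]
    gcongr
  · simpa using (norm_nonneg z).trans_lt hr1
  · refine summable_of_ne_finset_zero (s := {0}) fun n hn => ?_
    simp at hn; simp [hn]
  · simpa using hr1

lemma lco_bound1 {K : Type*} [RCLike K] (l : K) (n : ℕ) :
    ‖((n : K) + 1) * lco l (n + 1)‖ ≤ lC ‖l‖ := by
  have h : ‖((n : K) + 1)‖ = (n : ℝ) + 1 := by
    have : ((n : K) + 1) = ((n + 1 : ℕ) : K) := by push_cast; ring
    rw [this, RCLike.norm_natCast]; push_cast; ring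
  rw [norm_mul, h]; exact lco_bound_succ' l n

lemma lco_bound2 {K : Type*} [RCLike K] (l : K) (n : ℕ) :
    ‖((n : K) + 1) * (((n : K) + 2) * lco l (n + 2))‖ ≤ lC ‖l‖ * ((n : ℝ) + 1) ^ 1 := by
  have h : ‖((n : K) + 1)‖ = (n : ℝ) + 1 := by
    have : ((n : K) + 1) = ((n + 1 : ℕ) : K) := by push_cast; ring
    rw [this, RCLike.norm_natCast]; push_cast; ring
  have := lco_bound1 l (n + 1)
  push_cast at this
  rw [norm_mul, h, pow_one, mul_comm]
  gcongr
  have e : (n : K) + 1 + 1 = n + 2 := by ring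
  rwa [e] at this

lemma SS_summable {K : Type*} [RCLike K] (l : K) {z : K} (hz : ‖z‖ < 1) :
    Summable (fun n => lco l n * z ^ n) :=
  summable_aux 0 (C := lC ‖l‖) (fun n => by simpa using lco_bound l n) hz

lemma SS1_summable {K : Type*} [RCLike K] (l : K) {z : K} (hz : ‖z‖ < 1) :
    Summable (fun n : ℕ => ((n : K) + 1) * lco l (n + 1) * z ^ n) :=
  summable_aux 0 (C := lC ‖l‖) (fun n => by simpa using lco_bound1 l n) hz

lemma SS2_summable {K : Type*} [RCLike K] (l : K) {z : K} (hz : ‖z‖ < 1) :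
    Summable (fun n : ℕ => ((n : K) + 1) * (((n : K) + 2) * lco l (n + 2)) * z ^ n) :=
  summable_aux 1 (C := lC ‖l‖) (fun n => lco_bound2 l n) hz

lemma SS_hasDerivAt {K : Type*} [RCLike K] (l : K) {z : K} (hz : ‖z‖ < 1) :
    HasDerivAt (SS l) (SS1 l z) z :=
  deriv_aux 0 (C := lC ‖l‖) (fun n => by simpa using lco_bound l n) hz

lemma SS1_hasDerivAt {K : Type*} [RCLike K] (l : K) {z : K} (hz : ‖z‖ < 1) :
    HasDerivAt (SS1 l) (SS2 l z) z := by
  have := deriv_aux (a := fun n : ℕ => ((n : K) + 1) * lco l (n + 1)) 0 (C := lC ‖l‖)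
    (fun n => by simpa using lco_bound1 l n) hz
  refine this.congr_deriv ?_
  refine tsum_congr fun n => ?_
  push_cast; ring_nf

lemma SS_zero {K : Type*} [RCLike K] (l : K) : SS l 0 = 1 := by
  unfold SS
  rw [tsum_eq_single 0]
  · simp [lco]
  · intro n hn; simp [hn]

lemma SS2_hasDerivAt_exists {K : Type*} [RCLike K] (l : K) {z : K} (hz : ‖z‖ < 1) :
    ContinuousAt (SS2 l) z :=
  (deriv_aux (a := fun n : ℕ => ((n : K) + 1) * (((n : K) + 2) * lco l (n + 2))) 1
    (C := lC ‖l‖) (lco_bound2 l) hz).continuousAt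

/-- The hypergeometric equation. -/
lemma SS_ode {K : Type*} [RCLike K] (l : K) {z : K} (hz : ‖z‖ < 1) :
    z * (1 - z) * SS2 l z + (1 - 2 * z) * SS1 l z + l * SS l z = 0 := by
  have h0 := (SS_summable l hz).hasSum
  have h1 := (SS1_summable l hz).hasSum
  have h2 := (SS2_summable l hz).hasSum
  -- z S1
  have e1 : HasSum (fun n : ℕ => (n : K) * lco l n * z ^ n) (z * SS1 l z) := by
    rw [← hasSum_nat_add_iff' 1]
    simp only [Finset.sum_range_one, Nat.cast_zero, zero_mul, sub_zero]
    refine HasSum_congr (h1.mul_left z) (fun n => ?_)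
    push_cast; ring
  have e2 : HasSum (fun n : ℕ => (n : K) * (((n : K) + 1) * lco l (n + 1)) * z ^ n)
      (z * SS2 l z) := by
    rw [← hasSum_nat_add_iff' 1]
    simp only [Finset.sum_range_one, Nat.cast_zero, zero_mul, sub_zero]
    refine HasSum_congr (h2.mul_left z) (fun n => ?_)
    push_cast; ring_nf
  have e3 : HasSum (fun n : ℕ => (n : K) * ((n : K) - 1) * lco l n * z ^ n)
      (z ^ 2 * SS2 l z) := by
    rw [← hasSum_nat_add_iff' 2]
    simp only [Finset.sum_range_succ, Finset.range_zero, Finset.sum_empty, Nat.cast_zero, zero_mul,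
      Nat.cast_one, sub_self, mul_zero, add_zero, sub_zero]
    refine HasSum_congr (h2.mul_left (z ^ 2)) (fun n => ?_)
    push_cast; ring
  have tot := ((e2.sub e3).add (h1.sub (e1.mul_left 2))).add (h0.mul_left l)
  have hz0 : ∀ n : ℕ, (n : K) * (((n : K) + 1) * lco l (n + 1)) * z ^ n -
      (n : K) * ((n : K) - 1) * lco l n * z ^ n +
      (((n : K) + 1) * lco l (n + 1) * z ^ n - 2 * ((n : K) * lco l n * z ^ n)) +
      l * (lco l n * z ^ n) = 0 := by
    intro n
    have := lco_rec l n
    linear_combination z ^ n * this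
  simp only [hz0] at tot
  have := tot.unique hasSum_zero
  change z * SS2 l z - z ^ 2 * SS2 l z + (SS1 l z - 2 * (z * SS1 l z)) + l * SS l z = 0 at this
  linear_combination this

/-- Growth of the Legendre series at the singular point. -/
lemma SS_bound {K : Type*} [RCLike K] (l : K) {z : K} (hz : ‖z‖ < 1) {d : ℝ} (hd : 0 < d) :
    ‖SS l z‖ ≤ (lC ‖l‖ * (1 + 1 / d)) * (1 - ‖z‖) ^ (-d) := by
  have hC := lC_pos (norm_nonneg l)
  have hlog := Real.hasSum_pow_div_log_of_abs_lt_one (x := ‖z‖) (by simpa using hz)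
  have h1 : ‖SS l z‖ ≤ 1 + lC ‖l‖ * (-Real.log (1 - ‖z‖)) := by
    have hs := SS_summable l hz
    unfold SS
    rw [hs.tsum_eq_zero_add]
    refine (norm_add_le _ _).trans ?_
    gcongr
    · simp [lco]
    · refine tsum_of_norm_bounded (hlog.mul_left (lC ‖l‖)) fun n => ?_
      rw [norm_mul, norm_pow]
      have := lco_bound_succ' l n
      rw [mul_div_assoc', le_div_iff₀ (by positivity)]
      calc _ = (((n : ℝ) + 1) * ‖lco l (n + 1)‖) * ‖z‖ ^ (n + 1) := by ring
        _ ≤ _ := by gcongr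
  have hy : 0 < 1 - ‖z‖ := by linarith
  have h2 : -Real.log (1 - ‖z‖) ≤ (1 - ‖z‖) ^ (-d) / d := by
    have := Real.log_le_rpow_div (x := (1 - ‖z‖)⁻¹) (by positivity) hd
    rwa [Real.log_inv, Real.inv_rpow hy.le, ← Real.rpow_neg hy.le] at this
  have h3 : 1 ≤ (1 - ‖z‖) ^ (-d) :=
    Real.one_le_rpow_of_pos_of_le_one_of_nonpos hy (by linarith [norm_nonneg z]) (by linarith)
  have hC1 : 1 ≤ lC ‖l‖ := by unfold lC; have := norm_nonneg l; nlinarith [Real.exp_pos ‖l‖]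
  calc ‖SS l z‖ ≤ 1 + lC ‖l‖ * (-Real.log (1 - ‖z‖)) := h1
    _ ≤ lC ‖l‖ * (1 - ‖z‖) ^ (-d) + lC ‖l‖ * ((1 - ‖z‖) ^ (-d) / d) := by
        gcongr; nlinarith
    _ = _ := by ring

lemma SS1_bound {K : Type*} [RCLike K] (l : K) {z : K} (hz : ‖z‖ < 1) :
    ‖SS1 l z‖ ≤ lC ‖l‖ / (1 - ‖z‖) := by
  have := (hasSum_geometric_of_lt_one (norm_nonneg z) hz).mul_left (lC ‖l‖)
  rw [div_eq_mul_inv]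
  refine tsum_of_norm_bounded this fun n => ?_
  rw [norm_mul, norm_pow]
  gcongr
  exact lco_bound1 l n

lemma SS_ofReal (l z : ℝ) : ((SS l z : ℝ) : ℂ) = SS (l : ℂ) (z : ℂ) := by
  unfold SS
  rw [Complex.ofReal_tsum]
  refine tsum_congr fun n => ?_
  rw [Complex.ofReal_mul, lco_ofReal]; simp

lemma legendreP_eq (ν x : ℂ) : legendreP ν x = SS (ν * (ν + 1)) ((1 - x) / 2) := by
  unfold legendreP SS
  rw [ordinaryHypergeometric_eq_tsum]
  refine tsum_congr fun n => ?_
  rw [smul_eq_mul]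
  congr 1
  induction n with
  | zero => simp [lco]
  | succ n ih =>
    rw [lco_succ, ← ih, ascPochhammer_succ_eval, ascPochhammer_succ_eval, ascPochhammer_succ_eval,
      Nat.factorial_succ]
    have h1 : (n : ℂ) + 1 ≠ 0 := by exact_mod_cast Nat.succ_ne_zero n
    have h2 : ((n.factorial : ℕ) : ℂ) ≠ 0 := by exact_mod_cast Nat.factorial_ne_zero n
    have h3 : (ascPochhammer ℂ n).eval 1 ≠ 0 := by
      rw [ascPochhammer_eval_one]; exact h2
    have h4 : (1 : ℂ) + n ≠ 0 := by rwa [add_comm]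
    push_cast
    field_simp
    ring

end L3


namespace L3

open Set Filter Topology

lemma para_deriv {G G' : ℝ → ℝ → ℝ} {U : Set ℝ} (hU : IsOpen U) (a b : ℝ)
    (hG : ContinuousOn (fun p : ℝ × ℝ => G p.1 p.2) (U ×ˢ univ))
    (hG' : ContinuousOn (fun p : ℝ × ℝ => G' p.1 p.2) (U ×ˢ univ))
    (hd : ∀ θ ∈ U, ∀ φ, HasDerivAt (fun t => G t φ) (G' θ φ) θ) {θ₀ : ℝ} (h0 : θ₀ ∈ U) :
    HasDerivAt (fun t => ∫ φ in a..b, G t φ) (∫ φ in a..b, G' θ₀ φ) θ₀ := by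
  obtain ⟨ε, hε, hball⟩ := Metric.isOpen_iff.1 hU θ₀ h0
  have hsub : Metric.closedBall θ₀ (ε / 2) ⊆ U :=
    (Metric.closedBall_subset_ball (by linarith)).trans hball
  have hK : IsCompact (Metric.closedBall θ₀ (ε / 2) ×ˢ uIcc a b) :=
    (isCompact_closedBall _ _).prod isCompact_uIcc
  obtain ⟨C, hC⟩ := hK.exists_bound_of_continuousOn
    (hG'.mono (prod_mono hsub (subset_univ _)))
  have hc : ∀ θ ∈ U, Continuous (fun φ => G θ φ) := fun θ hθ =>
    hG.comp_continuous (f := fun φ => (θ, φ)) (by fun_prop) (fun φ => ⟨hθ, mem_univ _⟩)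
  have hc' : ∀ θ ∈ U, Continuous (fun φ => G' θ φ) := fun θ hθ =>
    hG'.comp_continuous (f := fun φ => (θ, φ)) (by fun_prop) (fun φ => ⟨hθ, mem_univ _⟩)
  refine (intervalIntegral.hasDerivAt_integral_of_dominated_loc_of_deriv_le
    (F := G) (F' := G') (bound := fun _ => C)
    (s := Metric.closedBall θ₀ (ε / 2)) (Metric.closedBall_mem_nhds _ (by positivity))
    ?_ ?_ ?_ ?_ ?_ ?_).2
  · filter_upwards [hU.mem_nhds h0] with θ hθ
    exact (hc θ hθ).aestronglyMeasurable
  · exact (hc θ₀ h0).intervalIntegrable _ _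
  · exact (hc' θ₀ h0).aestronglyMeasurable
  · refine Filter.Eventually.of_forall fun t ht x hx => hC (x, t) ⟨hx, uIoc_subset_uIcc ht⟩
  · exact intervalIntegrable_const
  · exact Filter.Eventually.of_forall fun t ht x hx => hd x (hsub hx) t

/-- the argument of the addition formula -/
noncomputable def zz (η θ φ : ℝ) : ℝ :=
  (1 - (Real.cos θ * Real.cos η + Real.sin θ * Real.sin η * Real.cos φ)) / 2

noncomputable def zz1 (η θ φ : ℝ) : ℝ :=
  (Real.sin θ * Real.cos η - Real.cos θ * Real.sin η * Real.cos φ) / 2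

noncomputable def zz2 (η θ φ : ℝ) : ℝ :=
  (Real.cos θ * Real.cos η + Real.sin θ * Real.sin η * Real.cos φ) / 2

lemma one_sub_zz (η θ φ : ℝ) : 1 - zz η θ φ = ((1 + Real.cos φ) / 2 * (1 + Real.cos (θ - η)) +
    (1 - Real.cos φ) / 2 * (1 + Real.cos (θ + η))) / 2 := by
  rw [Real.cos_sub, Real.cos_add, zz]; ring

lemma zz_nonneg (η θ φ : ℝ) : 0 ≤ zz η θ φ := by
  have h : zz η θ φ = ((1 + Real.cos φ) / 2 * (1 - Real.cos (θ - η)) +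
    (1 - Real.cos φ) / 2 * (1 - Real.cos (θ + η))) / 2 := by
    rw [Real.cos_sub, Real.cos_add, zz]; ring
  rw [h]
  have h1 := Real.cos_le_one φ
  have h2 := Real.neg_one_le_cos φ
  have h3 := Real.cos_le_one (θ - η)
  have h4 := Real.cos_le_one (θ + η)
  have := mul_nonneg (by linarith : 0 ≤ (1 + Real.cos φ) / 2) (sub_nonneg.2 h3)
  have := mul_nonneg (by linarith : 0 ≤ (1 - Real.cos φ) / 2) (sub_nonneg.2 h4)
  linarith

lemma cos_gt_neg_one {t : ℝ} (h1 : -π < t) (h2 : t < π) : 0 < 1 + Real.cos t := by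
  rw [← Real.cos_abs]
  have h : |t| < π := abs_lt.2 ⟨h1, h2⟩
  have := Real.strictAntiOn_cos ⟨abs_nonneg t, h.le⟩ ⟨Real.pi_pos.le, le_refl _⟩ h
  rw [Real.cos_pi] at this
  linarith

lemma zz_lt_one {η θ φ : ℝ} (hη : 0 < η) (hθ : θ ∈ Ioo (-(π - η)) (π - η)) : zz η θ φ < 1 := by
  have h := one_sub_zz η θ φ
  have a1 := cos_gt_neg_one (t := θ - η) (by linarith [hθ.1]) (by linarith [hθ.2])
  have a2 := cos_gt_neg_one (t := θ + η) (by linarith [hθ.1]) (by linarith [hθ.2])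
  have h1 := Real.cos_le_one φ
  have h2 := Real.neg_one_le_cos φ
  rcases le_total 0 (Real.cos φ) with h3 | h3
  · have := mul_pos (by linarith : 0 < (1 + Real.cos φ) / 2) a1
    have := mul_nonneg (by linarith : 0 ≤ (1 - Real.cos φ) / 2) a2.le
    linarith
  · have := mul_nonneg (by linarith : 0 ≤ (1 + Real.cos φ) / 2) a1.le
    have := mul_pos (by linarith : 0 < (1 - Real.cos φ) / 2) a2
    linarith

lemma zz_norm {η θ φ : ℝ} (hη : 0 < η) (hθ : θ ∈ Ioo (-(π - η)) (π - η)) : ‖zz η θ φ‖ < 1 := by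
  rw [Real.norm_of_nonneg (zz_nonneg _ _ _)]; exact zz_lt_one hη hθ

lemma zz_hasDerivAt (η θ φ : ℝ) : HasDerivAt (fun t => zz η t φ) (zz1 η θ φ) θ := by
  unfold zz zz1
  have h1 := (Real.hasDerivAt_cos θ).mul_const (Real.cos η)
  have h2 := ((Real.hasDerivAt_sin θ).mul_const (Real.sin η)).mul_const (Real.cos φ)
  refine (((h1.add h2).const_sub 1).div_const 2).congr_deriv ?_
  ring

lemma zz1_hasDerivAt (η θ φ : ℝ) : HasDerivAt (fun t => zz1 η t φ) (zz2 η θ φ) θ := by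
  unfold zz1 zz2
  have h1 := (Real.hasDerivAt_sin θ).mul_const (Real.cos η)
  have h2 := ((Real.hasDerivAt_cos θ).mul_const (Real.sin η)).mul_const (Real.cos φ)
  refine ((h1.sub h2).div_const 2).congr_deriv ?_
  ring

lemma zz_hasDerivAt_phi (η θ φ : ℝ) : HasDerivAt (fun t => zz η θ t)
    (Real.sin θ * (Real.sin η * Real.sin φ / 2)) φ := by
  unfold zz
  have h2 := (Real.hasDerivAt_cos φ).const_mul (Real.sin θ * Real.sin η)
  refine (((h2.const_add (Real.cos θ * Real.cos η)).const_sub 1).div_const 2).congr_deriv ?_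
  ring

lemma zz_cont (η : ℝ) : Continuous (fun p : ℝ × ℝ => zz η p.1 p.2) := by
  unfold zz; fun_prop
lemma zz1_cont (η : ℝ) : Continuous (fun p : ℝ × ℝ => zz1 η p.1 p.2) := by
  unfold zz1; fun_prop
lemma zz2_cont (η : ℝ) : Continuous (fun p : ℝ × ℝ => zz2 η p.1 p.2) := by
  unfold zz2; fun_prop

lemma comp_zz_cont {f : ℝ → ℝ} (hf : ∀ z : ℝ, ‖z‖ < 1 → ContinuousAt f z) {η : ℝ} (hη : 0 < η) :
    ContinuousOn (fun p : ℝ × ℝ => f (zz η p.1 p.2)) (Ioo (-(π - η)) (π - η) ×ˢ univ) := by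
  intro p hp
  exact ((hf _ (zz_norm hη hp.1)).comp (f := fun p : ℝ × ℝ => zz η p.1 p.2)
    (zz_cont η).continuousAt).continuousWithinAt

lemma SS_cA (l : ℝ) (z : ℝ) (hz : ‖z‖ < 1) : ContinuousAt (SS l) z :=
  (SS_hasDerivAt l hz).continuousAt
lemma SS1_cA (l : ℝ) (z : ℝ) (hz : ‖z‖ < 1) : ContinuousAt (SS1 l) z :=
  (SS1_hasDerivAt l hz).continuousAt
lemma SS2_cA (l : ℝ) (z : ℝ) (hz : ‖z‖ < 1) : ContinuousAt (SS2 l) z :=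
  SS2_hasDerivAt_exists l hz

lemma lco_pos {l : ℝ} (hl : l < 0) (n : ℕ) : 0 < lco l n := by
  unfold lco
  refine Finset.prod_pos fun k _ => ?_
  have : (0 : ℝ) ≤ (k : ℝ) * (k + 1) := by positivity
  exact div_pos (by linarith) (by positivity)

lemma SS_ge_one {l : ℝ} (hl : l < 0) {z : ℝ} (h0 : 0 ≤ z) (h1 : z < 1) : 1 ≤ SS l z := by
  have hs := SS_summable l (z := z) (by rwa [Real.norm_of_nonneg h0])
  have := hs.le_tsum 0 (fun n _ => mul_nonneg (lco_pos hl n).le (pow_nonneg h0 n))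
  rwa [lco_zero, pow_zero, mul_one] at this

/-- product formula in the open region -/
lemma prod_formula_open {l : ℝ} (hl : l < 0) {η : ℝ} (hη : 0 < η) {θ : ℝ}
    (hθ : θ ∈ Ioo 0 (π - η)) :
    ∫ φ in (0 : ℝ)..π, SS l (zz η θ φ) =
      π * (SS l ((1 - Real.cos θ) / 2) * SS l ((1 - Real.cos η) / 2)) := by
  set U := Ioo (-(π - η)) (π - η) with hU
  have hUo : IsOpen U := isOpen_Ioo
  have h0U : (0 : ℝ) ∈ U := ⟨by linarith [hθ.1, hθ.2], by linarith [hθ.1, hθ.2]⟩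
  have cS := comp_zz_cont (SS_cA l) hη
  have cS1 := comp_zz_cont (SS1_cA l) hη
  have cS2 := comp_zz_cont (SS2_cA l) hη
  rw [← hU] at cS cS1 cS2
  let G1 : ℝ → ℝ → ℝ := fun θ φ => SS1 l (zz η θ φ) * zz1 η θ φ
  let G2 : ℝ → ℝ → ℝ := fun θ φ => SS2 l (zz η θ φ) * zz1 η θ φ * zz1 η θ φ +
    SS1 l (zz η θ φ) * zz2 η θ φ
  have cz1 : ContinuousOn (fun p : ℝ × ℝ => zz1 η p.1 p.2) (U ×ˢ univ) := (zz1_cont η).continuousOn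
  have cz2 : ContinuousOn (fun p : ℝ × ℝ => zz2 η p.1 p.2) (U ×ˢ univ) := (zz2_cont η).continuousOn
  have cG1 : ContinuousOn (fun p : ℝ × ℝ => G1 p.1 p.2) (U ×ˢ univ) := cS1.mul cz1
  have cG2 : ContinuousOn (fun p : ℝ × ℝ => G2 p.1 p.2) (U ×ˢ univ) :=
    ((cS2.mul cz1).mul cz1).add (cS1.mul cz2)
  let k : ℝ → ℝ := fun θ => ∫ φ in (0 : ℝ)..π, SS l (zz η θ φ)
  let k1 : ℝ → ℝ := fun θ => ∫ φ in (0 : ℝ)..π, G1 θ φ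
  let k2 : ℝ → ℝ := fun θ => ∫ φ in (0 : ℝ)..π, G2 θ φ
  have hk : ∀ t ∈ U, HasDerivAt k (k1 t) t := fun t ht =>
    para_deriv (G := fun θ φ => SS l (zz η θ φ)) (G' := G1) hUo 0 π cS cG1
      (fun t ht φ => (SS_hasDerivAt l (zz_norm hη ht)).comp (h := fun t => zz η t φ) t (zz_hasDerivAt η t φ)) ht
  have hk1 : ∀ t ∈ U, HasDerivAt k1 (k2 t) t := fun t ht =>
    para_deriv (G := G1) (G' := G2) hUo 0 π cG1 cG2
      (fun t ht φ => ((SS1_hasDerivAt l (zz_norm hη ht)).comp (h := fun t => zz η t φ) t (zz_hasDerivAt η t φ)).mul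
        (zz1_hasDerivAt η t φ)) ht
  have hsec : ∀ {H : ℝ → ℝ → ℝ}, ContinuousOn (fun p : ℝ × ℝ => H p.1 p.2) (U ×ˢ univ) →
      ∀ t ∈ U, Continuous (fun φ => H t φ) := fun hH t ht =>
    hH.comp_continuous (f := fun φ => (t, φ)) (by fun_prop) (fun φ => ⟨ht, mem_univ _⟩)
  have ode : ∀ t ∈ U, Real.sin t * k2 t + Real.cos t * k1 t + l * Real.sin t * k t = 0 := by
    intro t ht
    have i0 := (hsec (H := fun θ φ => SS l (zz η θ φ)) cS t ht).intervalIntegrable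
      (μ := volume) 0 π
    have i1 := (hsec cG1 t ht).intervalIntegrable (μ := volume) 0 π
    have i2 := (hsec cG2 t ht).intervalIntegrable (μ := volume) 0 π
    have e : Real.sin t * k2 t + Real.cos t * k1 t + l * Real.sin t * k t =
        ∫ φ in (0 : ℝ)..π, (Real.sin t * G2 t φ + Real.cos t * G1 t φ +
          l * Real.sin t * SS l (zz η t φ)) := by
      rw [intervalIntegral.integral_add ((i2.const_mul _).add (i1.const_mul _)) (i0.const_mul _),
        intervalIntegral.integral_add (i2.const_mul _) (i1.const_mul _),
        intervalIntegral.integral_const_mul, intervalIntegral.integral_const_mul,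
        intervalIntegral.integral_const_mul]
    rw [e]
    have hd : ∀ φ : ℝ, HasDerivAt (fun φ => -(SS1 l (zz η t φ) * (Real.sin η * Real.sin φ / 2)))
        (Real.sin t * G2 t φ + Real.cos t * G1 t φ + l * Real.sin t * SS l (zz η t φ)) φ := by
      intro φ
      have h1 := (SS1_hasDerivAt l (zz_norm (φ := φ) hη ht)).comp φ (zz_hasDerivAt_phi η t φ)
      have h2 := ((Real.hasDerivAt_sin φ).const_mul (Real.sin η)).div_const 2
      refine (h1.mul h2).neg.congr_deriv ?_
      have hode := SS_ode l (zz_norm (φ := φ) hη ht)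
      simp only [G1, G2, Function.comp]
      generalize SS2 l (zz η t φ) = s2 at *
      generalize SS1 l (zz η t φ) = s1 at *
      generalize SS l (zz η t φ) = s0 at *
      unfold zz at hode
      unfold zz1 zz2
      have a1 := Real.sin_sq_add_cos_sq t
      have a2 := Real.sin_sq_add_cos_sq η
      have a3 := Real.sin_sq_add_cos_sq φ
      generalize Real.sin t = st at *
      generalize Real.cos t = ct at *
      generalize Real.sin η = sh at *
      generalize Real.cos η = ch at *
      generalize Real.sin φ = sp at *
      generalize Real.cos φ = cp at *
      linear_combination (-st) * hode + s1 * sh * cp / 2 * a1 - s2 * st / 4 *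
        ((ch ^ 2 + sh ^ 2 * cp ^ 2) * a1 + sh ^ 2 * a3 + a2)
    rw [intervalIntegral.integral_eq_sub_of_hasDerivAt (fun φ _ => hd φ)]
    · simp
    · refine Continuous.intervalIntegrable ?_ _ _
      exact (((hsec cG2 t ht).const_mul _).add ((hsec cG1 t ht).const_mul _)).add
        ((hsec (H := fun θ φ => SS l (zz η θ φ)) cS t ht).const_mul _)
  -- the other solution
  let s : ℝ → ℝ := fun θ => SS l ((1 - Real.cos θ) / 2)
  let s1 : ℝ → ℝ := fun θ => SS1 l ((1 - Real.cos θ) / 2) * (Real.sin θ / 2)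
  let s2 : ℝ → ℝ := fun θ => SS2 l ((1 - Real.cos θ) / 2) * (Real.sin θ / 2) * (Real.sin θ / 2)
    + SS1 l ((1 - Real.cos θ) / 2) * (Real.cos θ / 2)
  have hzn : ∀ t ∈ U, 0 ≤ (1 - Real.cos t) / 2 ∧ (1 - Real.cos t) / 2 < 1 := by
    intro t ht
    have := cos_gt_neg_one (t := t) (by linarith [ht.1]) (by linarith [ht.2])
    have := Real.cos_le_one t
    constructor <;> linarith
  have hzn' : ∀ t ∈ U, ‖(1 - Real.cos t) / 2‖ < 1 := by
    intro t ht
    rw [Real.norm_of_nonneg (hzn t ht).1]; exact (hzn t ht).2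
  have hzd : ∀ t : ℝ, HasDerivAt (fun t => (1 - Real.cos t) / 2) (Real.sin t / 2) t := by
    intro t
    refine (((Real.hasDerivAt_cos t).const_sub 1).div_const 2).congr_deriv (by ring)
  have hs : ∀ t ∈ U, HasDerivAt s (s1 t) t := fun t ht =>
    (SS_hasDerivAt l (hzn' t ht)).comp (h := fun t => (1 - Real.cos t) / 2) t (hzd t)
  have hs1 : ∀ t ∈ U, HasDerivAt s1 (s2 t) t := fun t ht =>
    ((SS1_hasDerivAt l (hzn' t ht)).comp (h := fun t => (1 - Real.cos t) / 2) t (hzd t)).mul ((Real.hasDerivAt_sin t).div_const 2)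
  have odes : ∀ t ∈ U, Real.sin t * s2 t + Real.cos t * s1 t + l * Real.sin t * s t = 0 := by
    intro t ht
    have := SS_ode l (hzn' t ht)
    have a1 := Real.sin_sq_add_cos_sq t
    simp only [s, s1, s2]
    linear_combination Real.sin t * this +
      Real.sin t * SS2 l ((1 - Real.cos t) / 2) * a1 / 4
  have hW : ∀ t ∈ U, HasDerivAt (fun t => Real.sin t * (k1 t * s t - k t * s1 t)) 0 t := by
    intro t ht
    refine ((Real.hasDerivAt_sin t).mul (((hk1 t ht).mul (hs t ht)).sub
      ((hk t ht).mul (hs1 t ht)))).congr_deriv ?_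
    simp only [Pi.mul_apply, Pi.sub_apply]
    linear_combination s t * ode t ht - k t * odes t ht
  have hW0 : ∀ t ∈ U, Real.sin t * (k1 t * s t - k t * s1 t) = 0 := by
    intro t ht
    have := (convex_Ioo (-(π - η)) (π - η)).is_const_of_fderivWithin_eq_zero (𝕜 := ℝ)
      (f := fun t => Real.sin t * (k1 t * s t - k t * s1 t)) 
      (fun t ht => (hW t ht).differentiableAt.differentiableWithinAt)
      (fun t ht => by
        have := (hW t ht).hasFDerivAt.hasFDerivWithinAt (s := Ioo (-(π - η)) (π - η))
        rw [this.fderivWithin (isOpen_Ioo.uniqueDiffWithinAt ht)]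
        ext; simp) ht h0U
    simpa using this
  have hspos : ∀ t ∈ U, 0 < s t := fun t ht =>
    lt_of_lt_of_le one_pos (SS_ge_one hl (hzn t ht).1 (hzn t ht).2)
  have hsub : ∀ t ∈ Icc 0 θ, t ∈ U := fun t ht => ⟨by linarith [ht.1, hθ.1, hθ.2], by
    linarith [ht.2, hθ.2]⟩
  have hq : ∀ t ∈ U, HasDerivAt (fun t => k t / s t)
      ((k1 t * s t - k t * s1 t) / s t ^ 2) t := fun t ht =>
    (hk t ht).div (hs t ht) (hspos t ht).ne'
  obtain ⟨c, hc, hc'⟩ := exists_hasDerivAt_eq_slope (fun t => k t / s t)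
    (fun t => (k1 t * s t - k t * s1 t) / s t ^ 2) hθ.1
    (fun t ht => (hq t (hsub t ht)).continuousAt.continuousWithinAt)
    (fun t ht => hq t (hsub t (Ioo_subset_Icc_self ht)))
  have hsin : Real.sin c ≠ 0 := (Real.sin_pos_of_pos_of_lt_pi hc.1 (by linarith [hc.2, hθ.2])).ne'
  have hz := (mul_eq_zero.1 (hW0 c (hsub c (Ioo_subset_Icc_self hc)))).resolve_left hsin
  rw [hz, zero_div, eq_comm, div_eq_zero_iff, sub_zero] at hc'
  have heq := sub_eq_zero.1 (hc'.resolve_right hθ.1.ne')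
  have hsθ := hspos θ ⟨by linarith [hθ.1, hθ.2], hθ.2⟩
  have hk0 : k 0 = π * SS l ((1 - Real.cos η) / 2) := by
    simp [k, zz]
  have hs0 : s 0 = 1 := by simp [s, SS_zero]
  rw [hk0, hs0, div_one, div_eq_iff hsθ.ne'] at heq
  change k θ = _
  rw [heq]; simp only [s]; ring

end L3


namespace L3

open Set Filter Topology

lemma one_add_cos_ge {φ : ℝ} (h0 : 0 ≤ φ) (h1 : φ ≤ π) :
    2 * ((π - φ) / π) ^ 2 ≤ 1 + Real.cos φ := by
  have hs : (π - φ) / π ≤ Real.sin ((π - φ) / 2) := by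
    have := Real.mul_le_sin (x := (π - φ) / 2) (by linarith) (by linarith)
    refine le_trans (le_of_eq ?_) this
    field_simp
  have hc : 1 + Real.cos φ = 2 * Real.sin ((π - φ) / 2) ^ 2 := by
    rw [show (π - φ) / 2 = π / 2 - φ / 2 by ring, Real.sin_pi_div_two_sub, Real.cos_sq]
    ring_nf
  rw [hc]
  have : 0 ≤ (π - φ) / π := div_nonneg (by linarith) Real.pi_pos.le
  gcongr

lemma int_sub_rpow {r : ℝ} (hr : -1 < r) : IntervalIntegrable (fun φ : ℝ => (π - φ) ^ r) volume 0 π := by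
  have := (intervalIntegral.intervalIntegrable_rpow' (a := 0) (b := π) hr).comp_sub_left π
  simpa using this.symm

lemma SS_le_of_le {l : ℝ} {z y : ℝ} (h0 : 0 ≤ z) (hy : 0 < y) (h : y ≤ 1 - z) {d : ℝ} (hd : 0 < d) :
    ‖SS l z‖ ≤ (lC ‖l‖ * (1 + 1 / d)) * y ^ (-d) := by
  have hz : ‖z‖ < 1 := by rw [Real.norm_of_nonneg h0]; linarith
  have hC := lC_pos (norm_nonneg l)
  refine (SS_bound l hz hd).trans ?_
  rw [Real.norm_of_nonneg h0]
  have := Real.rpow_le_rpow_of_nonpos hy h (by linarith : -d ≤ 0)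
  gcongr

lemma prod_formula_aux {l : ℝ} (hl : l < 0) {η : ℝ} (hη : η ∈ Ioo 0 π) :
    IntervalIntegrable (fun φ => SS l (1 - Real.sin η ^ 2 * (1 + Real.cos φ) / 2)) volume 0 π ∧
    ∫ φ in (0 : ℝ)..π, SS l (1 - Real.sin η ^ 2 * (1 + Real.cos φ) / 2) =
      π * (SS l ((1 + Real.cos η) / 2) * SS l ((1 - Real.cos η) / 2)) := by
  have hs : 0 < Real.sin η := Real.sin_pos_of_pos_of_lt_pi hη.1 hη.2
  have hzeq : ∀ φ, zz η (π - η) φ = 1 - Real.sin η ^ 2 * (1 + Real.cos φ) / 2 := by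
    intro φ
    unfold zz
    rw [Real.cos_pi_sub, Real.sin_pi_sub]
    linear_combination (1 / 2) * Real.sin_sq_add_cos_sq η
  set c : ℝ := Real.sin η ^ 2 / (2 * π ^ 2) with hc
  have hcpos : 0 < c := by have := Real.pi_pos; positivity
  have hlow : ∀ θ φ : ℝ, Real.sin η / 2 ≤ Real.sin θ → φ ∈ Ioo 0 π →
      c * (π - φ) ^ 2 ≤ 1 - zz η θ φ := by
    intro θ φ hθ hφ
    have h1 := one_add_cos_ge hφ.1.le hφ.2.le
    have h2 : 1 - zz η θ φ = (1 + Real.cos (θ + η) + Real.sin θ * Real.sin η * (1 + Real.cos φ)) / 2 := by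
      rw [Real.cos_add, zz]; ring
    have h3 := Real.neg_one_le_cos (θ + η)
    have h4 : Real.sin η / 2 * Real.sin η * (2 * ((π - φ) / π) ^ 2) ≤
        Real.sin θ * Real.sin η * (1 + Real.cos φ) := by
      have : 0 ≤ Real.sin θ := by linarith
      gcongr
    have h5 : c * (π - φ) ^ 2 = Real.sin η / 2 * Real.sin η * (2 * ((π - φ) / π) ^ 2) / 2 := by
      rw [hc]; field_simp
    rw [h2, h5]; linarith
  have hbd : ∀ θ φ : ℝ, Real.sin η / 2 ≤ Real.sin θ → φ ∈ Ioo 0 π → ‖SS l (zz η θ φ)‖ ≤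
      (lC ‖l‖ * (1 + 1 / (1 / 4)) * c ^ (-(1 / 4) : ℝ)) * (π - φ) ^ (-(1 / 2) : ℝ) := by
    intro θ φ hθ hφ
    have hp : 0 < π - φ := sub_pos.2 hφ.2
    have := SS_le_of_le (l := l) (zz_nonneg η θ φ) (by positivity) (hlow θ φ hθ hφ)
      (d := 1 / 4) (by norm_num)
    refine this.trans (le_of_eq ?_)
    rw [Real.mul_rpow hcpos.le (by positivity), ← Real.rpow_natCast (π - φ) 2, ← Real.rpow_mul hp.le,
      mul_assoc _ (c ^ _)]
    norm_num
  have hbint : IntervalIntegrable (fun φ => (lC ‖l‖ * (1 + 1 / (1 / 4)) * c ^ (-(1 / 4) : ℝ)) *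
      (π - φ) ^ (-(1 / 2) : ℝ)) volume 0 π := (int_sub_rpow (by norm_num)).const_mul _
  have hlt : ∀ φ ∈ Ioo 0 π, zz η (π - η) φ < 1 := by
    intro φ hφ
    have := hlow (π - η) φ (by rw [Real.sin_pi_sub]; linarith) hφ
    have hp : 0 < π - φ := sub_pos.2 hφ.2
    have : 0 < c * (π - φ) ^ 2 := by positivity
    linarith
  have hnorm : ∀ φ ∈ Ioo 0 π, ‖zz η (π - η) φ‖ < 1 := fun φ hφ => by
    rw [Real.norm_of_nonneg (zz_nonneg _ _ _)]; exact hlt φ hφ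
  have hae : ∀ᵐ φ : ℝ, φ ∈ uIoc (0 : ℝ) π → φ ∈ Ioo 0 π := by
    filter_upwards [Measure.ae_ne volume π] with φ h1 h2
    rw [uIoc_of_le Real.pi_pos.le] at h2
    exact ⟨h2.1, lt_of_le_of_ne h2.2 h1⟩
  have hcz : ∀ θ, Continuous (fun φ => zz η θ φ) := fun θ =>
    (zz_cont η).comp (f := fun φ => (θ, φ)) (by fun_prop)
  have hmeas : AEStronglyMeasurable (fun φ => SS l (zz η (π - η) φ))
      (volume.restrict (uIoc (0 : ℝ) π)) := by
    rw [uIoc_of_le Real.pi_pos.le, ← restrict_Ioo_eq_restrict_Ioc]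
    refine ContinuousOn.aestronglyMeasurable (fun φ hφ => ?_) measurableSet_Ioo
    exact ((SS_cA l _ (hnorm φ hφ)).comp (f := fun φ => zz η (π - η) φ)
      (hcz _).continuousAt).continuousWithinAt
  have hsin0 : Real.sin η / 2 < Real.sin (π - η) := by rw [Real.sin_pi_sub]; linarith
  constructor
  · refine hbint.mono_fun ?_ ?_
    · simpa only [hzeq] using hmeas
    · rw [Filter.EventuallyLE, ae_restrict_iff' measurableSet_uIoc]
      filter_upwards [hae] with φ h1 h2
      rw [← hzeq]
      exact (hbd _ _ hsin0.le (h1 h2)).trans (le_abs_self _)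
  · have hev : ∀ᶠ θ in 𝓝[<] (π - η), θ ∈ Ioo 0 (π - η) :=
      Ioo_mem_nhdsLT (by linarith [hη.2])
    have hev2 : ∀ᶠ θ in 𝓝[<] (π - η), Real.sin η / 2 ≤ Real.sin θ :=
      nhdsWithin_le_nhds (Real.continuous_sin.continuousAt.eventually (lt_mem_nhds hsin0) |>.mono
        fun _ h => le_of_lt h)
    have lim1 : Tendsto (fun θ => ∫ φ in (0 : ℝ)..π, SS l (zz η θ φ)) (𝓝[<] (π - η))
        (𝓝 (∫ φ in (0 : ℝ)..π, SS l (zz η (π - η) φ))) := by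
      refine intervalIntegral.tendsto_integral_filter_of_dominated_convergence _ ?_ ?_ hbint ?_
      · filter_upwards [hev] with θ hθ
        refine Continuous.aestronglyMeasurable ?_
        refine continuous_iff_continuousAt.2 fun φ => ?_
        exact (SS_cA l _ (zz_norm hη.1 ⟨by linarith [hθ.1, hη.2], hθ.2⟩)).comp
          (f := fun φ => zz η θ φ) (hcz _).continuousAt
      · filter_upwards [hev2] with θ hθ
        filter_upwards [hae] with φ h1 h2 using hbd _ _ hθ (h1 h2)
      · filter_upwards [hae] with φ h1 h2
        refine Tendsto.comp (SS_cA l _ (hnorm φ (h1 h2))) ?_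
        exact ((zz_cont η).comp (f := fun θ => (θ, φ)) (by fun_prop)).continuousAt.mono_left
          nhdsWithin_le_nhds
    have lim2 : Tendsto (fun θ => ∫ φ in (0 : ℝ)..π, SS l (zz η θ φ)) (𝓝[<] (π - η))
        (𝓝 (π * (SS l ((1 - Real.cos (π - η)) / 2) * SS l ((1 - Real.cos η) / 2)))) := by
      have : Tendsto (fun θ => π * (SS l ((1 - Real.cos θ) / 2) * SS l ((1 - Real.cos η) / 2)))
          (𝓝[<] (π - η))
          (𝓝 (π * (SS l ((1 - Real.cos (π - η)) / 2) * SS l ((1 - Real.cos η) / 2)))) := by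
        refine Tendsto.const_mul _ (Tendsto.mul_const _ ?_)
        have hn : ‖(1 - Real.cos (π - η)) / 2‖ < 1 := by
          rw [Real.norm_of_nonneg (by linarith [Real.cos_le_one (π - η)])]
          linarith [cos_gt_neg_one (t := π - η) (by linarith [hη.2, Real.pi_pos]) (by linarith [hη.1])]
        exact ((SS_cA l _ hn).comp (f := fun θ => (1 - Real.cos θ) / 2) (by fun_prop)).tendsto.mono_left
          nhdsWithin_le_nhds
      refine this.congr' ?_
      filter_upwards [hev] with θ hθ
      rw [prod_formula_open hl hη.1 hθ]
    have := tendsto_nhds_unique lim1 lim2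
    simp only [hzeq] at this
    rw [this, Real.cos_pi_sub, sub_neg_eq_add]

end L3


namespace L3

open Set Filter Topology

/-- rising factorial -/
noncomputable def ph (a : ℝ) (n : ℕ) : ℝ := ∏ k ∈ Finset.range n, (a + k)

lemma ph_zero (a : ℝ) : ph a 0 = 1 := by simp [ph]
lemma ph_succ (a : ℝ) (n : ℕ) : ph a (n + 1) = ph a n * (a + n) := by
  rw [ph, ph, Finset.prod_range_succ]
lemma ph_pos {a : ℝ} (ha : 0 < a) (n : ℕ) : 0 < ph a n :=
  Finset.prod_pos fun k _ => by positivity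
lemma ph_succ_left (a : ℝ) (n : ℕ) : ph a (n + 1) = a * ph (a + 1) n := by
  rw [ph, ph, Finset.prod_range_succ']
  rw [mul_comm]
  congr 1
  · simp
  · refine Finset.prod_congr rfl fun k _ => ?_
    push_cast; ring
lemma ph_add (a : ℝ) (m n : ℕ) : ph a (m + n) = ph a m * ph (a + m) n := by
  induction n with
  | zero => simp [ph_zero]
  | succ n ih => rw [← add_assoc, ph_succ, ih, ph_succ]; push_cast; ring
lemma ph_one (n : ℕ) : ph 1 n = n.factorial := by
  induction n with
  | zero => simp [ph_zero]
  | succ n ih => rw [ph_succ, ih, Nat.factorial_succ]; push_cast; ring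

lemma Gamma_add_nat {a : ℝ} (ha : 0 < a) (n : ℕ) : Real.Gamma (a + n) = ph a n * Real.Gamma a := by
  induction n with
  | zero => simp [ph_zero]
  | succ n ih =>
    have : a + ((n + 1 : ℕ) : ℝ) = (a + n) + 1 := by push_cast; ring
    rw [this, Real.Gamma_add_one (by positivity), ih, ph_succ]; ring

lemma ph_eq_asc (a : ℝ) (n : ℕ) : (ascPochhammer ℝ n).eval a = ph a n := by
  induction n with
  | zero => simp [ph_zero]
  | succ n ih => rw [ascPochhammer_succ_eval, ih, ph_succ]

lemma choose_eq_ph (a : ℝ) (n : ℕ) : Ring.choose (a + n - 1) n = ph a n / n.factorial := by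
  rw [Ring.choose_eq_smul, Polynomial.descPochhammer_smeval_eq_ascPochhammer,
    Polynomial.ascPochhammer_smeval_cast, Polynomial.ascPochhammer_smeval_eq_eval, ← ph_eq_asc,
    smul_eq_mul, div_eq_inv_mul]
  congr 2
  ring

lemma binom_series (a : ℝ) {t : ℝ} (ht : |t| < 1) :
    HasSum (fun n : ℕ => ph a n / n.factorial * t ^ n) ((1 - t) ^ (-a)) := by
  have h := (Real.one_div_one_sub_rpow_hasFPowerSeriesOnBall_zero a).hasSum (y := t) (by
    simpa [← ofReal_norm] using ht)
  have h1 : 0 < 1 - t := by linarith [(abs_lt.1 ht).2]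
  simp only [FormalMultilinearSeries.ofScalars_apply_eq, zero_add, smul_eq_mul, choose_eq_ph] at h
  rwa [one_div, ← Real.rpow_neg h1.le] at h

lemma hasSum_integral_nonneg {X : Type*} [MeasurableSpace X] {μ : Measure X} {F : ℕ → X → ℝ}
    {f : X → ℝ} (hF : ∀ n, AEStronglyMeasurable (F n) μ) (h0 : ∀ n, ∀ᵐ x ∂μ, 0 ≤ F n x)
    (hf : Integrable f μ) (hs : ∀ᵐ x ∂μ, HasSum (fun n => F n x) (f x)) :
    HasSum (fun n => ∫ x, F n x ∂μ) (∫ x, f x ∂μ) := by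
  refine hasSum_integral_of_dominated_convergence F hF ?_ ?_ ?_ hs
  · intro n
    filter_upwards [h0 n] with x hx
    rw [Real.norm_of_nonneg hx]
  · filter_upwards [hs] with x hx using hx.summable
  · refine hf.congr ?_
    filter_upwards [hs] with x hx using hx.tsum_eq.symm

lemma beta_int {a b : ℝ} (ha : 0 < a) (hb : 0 < b) :
    IntegrableOn (fun t : ℝ => t ^ (a - 1) * (1 - t) ^ (b - 1)) (Ioo 0 1) ∧
    ∫ t in Ioo (0 : ℝ) 1, t ^ (a - 1) * (1 - t) ^ (b - 1) =
      Real.Gamma a * Real.Gamma b / Real.Gamma (a + b) := by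
  have hc := Complex.betaIntegral_convergent (u := a) (v := b) (by simpa) (by simpa)
  have heq : ∀ t ∈ Ioo (0 : ℝ) 1, (t : ℂ) ^ ((a : ℂ) - 1) * (1 - (t : ℂ)) ^ ((b : ℂ) - 1) =
      ((t ^ (a - 1) * (1 - t) ^ (b - 1) : ℝ) : ℂ) := by
    intro t ht
    rw [Complex.ofReal_mul, Complex.ofReal_cpow ht.1.le, Complex.ofReal_cpow (by linarith [ht.2])]
    push_cast; rfl
  rw [intervalIntegrable_iff_integrableOn_Ioo_of_le zero_le_one] at hc
  have hi : IntegrableOn (fun t : ℝ => t ^ (a - 1) * (1 - t) ^ (b - 1)) (Ioo 0 1) := by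
    have := (hc.congr_fun heq measurableSet_Ioo).re
    simpa [IntegrableOn] using this
  refine ⟨hi, ?_⟩
  have h2 := ProbabilityTheory.beta_eq_betaIntegralReal a b ha hb
  rw [ProbabilityTheory.beta, Complex.betaIntegral,
    intervalIntegral.integral_of_le zero_le_one, integral_Ioc_eq_integral_Ioo,
    setIntegral_congr_fun measurableSet_Ioo heq, integral_complex_ofReal, Complex.ofReal_re] at h2
  exact h2.symm

/-- Gauss's summation formula -/
lemma gauss {a b c : ℝ} (ha : 0 < a) (hb : 0 < b) (hc : a + b < c) :
    HasSum (fun n : ℕ => ph a n * ph b n / (ph c n * n.factorial))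
      (Real.Gamma c * Real.Gamma (c - a - b) / (Real.Gamma (c - a) * Real.Gamma (c - b))) := by
  have hcb : 0 < c - b := by linarith
  have h := hasSum_integral_nonneg (μ := volume.restrict (Ioo (0 : ℝ) 1))
    (F := fun n t => ph a n / n.factorial * (t ^ (b + n - 1) * (1 - t) ^ (c - b - 1)))
    (f := fun t => t ^ (b - 1) * (1 - t) ^ (c - a - b - 1)) ?_ ?_
    (beta_int hb (by linarith)).1 ?_
  · rw [(beta_int hb (by linarith)).2] at h
    have h2 : ∀ n : ℕ, ∫ t in Ioo (0 : ℝ) 1, ph a n / n.factorial *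
        (t ^ (b + n - 1) * (1 - t) ^ (c - b - 1)) = ph a n / n.factorial *
        (ph b n * Real.Gamma b * Real.Gamma (c - b) / (ph c n * Real.Gamma c)) := by
      intro n
      rw [MeasureTheory.integral_const_mul, (beta_int (by positivity) hcb).2, Gamma_add_nat hb,
        show b + n + (c - b) = c + n by ring, Gamma_add_nat (by linarith)]
    simp only [h2] at h
    have g1 := Real.Gamma_pos_of_pos (show 0 < c by linarith)
    have g2 := Real.Gamma_pos_of_pos hb
    have g3 := Real.Gamma_pos_of_pos hcb
    have g4 := Real.Gamma_pos_of_pos (show 0 < c - a by linarith)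
    have h3 := h.mul_left (Real.Gamma c / (Real.Gamma b * Real.Gamma (c - b)))
    have hv : Real.Gamma c / (Real.Gamma b * Real.Gamma (c - b)) *
        (Real.Gamma b * Real.Gamma (c - a - b) / Real.Gamma (b + (c - a - b))) =
        Real.Gamma c * Real.Gamma (c - a - b) / (Real.Gamma (c - a) * Real.Gamma (c - b)) := by
      rw [show b + (c - a - b) = c - a by ring]
      field_simp
    rw [hv] at h3
    refine HasSum_congr h3 fun n => ?_
    have := ph_pos (show 0 < c by linarith) n
    have : (0 : ℝ) < n.factorial := by positivity
    field_simp
  · intro n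
    exact ((beta_int (a := b + n) (by positivity) hcb).1.const_mul _).aestronglyMeasurable
  · intro n
    refine (ae_restrict_iff' measurableSet_Ioo).2 (Eventually.of_forall fun t ht => ?_)
    have h1 : 0 < 1 - t := by linarith [ht.2]
    have h2 := ht.1
    have := ph_pos ha n
    positivity
  · refine (ae_restrict_iff' measurableSet_Ioo).2 (Eventually.of_forall fun t ht => ?_)
    have h1 : 0 < 1 - t := by linarith [ht.2]
    have h := (binom_series a (t := t) (by rw [abs_of_pos ht.1]; exact ht.2)).mul_left
      (t ^ (b - 1) * (1 - t) ^ (c - b - 1))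
    have hv : t ^ (b - 1) * (1 - t) ^ (c - b - 1) * (1 - t) ^ (-a) =
        t ^ (b - 1) * (1 - t) ^ (c - a - b - 1) := by
      rw [mul_assoc, ← Real.rpow_add h1]; ring_nf
    rw [hv] at h
    refine HasSum_congr h fun n => ?_
    rw [show b + n - 1 = (b - 1) + n by ring, Real.rpow_add ht.1, Real.rpow_natCast]
    ring

/-- Vandermonde -/
lemma vander (a b : ℝ) (n : ℕ) :
    ∑ ij ∈ Finset.HasAntidiagonal.antidiagonal n, (n.choose ij.1 : ℝ) * (ph a ij.1 * ph b ij.2) = ph (a + b) n := by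
  induction n with
  | zero => simp [ph_zero]
  | succ n ih =>
    rw [Finset.sum_antidiagonal_choose_succ_mul (fun i j => ph a i * ph b j), ph_succ, ← ih,
      Finset.sum_mul, ← Finset.sum_add_distrib]
    refine Finset.sum_congr rfl fun ij hij => ?_
    have h := Finset.HasAntidiagonal.mem_antidiagonal.1 hij
    have h2 : (n : ℝ) = ij.1 + ij.2 := by exact_mod_cast h.symm
    have h3 : n.choose ij.2 = n.choose ij.1 := by
      rw [← h]; exact (Nat.choose_symm_add).symm
    rw [h3, ph_succ, ph_succ, h2]; ring

lemma vander' (a c : ℝ) (n : ℕ) :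
    ∑ ij ∈ Finset.HasAntidiagonal.antidiagonal n, (n.choose ij.1 : ℝ) * ((-1) ^ ij.1 * ph a ij.1 *
      ph (c + ij.1) ij.2) = ph (c - a) n := by
  induction n generalizing c with
  | zero => simp [ph_zero]
  | succ n ih =>
    rw [Finset.sum_antidiagonal_choose_succ_mul (fun i j => (-1) ^ i * ph a i * ph (c + i) j),
      ph_succ_left, show c - a + 1 = c + 1 - a by ring, ← ih,
      Finset.mul_sum, ← Finset.sum_add_distrib]
    refine Finset.sum_congr rfl fun ij hij => ?_
    have h := Finset.HasAntidiagonal.mem_antidiagonal.1 hij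
    have h3 : n.choose ij.2 = n.choose ij.1 := by
      rw [← h]; exact (Nat.choose_symm_add).symm
    rw [h3, ph_succ a, ph_succ_left (c + ij.1), show c + (ij.1 : ℝ) + 1 = c + 1 + ij.1 by ring]
    push_cast
    rw [show c + (ij.1 + 1) = c + 1 + (ij.1 : ℝ) by ring]
    ring

end L3

namespace L3

open Set Filter Topology

/-- the parameter -/
noncomputable def la (α : ℝ) : ℝ := (2 * α - 1) * (2 * α)

lemma la_neg {α : ℝ} (h0 : 0 < α) (h1 : α < 1 / 2) : la α < 0 := by unfold la; nlinarith

lemma lco_ph (α : ℝ) (n : ℕ) :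
    lco (la α) n = ph (1 - 2 * α) n * ph (2 * α) n / (n.factorial : ℝ) ^ 2 := by
  induction n with
  | zero => simp [lco_zero, ph_zero]
  | succ n ih =>
    rw [lco_succ, ih, ph_succ, ph_succ, Nat.factorial_succ, la]
    push_cast
    have : (0 : ℝ) < n.factorial := by positivity
    have : (0 : ℝ) < (n : ℝ) + 1 := by positivity
    field_simp
    ring

lemma SS_contOn (l : ℝ) : ContinuousOn (SS l) (Ioo 0 1) := fun z hz =>
  (SS_hasDerivAt l (by rw [Real.norm_of_nonneg hz.1.le]; exact hz.2)).continuousAt.continuousWithinAt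

lemma mh_int (l : ℝ) {σ : ℝ} (hσ : 0 < σ) :
    IntegrableOn (fun z : ℝ => SS l z * (z * (1 - z)) ^ (σ - 1)) (Ioo 0 1) := by
  have hb := (beta_int hσ (half_pos hσ)).1.const_mul (lC ‖l‖ * (1 + 1 / (σ / 2)))
  refine Integrable.mono' hb ?_ ?_
  · refine ContinuousOn.aestronglyMeasurable ?_ measurableSet_Ioo
    refine (SS_contOn l).mul (ContinuousOn.rpow_const (by fun_prop) fun z hz => Or.inl ?_)
    exact (mul_pos hz.1 (by linarith [hz.2])).ne'
  · refine (ae_restrict_iff' measurableSet_Ioo).2 (Eventually.of_forall fun z hz => ?_)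
    have h1 : 0 < 1 - z := by linarith [hz.2]
    have h0 := hz.1
    have h := SS_bound l (z := z) (by rw [Real.norm_of_nonneg hz.1.le]; exact hz.2) (half_pos hσ)
    rw [Real.norm_of_nonneg h0.le] at h
    rw [norm_mul, Real.norm_of_nonneg (show 0 ≤ (z * (1 - z)) ^ (σ - 1) by positivity)]
    calc _ ≤ _ := mul_le_mul_of_nonneg_right h (by positivity)
      _ = _ := by
        rw [Real.mul_rpow h0.le h1.le, show σ / 2 - 1 = - (σ / 2) + (σ - 1) by ring,
          Real.rpow_add h1]
        ring

/-- moments -/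
noncomputable def mh (l σ : ℝ) : ℝ := ∫ z in Ioo (0 : ℝ) 1, SS l z * (z * (1 - z)) ^ (σ - 1)

lemma mh_rec (l : ℝ) {σ : ℝ} (hσ : 0 < σ) :
    σ ^ 2 * mh l σ = (4 * σ ^ 2 + 2 * σ - l) * mh l (σ + 1) := by
  have hd : ∀ z ∈ Ioo (0 : ℝ) 1, HasDerivAt (fun z => (z * (1 - z)) ^ (σ + 1) * SS1 l z
      - σ * (1 - 2 * z) * ((z * (1 - z)) ^ σ * SS l z))
      ((4 * σ ^ 2 + 2 * σ - l) * (SS l z * (z * (1 - z)) ^ (σ + 1 - 1))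
        - σ ^ 2 * (SS l z * (z * (1 - z)) ^ (σ - 1))) z := by
    intro z hz
    have hn : ‖z‖ < 1 := by rw [Real.norm_of_nonneg hz.1.le]; exact hz.2
    have hv : 0 < z * (1 - z) := mul_pos hz.1 (by linarith [hz.2])
    have dv : HasDerivAt (fun z : ℝ => z * (1 - z)) (1 - 2 * z) z :=
      ((hasDerivAt_id z).mul ((hasDerivAt_id z).const_sub 1)).congr_deriv (by simp; ring)
    have e1 := (dv.rpow_const (p := σ + 1) (Or.inl hv.ne')).mul (SS1_hasDerivAt l hn)
    have e2 := ((((hasDerivAt_id z).const_mul 2).const_sub 1).const_mul σ).mul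
      ((dv.rpow_const (p := σ) (Or.inl hv.ne')).mul (SS_hasDerivAt l hn))
    refine (e1.sub e2).congr_deriv ?_
    have ode := SS_ode l hn
    have hp : (z * (1 - z)) ^ (σ + 1) = (z * (1 - z)) ^ (σ - 1) * ((z * (1 - z)) * (z * (1 - z))) := by
      rw [show σ + 1 = (σ - 1) + 1 + 1 by ring, Real.rpow_add hv, Real.rpow_add hv, Real.rpow_one,
        mul_assoc]
    have hp2 : (z * (1 - z)) ^ σ = (z * (1 - z)) ^ (σ - 1) * (z * (1 - z)) := by
      rw [← Real.rpow_add_one hv.ne']; ring_nf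
    simp only [Pi.mul_apply, id]
    rw [show σ + 1 - 1 = σ by ring, hp, hp2]
    generalize (z * (1 - z)) ^ (σ - 1) = w
    linear_combination (w * (z * (1 - z))) * ode
  have hi1 := mh_int l (σ := σ + 1) (by positivity)
  have hi0 := mh_int l hσ
  have hI : IntervalIntegrable (fun z => (4 * σ ^ 2 + 2 * σ - l) * (SS l z * (z * (1 - z)) ^ (σ + 1 - 1))
        - σ ^ 2 * (SS l z * (z * (1 - z)) ^ (σ - 1))) volume 0 1 := by
    rw [intervalIntegrable_iff_integrableOn_Ioo_of_le zero_le_one]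
    exact (hi1.const_mul _).sub (hi0.const_mul _)
  have t0 : Tendsto (fun z => (z * (1 - z)) ^ (σ + 1) * SS1 l z
      - σ * (1 - 2 * z) * ((z * (1 - z)) ^ σ * SS l z)) (𝓝[>] 0) (𝓝 0) := by
    have c0 : ContinuousAt (SS l) 0 := (SS_hasDerivAt l (z := (0 : ℝ)) (by simp)).continuousAt
    have c1 : ContinuousAt (SS1 l) 0 := (SS1_hasDerivAt l (z := (0 : ℝ)) (by simp)).continuousAt
    have cv : ∀ p : ℝ, 0 < p → ContinuousAt (fun z : ℝ => (z * (1 - z)) ^ p) 0 := fun p hp =>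
      ContinuousAt.rpow_const (by fun_prop) (Or.inr hp.le)
    have : ContinuousAt (fun z => (z * (1 - z)) ^ (σ + 1) * SS1 l z
      - σ * (1 - 2 * z) * ((z * (1 - z)) ^ σ * SS l z)) 0 := by
      refine ((cv _ (by positivity)).mul c1).sub (ContinuousAt.mul (by fun_prop) ((cv _ hσ).mul c0))
    have h := this.tendsto
    simp only [zero_mul, Real.zero_rpow hσ.ne', Real.zero_rpow (show σ + 1 ≠ 0 by positivity),
      mul_zero, sub_zero] at h
    exact h.mono_left nhdsWithin_le_nhds
  have t1 : Tendsto (fun z => (z * (1 - z)) ^ (σ + 1) * SS1 l z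
      - σ * (1 - 2 * z) * ((z * (1 - z)) ^ σ * SS l z)) (𝓝[<] 1) (𝓝 0) := by
    have hg : Tendsto (fun z : ℝ => lC ‖l‖ * (z * (1 - z)) ^ σ +
        σ * ((lC ‖l‖ * (1 + 1 / (σ / 2))) * (1 - z) ^ (σ / 2))) (𝓝[<] 1) (𝓝 0) := by
      have : ContinuousAt (fun z : ℝ => lC ‖l‖ * (z * (1 - z)) ^ σ +
        σ * ((lC ‖l‖ * (1 + 1 / (σ / 2))) * (1 - z) ^ (σ / 2))) 1 := by
        refine ((ContinuousAt.rpow_const (by fun_prop) (Or.inr hσ.le)).const_mul _).add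
          (((ContinuousAt.rpow_const (by fun_prop) (Or.inr (half_pos hσ).le)).const_mul _).const_mul _)
      have h := this.tendsto
      simp only [sub_self, mul_zero, Real.zero_rpow hσ.ne',
        Real.zero_rpow (half_pos hσ).ne', add_zero] at h
      exact h.mono_left nhdsWithin_le_nhds
    refine squeeze_zero_norm' ?_ hg
    filter_upwards [Ioo_mem_nhdsLT (show (0 : ℝ) < 1 by norm_num)] with z hz
    have hn : ‖z‖ < 1 := by rw [Real.norm_of_nonneg hz.1.le]; exact hz.2
    have h1 : 0 < 1 - z := by linarith [hz.2]
    have h0 := hz.1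
    have hv : 0 < z * (1 - z) := mul_pos h0 h1
    have hC := lC_pos (norm_nonneg l)
    refine (norm_sub_le _ _).trans (add_le_add ?_ ?_)
    · rw [norm_mul, Real.norm_of_nonneg (by positivity), Real.rpow_add_one hv.ne']
      have hb := SS1_bound l hn
      rw [Real.norm_of_nonneg h0.le] at hb
      calc _ ≤ (z * (1 - z)) ^ σ * (z * (1 - z)) * (lC ‖l‖ / (1 - z)) := by gcongr
        _ = z * (lC ‖l‖ * (z * (1 - z)) ^ σ) := by field_simp
        _ ≤ 1 * (lC ‖l‖ * (z * (1 - z)) ^ σ) := by gcongr; exact hz.2.le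
        _ = _ := one_mul _
    · have hb := SS_bound l hn (half_pos hσ)
      rw [Real.norm_of_nonneg h0.le] at hb
      rw [norm_mul, norm_mul, norm_mul, Real.norm_of_nonneg hσ.le,
        Real.norm_of_nonneg (show 0 ≤ (z * (1 - z)) ^ σ by positivity), mul_assoc]
      have h2 : ‖1 - 2 * z‖ ≤ 1 := by rw [Real.norm_eq_abs, abs_le]; constructor <;> linarith
      have h3 : (z * (1 - z)) ^ σ ≤ (1 - z) ^ σ := by gcongr; nlinarith
      calc _ ≤ σ * (1 * ((1 - z) ^ σ * ((lC ‖l‖ * (1 + 1 / (σ / 2))) * (1 - z) ^ (-(σ / 2))))) := by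
            gcongr
        _ = σ * ((lC ‖l‖ * (1 + 1 / (σ / 2))) * ((1 - z) ^ σ * (1 - z) ^ (-(σ / 2)))) := by ring
        _ = _ := by rw [← Real.rpow_add h1]; ring_nf
  have key := intervalIntegral.integral_eq_sub_of_hasDerivAt_of_tendsto zero_lt_one hd hI t0 t1
  rw [intervalIntegral.integral_of_le zero_le_one, integral_Ioc_eq_integral_Ioo,
    MeasureTheory.integral_sub (hi1.const_mul _) (hi0.const_mul _), MeasureTheory.integral_const_mul,
    MeasureTheory.integral_const_mul] at key
  unfold mh
  linarith

lemma mh_shift {α : ℝ} (h0 : 0 < α) (k : ℕ) :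
    4 ^ k * mh (la α) (α + k) = mh (la α) α * (ph α k ^ 2 / (ph (1 / 2) k * ph (2 * α) k)) := by
  induction k with
  | zero => simp [ph_zero]
  | succ k ih =>
    have h := mh_rec (la α) (σ := α + k) (by positivity)
    have e : 4 * (α + k) ^ 2 + 2 * (α + k) - la α = 4 * (1 / 2 + k) * (2 * α + k) := by
      unfold la; ring
    rw [e] at h
    have p1 := ph_pos (show (0 : ℝ) < 1 / 2 by norm_num) k
    have p2 := ph_pos (show (0 : ℝ) < 2 * α by positivity) k
    have q1 : (0 : ℝ) < 1 / 2 + k := by positivity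
    have q2 : (0 : ℝ) < 2 * α + k := by positivity
    rw [ph_succ, ph_succ, ph_succ, Nat.cast_succ, ← add_assoc]
    have h2 : mh (la α) (α + k + 1) = (α + k) ^ 2 * mh (la α) (α + k) / (4 * (1 / 2 + k) * (2 * α + k)) := by
      rw [eq_div_iff (by positivity)]; linarith
    rw [h2, pow_succ]
    calc _ = (4 ^ k * mh (la α) (α + k)) * ((α + k) ^ 2 / ((1 / 2 + k) * (2 * α + k))) := by
          field_simp
      _ = _ := by rw [ih]; field_simp

lemma mh_val {α : ℝ} (h0 : 0 < α) (h1 : α < 1 / 2) :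
    mh (la α) α = Real.Gamma α ^ 3 / (Real.Gamma (2 * α) ^ 2 * Real.Gamma (1 - α)) := by
  have h := hasSum_integral_nonneg (μ := volume.restrict (Ioo (0 : ℝ) 1))
    (F := fun n z => lco (la α) n * (z ^ (α + n - 1) * (1 - z) ^ (α - 1)))
    (f := fun z => SS (la α) z * (z * (1 - z)) ^ (α - 1)) ?_ ?_ (mh_int _ h0) ?_
  · have h2 : ∀ n : ℕ, ∫ t in Ioo (0 : ℝ) 1, lco (la α) n * (t ^ (α + n - 1) * (1 - t) ^ (α - 1)) =
        Real.Gamma α ^ 2 / Real.Gamma (2 * α) *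
          (ph (1 - 2 * α) n * ph α n / (ph 1 n * n.factorial)) := by
      intro n
      rw [MeasureTheory.integral_const_mul, (beta_int (by positivity) h0).2, Gamma_add_nat h0,
        show α + n + α = 2 * α + n by ring, Gamma_add_nat (by linarith), lco_ph, ph_one]
      have := ph_pos (show (0 : ℝ) < 2 * α by positivity) n
      have := Real.Gamma_pos_of_pos (show (0 : ℝ) < 2 * α by positivity)
      have : (0 : ℝ) < n.factorial := by positivity
      field_simp
    simp only [h2] at h
    have hg := (gauss (a := 1 - 2 * α) (b := α) (c := 1) (by linarith) h0 (by linarith)).mul_left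
      (Real.Gamma α ^ 2 / Real.Gamma (2 * α))
    have := h.unique hg
    rw [mh, this, Real.Gamma_one, show 1 - (1 - 2 * α) - α = α by ring,
      show 1 - (1 - 2 * α) = 2 * α by ring]
    have := Real.Gamma_pos_of_pos (show (0 : ℝ) < 2 * α by positivity)
    have := Real.Gamma_pos_of_pos (show (0 : ℝ) < 1 - α by linarith)
    field_simp
  · intro n
    exact ((beta_int (a := α + n) (by positivity) h0).1.const_mul _).aestronglyMeasurable
  · intro n
    refine (ae_restrict_iff' measurableSet_Ioo).2 (Eventually.of_forall fun t ht => ?_)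
    have h1 : 0 < 1 - t := by linarith [ht.2]
    have h2 := ht.1
    have := lco_pos (la_neg h0 (by assumption)) n
    positivity
  · refine (ae_restrict_iff' measurableSet_Ioo).2 (Eventually.of_forall fun t ht => ?_)
    have h1 : 0 < 1 - t := by linarith [ht.2]
    have h := (SS_summable (la α) (z := t)
      (by rw [Real.norm_of_nonneg ht.1.le]; exact ht.2)).hasSum.mul_right ((t * (1 - t)) ^ (α - 1))
    refine HasSum_congr h fun n => ?_
    rw [show α + n - 1 = (α - 1) + n by ring, Real.rpow_add ht.1, Real.rpow_natCast,
      Real.mul_rpow ht.1.le h1.le]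
    ring

end L3

namespace L3

open Set Filter Topology

lemma wallis (k : ℕ) : ∫ φ in (0 : ℝ)..π, ((1 + Real.cos φ) / 2) ^ k =
    π * (ph (1 / 2) k / k.factorial) := by
  have h1 : ∀ φ : ℝ, ((1 + Real.cos φ) / 2) ^ k = Real.cos (φ / 2) ^ (2 * k) := by
    intro φ
    rw [pow_mul, Real.cos_sq, show 2 * (φ / 2) = φ by ring]
    congr 1; ring
  simp only [h1]
  rw [intervalIntegral.integral_comp_div (fun x => Real.cos x ^ (2 * k)) (two_ne_zero), zero_div,
    EulerSine.integral_cos_pow_eq, integral_sin_pow_even, smul_eq_mul]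
  have : ∀ k : ℕ, ∏ i ∈ Finset.range k, ((2 : ℝ) * i + 1) / (2 * i + 2) = ph (1 / 2) k / k.factorial := by
    intro k
    induction k with
    | zero => simp [ph_zero]
    | succ k ih =>
      rw [Finset.prod_range_succ, ih, ph_succ, Nat.factorial_succ]
      push_cast
      have : (0 : ℝ) < k.factorial := by positivity
      field_simp
      ring
  rw [this]; ring

/-- coefficients -/
noncomputable def Tn (α : ℝ) (n : ℕ) : ℝ :=
  ∑ k ∈ Finset.range (n + 1), (n.choose k : ℝ) * (-1) ^ k * (ph α k ^ 2 / (ph (2 * α) k * k.factorial))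

lemma ph_ratio (α : ℝ) (k : ℕ) : ph (1 - α) k / k.factorial =
    ∑ j ∈ Finset.range (k + 1), (k.choose j : ℝ) * ((-1) ^ j * ph α j / j.factorial) := by
  rw [← vander' α 1 k, Finset.Nat.sum_antidiagonal_eq_sum_range_succ_mk, Finset.sum_div]
  refine Finset.sum_congr rfl fun j hj => ?_
  have hj' : j ≤ k := by simpa [Nat.lt_succ_iff] using hj
  have h := ph_add 1 j (k - j)
  rw [ph_one, ph_one, Nat.add_sub_cancel' hj'] at h
  have : (0 : ℝ) < k.factorial := by positivity
  have : (0 : ℝ) < j.factorial := by positivity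
  simp only
  rw [div_eq_iff (by positivity), h]
  field_simp

lemma Tn_eq {α : ℝ} (h0 : 0 < α) (n : ℕ) : ph (2 * α) n * Tn α n =
    ∑ kj ∈ Finset.HasAntidiagonal.antidiagonal n, (n.choose kj.1 : ℝ) *
      (ph α kj.1 * ph α kj.2 * (ph (1 - α) kj.1 / kj.1.factorial)) := by
  rw [Finset.Nat.sum_antidiagonal_eq_sum_range_succ_mk, Tn, Finset.mul_sum]
  have e1 : ∀ k ∈ Finset.range (n + 1), (n.choose k : ℝ) *
      (ph α k * ph α (n - k) * (ph (1 - α) k / k.factorial)) =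
      ∑ j ∈ Finset.range (n + 1), (n.choose k : ℝ) * (k.choose j) * (ph α k * ph α (n - k) *
        ((-1) ^ j * ph α j / j.factorial)) := by
    intro k hk
    rw [ph_ratio, Finset.mul_sum, Finset.mul_sum]
    have hsub : Finset.range (k + 1) ⊆ Finset.range (n + 1) := by
      apply Finset.range_mono
      exact Nat.succ_le_of_lt (by simpa using hk)
    refine Finset.sum_subset_zero_on_sdiff hsub ?_ ?_ 
    · intro j hj
      have : k < j := by
        simp only [Finset.mem_sdiff, Finset.mem_range] at hj
        omega
      rw [Nat.choose_eq_zero_of_lt this]; simp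
    · intro j hj; ring
  rw [Finset.sum_congr rfl e1, Finset.sum_comm]
  refine Finset.sum_congr rfl fun j hj => ?_
  have hj' : j ≤ n := by simpa [Nat.lt_succ_iff] using hj
  have e2 : ∑ k ∈ Finset.range (n + 1), (n.choose k : ℝ) * (k.choose j) * (ph α k * ph α (n - k) *
        ((-1) ^ j * ph α j / j.factorial)) = ∑ k ∈ Finset.Ico j (n + 1), (n.choose k : ℝ) * (k.choose j) *
        (ph α k * ph α (n - k) * ((-1) ^ j * ph α j / j.factorial)) := by
    symm
    refine Finset.sum_subset_zero_on_sdiff ?_ ?_ (fun _ _ => rfl)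
    · intro x hx; simp only [Finset.mem_Ico, Finset.mem_range] at *; omega
    · intro k hk
      have : k < j := by
        simp only [Finset.mem_sdiff, Finset.mem_range, Finset.mem_Ico] at hk
        omega
      rw [Nat.choose_eq_zero_of_lt this]; simp
  rw [e2, Finset.sum_Ico_eq_sum_range, show n + 1 - j = (n - j) + 1 by omega]
  have hv := vander (α + j) α (n - j)
  rw [Finset.Nat.sum_antidiagonal_eq_sum_range_succ_mk] at hv
  have e3 : ∀ i ∈ Finset.range (n - j + 1), (n.choose (j + i) : ℝ) * ((j + i).choose j) *
      (ph α (j + i) * ph α (n - (j + i)) * ((-1) ^ j * ph α j / j.factorial)) =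
      (n.choose j * ((-1) ^ j * ph α j ^ 2 / j.factorial)) *
      (((n - j).choose i : ℝ) * (ph (α + j) i * ph α (n - j - i))) := by
    intro i hi
    have hi' : i ≤ n - j := by simpa [Nat.lt_succ_iff] using hi
    have hc := Nat.choose_mul (n := n) (k := j + i) (s := j) (by omega)
    rw [Nat.add_sub_cancel_left] at hc
    have hc' : (n.choose (j + i) : ℝ) * ((j + i).choose j) = n.choose j * (n - j).choose i := by
      exact_mod_cast hc
    rw [hc', ph_add, show n - (j + i) = n - j - i by omega]
    ring
  rw [Finset.sum_congr rfl e3, ← Finset.mul_sum, hv]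
  have hp := ph_add (2 * α) j (n - j)
  rw [Nat.add_sub_cancel' hj'] at hp
  rw [hp, show α + j + α = 2 * α + j by ring]
  have := ph_pos (show (0 : ℝ) < 2 * α by positivity) j
  field_simp

lemma hasSum_prod_nonneg {g : ℕ → ℕ → ℝ} {r : ℕ → ℝ} {t : ℝ} (h0 : ∀ k j, 0 ≤ g k j)
    (h1 : ∀ k, HasSum (g k) (r k)) (h2 : HasSum r t) :
    HasSum (fun n : ℕ => ∑ kj ∈ Finset.HasAntidiagonal.antidiagonal n, g kj.1 kj.2) t := by
  have hs : Summable (fun p : ℕ × ℕ => g p.1 p.2) := by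
    refine (summable_prod_of_nonneg (fun p => h0 p.1 p.2)).2 ⟨fun k => (h1 k).summable, ?_⟩
    simp only [fun k => (h1 k).tsum_eq]
    exact h2.summable
  have hp : HasSum (fun p : ℕ × ℕ => g p.1 p.2) t := by
    have := hs.hasSum.prod_fiberwise h1
    rw [this.unique h2] at *
    have h3 := hs.hasSum
    rwa [(hs.hasSum.prod_fiberwise h1).unique h2] at h3
  have h3 := (Finset.HasAntidiagonal.sigmaAntidiagonalEquivProd (A := ℕ)).hasSum_iff.2 hp
  refine h3.sigma fun n => ?_
  simp only [Function.comp, Finset.HasAntidiagonal.sigmaAntidiagonalEquivProd_apply]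
  have := (Finset.HasAntidiagonal.antidiagonal n).hasSum (fun kj : ℕ × ℕ => g kj.1 kj.2)
  exact this

lemma sum_lco_Tn {α : ℝ} (h0 : 0 < α) (h1 : α < 1 / 2) :
    HasSum (fun n => lco (la α) n * Tn α n)
      ((Real.Gamma α / (Real.Gamma (2 * α) * Real.Gamma (1 - α))) ^ 2) := by
  have hp1 : ∀ k, 0 < ph (1 - 2 * α) k := ph_pos (by linarith)
  have hp2 : ∀ k, 0 < ph α k := ph_pos (by linarith)
  have hp3 : ∀ k, 0 < ph (1 - α) k := ph_pos (by linarith)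
  have hp4 : ∀ k, 0 < ph (2 * α) k := ph_pos (by linarith)
  have g1 := Real.Gamma_pos_of_pos (show (0 : ℝ) < 2 * α by positivity)
  have g2 := Real.Gamma_pos_of_pos (show (0 : ℝ) < 1 - α by linarith)
  have g3 := Real.Gamma_pos_of_pos h0
  have hf : ∀ k : ℕ, (0 : ℝ) < k.factorial := fun k => by positivity
  have h := hasSum_prod_nonneg (g := fun k j => ph (1 - 2 * α) (k + j) / (k + j).factorial *
      (ph α j / j.factorial) * (ph α k * ph (1 - α) k / (k.factorial : ℝ) ^ 2))
    (r := fun k => Real.Gamma α / (Real.Gamma (2 * α) * Real.Gamma (1 - α)) *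
      (ph (1 - 2 * α) k * ph α k / (ph 1 k * k.factorial)))
    (t := (Real.Gamma α / (Real.Gamma (2 * α) * Real.Gamma (1 - α))) ^ 2) ?_ ?_ ?_
  · refine HasSum_congr h fun n => ?_
    have hT := Tn_eq h0 n
    rw [lco_ph]
    calc _ = ph (1 - 2 * α) n / (n.factorial : ℝ) ^ 2 * (ph (2 * α) n * Tn α n) := by ring
      _ = _ := by
        rw [hT, Finset.mul_sum]
        refine Finset.sum_congr rfl fun kj hkj => ?_
        have hs : kj.1 + kj.2 = n := Finset.HasAntidiagonal.mem_antidiagonal.1 hkj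
        have hc : (n.choose kj.1 : ℝ) = n.factorial / (kj.1.factorial * kj.2.factorial) := by
          rw [← hs, Nat.choose_symm_add, Nat.add_choose, Nat.cast_div (Nat.factorial_mul_factorial_dvd_factorial_add _ _)]
          · push_cast; rfl
          · have := hf kj.1; have := hf kj.2; push_cast; positivity
        rw [hc, hs]
        have := hf n
        have := hf kj.1
        have := hf kj.2
        field_simp
  · intro k j
    have := hp1 (k + j); have := hp2 j; have := hp2 k; have := hp3 k
    positivity
  · intro k
    have hg := (gauss (a := 1 - 2 * α + k) (b := α) (c := 1 + k) (by linarith [(k.cast_nonneg : (0 : ℝ) ≤ k)]) h0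
      (by linarith)).mul_left (ph (1 - 2 * α) k / k.factorial * (ph α k * ph (1 - α) k / (k.factorial : ℝ) ^ 2))
    have e : ph (1 - 2 * α) k / k.factorial * (ph α k * ph (1 - α) k / (k.factorial : ℝ) ^ 2) *
        (Real.Gamma (1 + k) * Real.Gamma (1 + k - (1 - 2 * α + k) - α) /
          (Real.Gamma (1 + k - (1 - 2 * α + k)) * Real.Gamma (1 + k - α))) =
        Real.Gamma α / (Real.Gamma (2 * α) * Real.Gamma (1 - α)) *
      (ph (1 - 2 * α) k * ph α k / (ph 1 k * k.factorial)) := by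
      rw [show 1 + (k : ℝ) - (1 - 2 * α + k) = 2 * α by ring, show 2 * α - α = α by ring,
        show 1 + (k : ℝ) - α = (1 - α) + k by ring, Gamma_add_nat (a := 1 - α) (by linarith),
        Gamma_add_nat one_pos, Real.Gamma_one, ph_one]
      have := hf k; have := hp3 k
      field_simp
    rw [e] at hg
    refine HasSum_congr hg fun j => ?_
    have q := ph_add 1 k j
    rw [ph_one, ph_one] at q
    have := hf k; have := hf j
    have := ph_pos (show (0 : ℝ) < 1 + k by positivity) j
    rw [q, ph_add]
    field_simp
  · have hg := (gauss (a := 1 - 2 * α) (b := α) (c := 1) (by linarith) h0 (by linarith)).mul_left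
      (Real.Gamma α / (Real.Gamma (2 * α) * Real.Gamma (1 - α)))
    rw [Real.Gamma_one, show 1 - (1 - 2 * α) - α = α by ring,
      show 1 - (1 - 2 * α) = 2 * α by ring] at hg
    rw [one_mul] at hg
    rw [sq]
    exact hg

end L3

namespace L3

open Set Filter Topology

/-- polynomial -/
noncomputable def Qn (n : ℕ) (v : ℝ) : ℝ :=
  ∑ k ∈ Finset.range (n + 1), (n.choose k : ℝ) * (-1) ^ k * (ph (1 / 2) k / k.factorial) * (4 * v) ^ k

lemma Qn_int (n : ℕ) (v : ℝ) :
    ∫ φ in (0 : ℝ)..π, (1 - 4 * v * ((1 + Real.cos φ) / 2)) ^ n = π * Qn n v := by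
  have h : ∀ φ : ℝ, (1 - 4 * v * ((1 + Real.cos φ) / 2)) ^ n =
      ∑ k ∈ Finset.range (n + 1), ((n.choose k : ℝ) * (-1) ^ k * (4 * v) ^ k) *
        ((1 + Real.cos φ) / 2) ^ k := by
    intro φ
    rw [sub_eq_neg_add, add_pow]
    refine Finset.sum_congr rfl fun k _ => ?_
    rw [neg_pow, mul_pow, one_pow]; ring
  simp only [h]
  rw [intervalIntegral.integral_finsetSum]
  · simp only [intervalIntegral.integral_const_mul, wallis]
    rw [Qn, Finset.mul_sum]
    refine Finset.sum_congr rfl fun k _ => ?_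
    ring
  · intro k _
    apply Continuous.intervalIntegrable
    fun_prop

lemma prod_series {l : ℝ} (hl : l < 0) {z : ℝ} (hz : z ∈ Ioo (0 : ℝ) 1) :
    HasSum (fun n => lco l n * Qn n (z * (1 - z))) (SS l z * SS l (1 - z)) := by
  have hη : Real.arccos (1 - 2 * z) ∈ Ioo 0 π := by
    constructor
    · rw [Real.arccos_pos]; linarith [hz.1]
    · refine lt_of_le_of_ne (Real.arccos_le_pi _) fun h => ?_
      rw [Real.arccos_eq_pi] at h; linarith [hz.2]
  obtain ⟨hi, hv⟩ := prod_formula_aux hl hη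
  have hc : Real.cos (Real.arccos (1 - 2 * z)) = 1 - 2 * z :=
    Real.cos_arccos (by linarith [hz.2]) (by linarith [hz.1])
  have hs : Real.sin (Real.arccos (1 - 2 * z)) ^ 2 = 4 * (z * (1 - z)) := by
    rw [Real.sin_sq, hc]; ring
  rw [hc, hs] at hv
  simp only [hs] at hi
  rw [show (1 + (1 - 2 * z)) / 2 = 1 - z by ring, show (1 - (1 - 2 * z)) / 2 = z by ring] at hv
  have hpi := Real.pi_pos
  rw [intervalIntegrable_iff_integrableOn_Ioo_of_le hpi.le] at hi
  have hv0 : 0 < z * (1 - z) := mul_pos hz.1 (by linarith [hz.2])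
  have hv1 : 4 * (z * (1 - z)) ≤ 1 := by nlinarith [sq_nonneg (1 - 2 * z)]
  have hr : ∀ φ ∈ Ioo (0 : ℝ) π, 0 ≤ 1 - 4 * (z * (1 - z)) * ((1 + Real.cos φ) / 2) ∧
      1 - 4 * (z * (1 - z)) * ((1 + Real.cos φ) / 2) < 1 := by
    intro φ hφ
    have h1 := cos_gt_neg_one (by linarith [hφ.1]) hφ.2
    have h2 := Real.cos_le_one φ
    constructor
    · nlinarith
    · have : 0 < 4 * (z * (1 - z)) * ((1 + Real.cos φ) / 2) := by
        apply mul_pos (by positivity); linarith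
      linarith
  have h := hasSum_integral_nonneg (μ := volume.restrict (Ioo (0 : ℝ) π))
    (F := fun n φ => lco l n * (1 - 4 * (z * (1 - z)) * ((1 + Real.cos φ) / 2)) ^ n)
    (f := fun φ => SS l (1 - 4 * (z * (1 - z)) * (1 + Real.cos φ) / 2)) ?_ ?_ hi ?_
  · have h2 : ∀ n : ℕ, ∫ φ in Ioo (0 : ℝ) π, lco l n * (1 - 4 * (z * (1 - z)) * ((1 + Real.cos φ) / 2)) ^ n
        = π * (lco l n * Qn n (z * (1 - z))) := by
      intro n
      rw [MeasureTheory.integral_const_mul, ← integral_Ioc_eq_integral_Ioo,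
        ← intervalIntegral.integral_of_le hpi.le, Qn_int]
      ring
    simp only [h2] at h
    rw [← integral_Ioc_eq_integral_Ioo, ← intervalIntegral.integral_of_le hpi.le, hv] at h
    have h3 := h.mul_left π⁻¹
    simp only [inv_mul_cancel_left₀ hpi.ne'] at h3
    rwa [mul_comm (SS l (1 - z))] at h3
  · intro n
    exact (by fun_prop : Continuous _).aestronglyMeasurable
  · intro n
    refine (ae_restrict_iff' measurableSet_Ioo).2 (Eventually.of_forall fun t ht => ?_)
    have := lco_pos hl n
    have := (hr t ht).1
    positivity
  · refine (ae_restrict_iff' measurableSet_Ioo).2 (Eventually.of_forall fun t ht => ?_)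
    rw [show 1 - 4 * (z * (1 - z)) * (1 + Real.cos t) / 2 = 1 - 4 * (z * (1 - z)) * ((1 + Real.cos t) / 2) by ring]
    exact (SS_summable l (by rw [Real.norm_of_nonneg (hr t ht).1]; exact (hr t ht).2)).hasSum

lemma Qn_nonneg (n : ℕ) {z : ℝ} (hz : z ∈ Ioo (0 : ℝ) 1) : 0 ≤ Qn n (z * (1 - z)) := by
  have h := Qn_int n (z * (1 - z))
  have hpi := Real.pi_pos
  have h2 : 0 ≤ π * Qn n (z * (1 - z)) := by
    rw [← h]
    refine intervalIntegral.integral_nonneg hpi.le fun φ _ => pow_nonneg ?_ n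
    have h1 := Real.neg_one_le_cos φ
    have h2 := Real.cos_le_one φ
    have hv0 : 0 < z * (1 - z) := mul_pos hz.1 (by linarith [hz.2])
    have hv1 : 4 * (z * (1 - z)) ≤ 1 := by nlinarith [sq_nonneg (1 - 2 * z)]
    nlinarith
  exact nonneg_of_mul_nonneg_right h2 hpi

lemma Qn_moment {α : ℝ} (h0 : 0 < α) (n : ℕ) :
    IntegrableOn (fun z : ℝ => SS (la α) z * (z * (1 - z)) ^ (α - 1) * Qn n (z * (1 - z))) (Ioo 0 1) ∧
    ∫ z in Ioo (0 : ℝ) 1, SS (la α) z * (z * (1 - z)) ^ (α - 1) * Qn n (z * (1 - z)) =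
      mh (la α) α * Tn α n := by
  have he : ∀ z ∈ Ioo (0 : ℝ) 1, ∑ k ∈ Finset.range (n + 1), ((n.choose k : ℝ) * (-1) ^ k *
      (ph (1 / 2) k / k.factorial) * 4 ^ k) * (SS (la α) z * (z * (1 - z)) ^ (α + k - 1)) =
      SS (la α) z * (z * (1 - z)) ^ (α - 1) * Qn n (z * (1 - z)) := by
    intro z hz
    have hv0 : 0 < z * (1 - z) := mul_pos hz.1 (by linarith [hz.2])
    rw [Qn, Finset.mul_sum]
    refine Finset.sum_congr rfl fun k _ => ?_
    rw [show α + k - 1 = (α - 1) + k by ring, Real.rpow_add hv0, Real.rpow_natCast, mul_pow 4]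
    ring
  have hint : ∀ k : ℕ, IntegrableOn (fun z : ℝ => ((n.choose k : ℝ) * (-1) ^ k *
      (ph (1 / 2) k / k.factorial) * 4 ^ k) * (SS (la α) z * (z * (1 - z)) ^ (α + k - 1))) (Ioo 0 1) :=
    fun k => (mh_int (la α) (σ := α + k) (by positivity)).const_mul _
  constructor
  · refine IntegrableOn.congr_fun ?_ he measurableSet_Ioo
    exact integrable_finsetSum _ fun k _ => hint k
  · rw [← setIntegral_congr_fun measurableSet_Ioo he, integral_finsetSum _ fun k _ => hint k]
    rw [Tn, Finset.mul_sum]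
    refine Finset.sum_congr rfl fun k _ => ?_
    rw [MeasureTheory.integral_const_mul]
    have h := mh_shift h0 k
    rw [mh] at h
    have := ph_pos (show (0 : ℝ) < 1 / 2 by norm_num) k
    have := ph_pos (show (0 : ℝ) < 2 * α by positivity) k
    calc _ = (n.choose k : ℝ) * (-1) ^ k * (ph (1 / 2) k / k.factorial) * (4 ^ k *
        ∫ z in Ioo (0 : ℝ) 1, SS (la α) z * (z * (1 - z)) ^ (α + k - 1)) := by ring
      _ = _ := by rw [h]; field_simp

lemma b_val {α : ℝ} (h0 : 0 < α) (h1 : α < 1 / 2) :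
    ∫ z in Ioo (0 : ℝ) 1, SS (la α) z ^ 2 * SS (la α) (1 - z) * (z * (1 - z)) ^ (α - 1) =
      Real.Gamma α ^ 5 / (Real.Gamma (2 * α) ^ 4 * Real.Gamma (1 - α) ^ 3) := by
  have hl := la_neg h0 h1
  have hnn : ∀ n, ∀ z ∈ Ioo (0 : ℝ) 1, 0 ≤ lco (la α) n *
      (SS (la α) z * (z * (1 - z)) ^ (α - 1) * Qn n (z * (1 - z))) := by
    intro n z hz
    have hv0 : 0 < z * (1 - z) := mul_pos hz.1 (by linarith [hz.2])
    have := SS_ge_one hl hz.1.le hz.2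
    have := lco_pos hl n
    have := Qn_nonneg n hz
    positivity
  have hsum := (sum_lco_Tn h0 h1).mul_left (mh (la α) α)
  have hs : ∀ z ∈ Ioo (0 : ℝ) 1, HasSum (fun n => lco (la α) n *
      (SS (la α) z * (z * (1 - z)) ^ (α - 1) * Qn n (z * (1 - z))))
      (SS (la α) z ^ 2 * SS (la α) (1 - z) * (z * (1 - z)) ^ (α - 1)) := by
    intro z hz
    have h := (prod_series hl hz).mul_left (SS (la α) z * (z * (1 - z)) ^ (α - 1))
    rw [show SS (la α) z ^ 2 * SS (la α) (1 - z) * (z * (1 - z)) ^ (α - 1) =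
      SS (la α) z * (z * (1 - z)) ^ (α - 1) * (SS (la α) z * SS (la α) (1 - z)) by ring]
    exact HasSum_congr h fun n => by ring
  have hI : ∀ n, ∫ z in Ioo (0 : ℝ) 1, lco (la α) n *
      (SS (la α) z * (z * (1 - z)) ^ (α - 1) * Qn n (z * (1 - z))) =
      mh (la α) α * (lco (la α) n * Tn α n) := by
    intro n
    rw [MeasureTheory.integral_const_mul, (Qn_moment h0 n).2]; ring
  have hN : ∀ n, ∫ z in Ioo (0 : ℝ) 1, ‖lco (la α) n *
      (SS (la α) z * (z * (1 - z)) ^ (α - 1) * Qn n (z * (1 - z)))‖ =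
      mh (la α) α * (lco (la α) n * Tn α n) := by
    intro n
    rw [← hI n]
    exact setIntegral_congr_fun measurableSet_Ioo fun z hz => Real.norm_of_nonneg (hnn n z hz)
  have hint : ∀ n, IntegrableOn (fun z => lco (la α) n *
      (SS (la α) z * (z * (1 - z)) ^ (α - 1) * Qn n (z * (1 - z)))) (Ioo 0 1) :=
    fun n => (Qn_moment h0 n).1.const_mul _
  have hsm : Summable fun n => ∫ z in Ioo (0 : ℝ) 1, ‖lco (la α) n *
      (SS (la α) z * (z * (1 - z)) ^ (α - 1) * Qn n (z * (1 - z)))‖ := by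
    simp only [hN]; exact hsum.summable
  have key := hasSum_integral_of_summable_integral_norm hint hsm
  have hcong : ∀ z ∈ Ioo (0 : ℝ) 1, ∑' n, lco (la α) n *
      (SS (la α) z * (z * (1 - z)) ^ (α - 1) * Qn n (z * (1 - z))) =
      SS (la α) z ^ 2 * SS (la α) (1 - z) * (z * (1 - z)) ^ (α - 1) := fun z hz => (hs z hz).tsum_eq
  rw [setIntegral_congr_fun measurableSet_Ioo hcong] at key
  simp only [hI] at key
  rw [key.unique hsum, mh_val h0 h1]
  have := Real.Gamma_pos_of_pos (show (0 : ℝ) < 2 * α by positivity)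
  have := Real.Gamma_pos_of_pos (show (0 : ℝ) < 1 - α by linarith)
  field_simp

lemma SS_v_bound (l : ℝ) {d : ℝ} (hd : 0 < d) {z : ℝ} (hz : z ∈ Ioo (0 : ℝ) 1) :
    ‖SS l z‖ ≤ lC ‖l‖ * (1 + 1 / d) * (z * (1 - z)) ^ (-d) := by
  have h1 : 0 < 1 - z := by linarith [hz.2]
  exact SS_le_of_le hz.1.le (mul_pos hz.1 h1) (by nlinarith [hz.1]) hd

/-- integrability of triple products -/
lemma triple_int {α C : ℝ} (h0 : 0 < α) {f g h : ℝ → ℝ} (hf : ContinuousOn f (Ioo 0 1))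
    (hg : ContinuousOn g (Ioo 0 1)) (hh : ContinuousOn h (Ioo 0 1))
    (bf : ∀ z ∈ Ioo (0 : ℝ) 1, ‖f z‖ ≤ C * (z * (1 - z)) ^ (-(α / 6)))
    (bg : ∀ z ∈ Ioo (0 : ℝ) 1, ‖g z‖ ≤ C * (z * (1 - z)) ^ (-(α / 6)))
    (bh : ∀ z ∈ Ioo (0 : ℝ) 1, ‖h z‖ ≤ C * (z * (1 - z)) ^ (-(α / 6))) :
    IntegrableOn (fun z : ℝ => f z * g z * h z * (z * (1 - z)) ^ (α - 1)) (Ioo 0 1) := by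
  refine Integrable.mono' ((beta_int (half_pos h0) (half_pos h0)).1.const_mul (C ^ 3)) ?_ ?_
  · refine ContinuousOn.aestronglyMeasurable ?_ measurableSet_Ioo
    refine ((hf.mul hg).mul hh).mul (ContinuousOn.rpow_const (by fun_prop) fun z hz => Or.inl ?_)
    exact (mul_pos hz.1 (by linarith [hz.2])).ne'
  · refine (ae_restrict_iff' measurableSet_Ioo).2 (Eventually.of_forall fun z hz => ?_)
    have h1 : 0 < 1 - z := by linarith [hz.2]
    have hv := mul_pos hz.1 h1
    have e1 := bf z hz
    have e2 := bg z hz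
    have e3 := bh z hz
    have p1 := (norm_nonneg (f z)).trans e1
    rw [norm_mul, norm_mul, norm_mul, Real.norm_of_nonneg (show 0 ≤ (z * (1 - z)) ^ (α - 1) by positivity)]
    calc _ ≤ (C * (z * (1 - z)) ^ (-(α / 6))) * (C * (z * (1 - z)) ^ (-(α / 6))) *
          (C * (z * (1 - z)) ^ (-(α / 6))) * (z * (1 - z)) ^ (α - 1) := by gcongr
      _ = C ^ 3 * ((z * (1 - z)) ^ (-(α / 6)) * (z * (1 - z)) ^ (-(α / 6)) *
          (z * (1 - z)) ^ (-(α / 6)) * (z * (1 - z)) ^ (α - 1)) := by ring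
      _ = _ := by
        rw [← Real.rpow_add hv, ← Real.rpow_add hv, ← Real.rpow_add hv,
          ← Real.mul_rpow hz.1.le h1.le]
        ring_nf

end L3

namespace L3

open Set Filter Topology

/-- shift of horizontal lines -/
lemma shift_lines {G : ℂ → ℂ} {h : ℝ → ℝ} {a b : ℝ} (hab : a ≤ b)
    (hG : ∀ s : ℂ, s.im ∈ Icc a b → DifferentiableAt ℂ G s)
    (hb : ∀ r y : ℝ, r ≠ 0 → y ∈ Icc a b → ‖G (r + y * I)‖ ≤ h r) (hi : Integrable h)
    (h1 : Tendsto h atTop (𝓝 0)) (h2 : Tendsto h atBot (𝓝 0)) :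
    ∫ r : ℝ, G (r + a * I) = ∫ r : ℝ, G (r + b * I) := by
  have hint : ∀ y ∈ Icc a b, Integrable (fun r : ℝ => G (r + y * I)) := by
    intro y hy
    refine hi.mono' ?_ ?_
    rotate_left
    · filter_upwards [Measure.ae_ne volume (0 : ℝ)] with r hr using hb r y hr hy
    refine Continuous.aestronglyMeasurable (continuous_iff_continuousAt.2 fun r => ?_)
    exact ContinuousAt.comp (f := fun r : ℝ => (r : ℂ) + y * I) (hG _ (by simpa using hy)).continuousAt
      (by fun_prop)
  have key : ∀ R : ℝ, (∫ r in (-R)..R, G (r + a * I)) - (∫ r in (-R)..R, G (r + b * I)) =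
      I * (∫ y in a..b, G ((-R : ℝ) + y * I)) - I * (∫ y in a..b, G (R + y * I)) := by
    intro R
    have := Complex.integral_boundary_rect_eq_zero_of_differentiableOn G (⟨-R, a⟩) (⟨R, b⟩) (by
      intro s hs
      refine (hG s ?_).differentiableWithinAt
      have := hs.2
      simpa [uIcc_of_le hab] using this)
    simp only [smul_eq_mul] at this
    linear_combination this
  have t1 : Tendsto (fun R : ℝ => (∫ r in (-R)..R, G (r + a * I)) - (∫ r in (-R)..R, G (r + b * I))) atTop
      (𝓝 ((∫ r : ℝ, G (r + a * I)) - ∫ r : ℝ, G (r + b * I))) :=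
    (intervalIntegral_tendsto_integral (hint a ⟨le_rfl, hab⟩) tendsto_neg_atTop_atBot tendsto_id).sub
      (intervalIntegral_tendsto_integral (hint b ⟨hab, le_rfl⟩) tendsto_neg_atTop_atBot tendsto_id)
  have bnd : ∀ R : ℝ, R ≠ 0 → ‖∫ y in a..b, G (R + y * I)‖ ≤ h R * |b - a| := by
    intro R hR
    refine intervalIntegral.norm_integral_le_of_norm_le_const fun y hy => hb R y hR ?_
    rw [uIoc_of_le hab] at hy
    exact ⟨hy.1.le, hy.2⟩
  have t2 : Tendsto (fun R : ℝ => (∫ r in (-R)..R, G (r + a * I)) - (∫ r in (-R)..R, G (r + b * I))) atTop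
      (𝓝 0) := by
    simp only [key]
    have u1 : Tendsto (fun R : ℝ => I * (∫ y in a..b, G ((-R : ℝ) + y * I))) atTop (𝓝 0) := by
      have : Tendsto (fun R : ℝ => ∫ y in a..b, G ((-R : ℝ) + y * I)) atTop (𝓝 0) := by
        refine squeeze_zero_norm' ((eventually_ne_atTop 0).mono fun R hR => bnd (-R) (neg_ne_zero.2 hR)) ?_
        have := (h2.comp tendsto_neg_atTop_atBot).mul_const |b - a|
        simpa using this
      simpa using this.const_mul I
    have u2 : Tendsto (fun R : ℝ => I * (∫ y in a..b, G (R + y * I))) atTop (𝓝 0) := by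
      have : Tendsto (fun R : ℝ => ∫ y in a..b, G (R + y * I)) atTop (𝓝 0) := by
        refine squeeze_zero_norm' ((eventually_ne_atTop 0).mono fun R hR => bnd R hR) ?_
        have := h1.mul_const |b - a|
        simpa using this
      simpa using this.const_mul I
    simpa using u1.sub u2
  have := tendsto_nhds_unique t1 t2
  exact sub_eq_zero.1 this

/-- majorant -/
noncomputable def hw (m r : ℝ) : ℝ := Real.exp ((m + 1) * r) * (|1 - Real.exp r| ^ (-(1 / 2) : ℝ) *
  (1 + Real.exp r) ^ (-(1 / 2) : ℝ))

lemma hw_nonneg (m r : ℝ) : 0 ≤ hw m r := by unfold hw; positivity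

lemma hw_pos_eq (m : ℝ) {r : ℝ} (hr : 0 < r) :
    hw m r = Real.exp (m * r) * (1 - Real.exp (-(2 * r))) ^ (-(1 / 2) : ℝ) := by
  have h1 : 1 < Real.exp r := Real.one_lt_exp_iff.2 hr
  have h2 : Real.exp (-(2 * r)) < 1 := by rw [Real.exp_lt_one_iff]; linarith
  have e : |1 - Real.exp r| * (1 + Real.exp r) = Real.exp (2 * r) * (1 - Real.exp (-(2 * r))) := by
    rw [abs_of_neg (by linarith), mul_sub, ← Real.exp_add, two_mul, Real.exp_add]
    rw [show r + r + -(r + r) = 0 by ring, Real.exp_zero]; ring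
  unfold hw
  rw [← Real.mul_rpow (abs_nonneg _) (by positivity), e, Real.mul_rpow (by positivity) (by linarith),
    ← Real.exp_mul, ← mul_assoc, ← Real.exp_add]
  ring_nf

lemma hw_neg (m r : ℝ) : hw m (-r) = hw (-1 - m) r := by
  have e : |1 - Real.exp (-r)| * (1 + Real.exp (-r)) = Real.exp (-(2 * r)) * (|1 - Real.exp r| * (1 + Real.exp r)) := by
    have : 1 - Real.exp (-r) = - (Real.exp (-r) * (1 - Real.exp r)) := by
      rw [mul_sub, ← Real.exp_add]; simp
    rw [this, abs_neg, abs_mul, abs_of_pos (Real.exp_pos _)]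
    have : 1 + Real.exp (-r) = Real.exp (-r) * (1 + Real.exp r) := by
      rw [mul_add, ← Real.exp_add]; simp; ring
    rw [this, show -(2 * r) = -r + -r by ring, Real.exp_add]; ring
  unfold hw
  rw [← Real.mul_rpow (abs_nonneg _) (by positivity), e, Real.mul_rpow (by positivity) (by positivity),
    ← Real.exp_mul, ← mul_assoc, ← Real.exp_add, ← Real.mul_rpow (abs_nonneg _) (by positivity)]
  ring_nf

lemma one_sub_exp_ge {x : ℝ} (hx : 0 < x) : x / (1 + x) ≤ 1 - Real.exp (-x) := by
  have h := Real.add_one_le_exp x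
  rw [Real.exp_neg]
  have : (Real.exp x)⁻¹ ≤ (1 + x)⁻¹ := by gcongr; linarith
  have : x / (1 + x) = 1 - (1 + x)⁻¹ := by field_simp; ring
  linarith

lemma hw_bound (m : ℝ) {r : ℝ} (hr : 0 < r) :
    hw m r ≤ Real.exp (m * r) + Real.exp (m * r) * r ^ (-(1 / 2) : ℝ) := by
  rw [hw_pos_eq m hr, ← mul_one_add]
  gcongr
  have h := one_sub_exp_ge (show 0 < 2 * r by positivity)
  have h2 : r / (1 + r) ≤ 2 * r / (1 + 2 * r) := by
    rw [div_le_div_iff₀ (by positivity) (by positivity)]; nlinarith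
  have h3 : (1 - Real.exp (-(2 * r))) ^ (-(1 / 2) : ℝ) ≤ (r / (1 + r)) ^ (-(1 / 2) : ℝ) :=
    Real.rpow_le_rpow_of_nonpos (by positivity) (h2.trans h) (by norm_num)
  refine h3.trans ?_
  rw [Real.rpow_neg (by positivity), ← Real.inv_rpow (by positivity), inv_div, add_div, div_self hr.ne',
    Real.rpow_neg hr.le, ← Real.inv_rpow hr.le, add_comm, one_div r]
  refine (Real.rpow_add_le_add_rpow (by positivity) (by positivity) (by norm_num) (by norm_num)).trans ?_
  simp

lemma hw_int_pos {m : ℝ} (hm : m < 0) : IntegrableOn (hw m) (Ioi 0) := by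
  have i1 : IntegrableOn (fun r => Real.exp (m * r)) (Ioi 0) := integrableOn_exp_mul_Ioi hm 0
  have i2 : IntegrableOn (fun r : ℝ => Real.exp (m * r) * r ^ (-(1 / 2) : ℝ)) (Ioi 0) := by
    have := integrableOn_rpow_mul_exp_neg_mul_rpow (p := 1) (s := -(1 / 2)) (b := -m) (by norm_num) one_pos (by linarith)
    refine this.congr_fun (fun r hr => ?_) measurableSet_Ioi
    simp only [Real.rpow_one, neg_neg]; ring
  refine Integrable.mono' (i1.add i2) ?_ ?_
  · unfold hw
    exact (by fun_prop : Measurable _).aestronglyMeasurable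
  · refine (ae_restrict_iff' measurableSet_Ioi).2 (Eventually.of_forall fun r hr => ?_)
    rw [Real.norm_of_nonneg (hw_nonneg m r)]
    exact hw_bound m hr

lemma hw_int {m : ℝ} (h1 : -1 < m) (h2 : m < 0) : Integrable (hw m) := by
  rw [← integrableOn_univ, ← Iio_union_Ici (a := (0 : ℝ)), integrableOn_union, integrableOn_Ici_iff_integrableOn_Ioi]
  refine ⟨?_, hw_int_pos h2⟩
  have := hw_int_pos (m := -1 - m) (by linarith)
  have h3 := this.comp_neg
  have e : (fun x => hw (-1 - m) (-x)) = hw m := by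
    funext x; rw [← hw_neg, neg_neg]
  rw [e] at h3
  simpa using h3

lemma hw_top {m : ℝ} (hm : m < 0) : Tendsto (hw m) atTop (𝓝 0) := by
  have t : Tendsto (fun r : ℝ => Real.exp (m * r) * 2) atTop (𝓝 0) := by
    have : Tendsto (fun r : ℝ => Real.exp (m * r)) atTop (𝓝 0) :=
      Real.tendsto_exp_atBot.comp (tendsto_id.const_mul_atTop_of_neg hm)
    simpa using this.mul_const 2
  refine squeeze_zero' (Eventually.of_forall fun r => hw_nonneg m r) ?_ t
  filter_upwards [eventually_ge_atTop 1] with r hr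
  refine (hw_bound m (by linarith)).trans ?_
  have : r ^ (-(1 / 2) : ℝ) ≤ 1 := Real.rpow_le_one_of_one_le_of_nonpos hr (by norm_num)
  nlinarith [Real.exp_pos (m * r)]

lemma hw_bot {m : ℝ} (hm : -1 < m) : Tendsto (hw m) atBot (𝓝 0) := by
  have h := (hw_top (m := -1 - m) (by linarith)).comp tendsto_neg_atBot_atTop
  refine h.congr fun r => ?_
  simp only [Function.comp]
  rw [← hw_neg, neg_neg]

end L3

namespace L3

open Set Filter Topology

/-- Beta integrals on the line -/
noncomputable def bb (p : ℝ) (m : ℕ) (r : ℝ) : ℝ := Real.exp (p * r) / (1 + Real.exp r) ^ m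

lemma bb_cont (p : ℝ) (m : ℕ) : Continuous (bb p m) := by
  unfold bb
  refine Continuous.div (by fun_prop) (by fun_prop) fun r => ?_
  positivity

lemma bb_pos (p : ℝ) (m : ℕ) (r : ℝ) : 0 < bb p m r := by unfold bb; positivity

lemma bb_le1 (p : ℝ) (m : ℕ) (r : ℝ) : bb p m r ≤ Real.exp (p * r) := by
  unfold bb
  refine div_le_self (by positivity) (one_le_pow₀ ?_)
  linarith [Real.exp_pos r]

lemma bb_le2 (p : ℝ) (m : ℕ) (r : ℝ) : bb p m r ≤ Real.exp ((p - m) * r) := by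
  unfold bb
  rw [sub_mul, Real.exp_sub, Real.exp_nat_mul]
  gcongr
  linarith [Real.exp_pos r]

lemma bb_int {p : ℝ} {m : ℕ} (hp : 0 < p) (hm : p < m) : Integrable (bb p m) := by
  rw [← integrableOn_univ, ← Iic_union_Ioi (a := (0 : ℝ)), integrableOn_union]
  constructor
  · refine (integrableOn_exp_mul_Iic hp 0).mono' (bb_cont p m).aestronglyMeasurable
      (Eventually.of_forall fun r => ?_)
    rw [Real.norm_of_nonneg (bb_pos p m r).le]; exact bb_le1 p m r
  · refine (integrableOn_exp_mul_Ioi (show p - m < 0 by linarith) 0).mono' (bb_cont p m).aestronglyMeasurable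
      (Eventually.of_forall fun r => ?_)
    rw [Real.norm_of_nonneg (bb_pos p m r).le]; exact bb_le2 p m r

lemma bb_top {p : ℝ} {m : ℕ} (hm : p < m) : Tendsto (bb p m) atTop (𝓝 0) := by
  refine squeeze_zero (fun r => (bb_pos p m r).le) (bb_le2 p m) ?_
  exact Real.tendsto_exp_atBot.comp (tendsto_id.const_mul_atTop_of_neg (by linarith))

lemma bb_bot {p : ℝ} {m : ℕ} (hp : 0 < p) : Tendsto (bb p m) atBot (𝓝 0) := by
  refine squeeze_zero (fun r => (bb_pos p m r).le) (bb_le1 p m) ?_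
  exact Real.tendsto_exp_atBot.comp (tendsto_id.const_mul_atBot hp)

lemma bb_rec1 {p : ℝ} {m : ℕ} (hp : 0 < p) (hm : p < m) :
    m * ∫ r, bb (p + 1) (m + 1) r = p * ∫ r, bb p m r := by
  have hd : ∀ r, HasDerivAt (bb p m) (p * bb p m r - m * bb (p + 1) (m + 1) r) r := by
    intro r
    have e1 : HasDerivAt (fun r : ℝ => Real.exp (p * r)) (p * Real.exp (p * r)) r :=
      ((hasDerivAt_id r).const_mul p).exp.congr_deriv (by simp; ring)
    have e2 : HasDerivAt (fun r : ℝ => (1 + Real.exp r) ^ m) (m * (1 + Real.exp r) ^ (m - 1) * Real.exp r) r :=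
      ((Real.hasDerivAt_exp r).const_add 1).pow m
    have hpos : 0 < 1 + Real.exp r := by positivity
    refine (e1.div e2 (by positivity)).congr_deriv ?_
    unfold bb
    rw [add_mul, one_mul, Real.exp_add]
    rcases m with _ | m
    · simp
    · simp only [Nat.add_sub_cancel]
      field_simp
      ring
  have i1 := bb_int hp hm
  have i2 : Integrable (bb (p + 1) (m + 1)) := bb_int (by linarith) (by push_cast; linarith)
  have key := integral_of_hasDerivAt_of_tendsto hd ((i1.const_mul p).sub (i2.const_mul m)) (bb_bot hp) (bb_top hm)
  rw [MeasureTheory.integral_sub (i1.const_mul p) (i2.const_mul m), MeasureTheory.integral_const_mul,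
    MeasureTheory.integral_const_mul] at key
  linarith

lemma bb_rec2 {p : ℝ} {m : ℕ} (hp : 0 < p) (hm : p < m) :
    m * ∫ r, bb p (m + 1) r = (m - p) * ∫ r, bb p m r := by
  have i1 := bb_int hp hm
  have i2 : Integrable (bb (p + 1) (m + 1)) := bb_int (by linarith) (by push_cast; linarith)
  have e : ∀ r, bb p (m + 1) r = bb p m r - bb (p + 1) (m + 1) r := by
    intro r
    have hpos : 0 < 1 + Real.exp r := by positivity
    unfold bb
    rw [add_mul, one_mul, Real.exp_add]
    field_simp
    ring
  simp only [e]
  rw [MeasureTheory.integral_sub i1 i2, mul_sub, bb_rec1 hp hm]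
  ring

lemma bb_pos_int {p : ℝ} {m : ℕ} (hp : 0 < p) (hm : p < m) : 0 < ∫ r, bb p m r := by
  rw [integral_pos_iff_support_of_nonneg (fun r => (bb_pos p m r).le) (bb_int hp hm)]
  have : Function.support (bb p m) = univ := by
    ext r; simp [(bb_pos p m r).ne']
  rw [this]; simp

lemma bb_lco {m : ℝ} (h1 : -1 < m) (h2 : m < 0) (n : ℕ) :
    4 ^ n * (ph (1 / 2) n / n.factorial) * ∫ r, bb (m + 1 + n) (2 * n + 1) r =
      lco (m * (m + 1)) n * ∫ r, bb (m + 1) 1 r := by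
  induction n with
  | zero => simp [ph_zero, lco_zero]
  | succ n ih =>
    have hp : 0 < m + 1 + n := by linarith [(n.cast_nonneg : (0 : ℝ) ≤ n)]
    have hm : m + 1 + n < ((2 * n + 1 : ℕ) : ℝ) := by push_cast; linarith [(n.cast_nonneg : (0 : ℝ) ≤ n)]
    have r2 := bb_rec2 hp hm
    have r1 := bb_rec1 hp (m := 2 * n + 1 + 1) (by push_cast at *; linarith)
    rw [show m + 1 + ((n + 1 : ℕ) : ℝ) = m + 1 + n + 1 by push_cast; ring,
      show 2 * (n + 1) + 1 = 2 * n + 1 + 1 + 1 by ring, lco_succ, ph_succ, Nat.factorial_succ, pow_succ]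
    generalize ∫ r, bb (m + 1 + n + 1) (2 * n + 1 + 1 + 1) r = X at *
    generalize ∫ r, bb (m + 1 + n) (2 * n + 1 + 1) r = Y at *
    generalize ∫ r, bb (m + 1 + n) (2 * n + 1) r = Z at *
    push_cast at *
    have hn : (0 : ℝ) < n + 1 := by positivity
    have hY : Y = (2 * n + 1 - (m + 1 + n)) * Z / (2 * n + 1) := by
      rw [eq_div_iff (by positivity)]; linarith
    have hX : X = (m + 1 + n) * Y / (2 * n + 1 + 1) := by
      rw [eq_div_iff (by positivity)]; linarith
    have hf : (0 : ℝ) < n.factorial := by positivity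
    calc _ = (4 ^ n * (ph (1 / 2) n / n.factorial) * Z) * ((n * (n + 1) - m * (m + 1)) / (n + 1) ^ 2) := by
          rw [hX, hY]; field_simp; ring
      _ = _ := by rw [ih]; ring

/-- line integral -/
noncomputable def MM (m x : ℝ) : ℝ :=
  ∫ r : ℝ, Real.exp ((m + 1) * r) * (1 + 2 * x * Real.exp r + Real.exp r ^ 2) ^ (-(1 / 2) : ℝ)

lemma quad_ge {x : ℝ} (hx : x ∈ Ioo (-1 : ℝ) 1) (e : ℝ) :
    (1 + x) / 2 * (1 + e) ^ 2 ≤ 1 + 2 * x * e + e ^ 2 := by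
  nlinarith [mul_nonneg (show 0 ≤ 1 - x by linarith [hx.2]) (sq_nonneg (1 - e))]

lemma MM_eq {m : ℝ} (h1 : -1 < m) (h2 : m < 0) {x : ℝ} (hx : x ∈ Ioo (-1 : ℝ) 1) :
    MM m x = (∫ r, bb (m + 1) 1 r) * SS (m * (m + 1)) ((1 - x) / 2) := by
  have hz0 : 0 < (1 - x) / 2 := by linarith [hx.2]
  have hz1 : (1 - x) / 2 < 1 := by linarith [hx.1]
  have hq : ∀ e : ℝ, 0 < e → 0 < 1 + 2 * x * e + e ^ 2 := fun e he =>
    lt_of_lt_of_le (by have := hx.1; have : 0 < 1 + x := by linarith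
                       positivity) (quad_ge hx e)
  have hint : Integrable (fun r : ℝ => Real.exp ((m + 1) * r) *
      (1 + 2 * x * Real.exp r + Real.exp r ^ 2) ^ (-(1 / 2) : ℝ)) := by
    refine ((bb_int (p := m + 1) (m := 1) (by linarith) (by push_cast; linarith)).const_mul
      (((1 + x) / 2) ^ (-(1 / 2) : ℝ))).mono' ?_ (Eventually.of_forall fun r => ?_)
    · refine Continuous.aestronglyMeasurable ?_
      refine Continuous.mul (by fun_prop) (Continuous.rpow_const (by fun_prop) fun r => Or.inl ?_)
      exact (hq _ (Real.exp_pos r)).ne'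
    · have hx1 : 0 < (1 + x) / 2 := by linarith [hx.1]
      have := hq _ (Real.exp_pos r)
      rw [Real.norm_of_nonneg (by positivity)]
      have e1 : (1 + 2 * x * Real.exp r + Real.exp r ^ 2) ^ (-(1 / 2) : ℝ) ≤
          ((1 + x) / 2 * (1 + Real.exp r) ^ 2) ^ (-(1 / 2) : ℝ) :=
        Real.rpow_le_rpow_of_nonpos (by positivity) (quad_ge hx _) (by norm_num)
      rw [Real.mul_rpow hx1.le (by positivity), ← Real.rpow_natCast (1 + Real.exp r), ← Real.rpow_mul (by positivity)] at e1
      norm_num at e1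
      rw [Real.rpow_neg_one] at e1
      unfold bb
      rw [pow_one]
      calc _ ≤ _ := mul_le_mul_of_nonneg_left e1 (by positivity)
        _ = _ := by norm_num; ring
  have h := hasSum_integral_nonneg (μ := volume)
    (F := fun (n : ℕ) (r : ℝ) => (4 ^ n * (ph (1 / 2) n / n.factorial) * ((1 - x) / 2) ^ n) *
      bb (m + 1 + n) (2 * n + 1) r) ?_ ?_ hint ?_
  · have h3 : ∀ n : ℕ, ∫ r, (4 ^ n * (ph (1 / 2) n / n.factorial) * ((1 - x) / 2) ^ n) *
        bb (m + 1 + n) (2 * n + 1) r = (∫ r, bb (m + 1) 1 r) * (lco (m * (m + 1)) n * ((1 - x) / 2) ^ n) := by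
      intro n
      rw [MeasureTheory.integral_const_mul]
      have := bb_lco h1 h2 n
      linear_combination ((1 - x) / 2) ^ n * this
    simp only [h3] at h
    have h4 := (SS_summable (m * (m + 1)) (z := (1 - x) / 2)
      (by rw [Real.norm_of_nonneg hz0.le]; exact hz1)).hasSum.mul_left (∫ r, bb (m + 1) 1 r)
    exact h.unique h4
  · intro n
    exact ((bb_cont _ _).aestronglyMeasurable).const_mul _
  · intro n
    refine Eventually.of_forall fun r => ?_
    have := bb_pos (m + 1 + n) (2 * n + 1) r
    have := ph_pos (show (0 : ℝ) < 1 / 2 by norm_num) n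
    positivity
  · refine Eventually.of_forall fun r => ?_
    have he := Real.exp_pos r
    set e := Real.exp r with hedef
    have ht0 : 0 ≤ 4 * ((1 - x) / 2) * e / (1 + e) ^ 2 := by positivity
    have ht1 : 4 * ((1 - x) / 2) * e / (1 + e) ^ 2 < 1 := by
      rw [div_lt_one (by positivity)]
      nlinarith [hq e he]
    have hs := (binom_series (1 / 2) (t := 4 * ((1 - x) / 2) * e / (1 + e) ^ 2)
      (by rw [abs_of_nonneg ht0]; exact ht1)).mul_left (bb (m + 1) 1 r)
    have hv : bb (m + 1) 1 r * (1 - 4 * ((1 - x) / 2) * e / (1 + e) ^ 2) ^ (-(1 / 2) : ℝ) =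
        Real.exp ((m + 1) * r) * (1 + 2 * x * e + e ^ 2) ^ (-(1 / 2) : ℝ) := by
      have e2 : 1 + 2 * x * e + e ^ 2 = (1 + e) ^ 2 * (1 - 4 * ((1 - x) / 2) * e / (1 + e) ^ 2) := by
        field_simp; ring
      rw [e2, Real.mul_rpow (by positivity) (by linarith), ← Real.rpow_natCast (1 + e),
        ← Real.rpow_mul (by positivity)]
      norm_num
      rw [Real.rpow_neg_one, bb, pow_one, ← hedef]
      ring
    rw [hv] at hs
    refine HasSum_congr hs fun n => ?_
    unfold bb
    rw [← hedef, add_mul (m + 1), Real.exp_add, Real.exp_nat_mul, ← hedef, div_pow (4 * ((1 - x) / 2) * e), pow_succ, pow_mul, mul_pow (4 * ((1 - x) / 2)), mul_pow 4]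
    field_simp

end L3

namespace L3

open Set Filter Topology

/-- inverse square root -/
noncomputable def hf (w : ℂ) : ℂ := w ^ ((-(1 / 2) : ℝ) : ℂ)

lemma norm_hf (w : ℂ) : ‖hf w‖ = ‖w‖ ^ (-(1 / 2) : ℝ) := Complex.norm_cpow_real _ _

lemma hf_diff {w : ℂ} (hw : w ∈ slitPlane) : DifferentiableAt ℂ hf w :=
  (differentiableAt_id (𝕜 := ℂ)).cpow_const hw

lemma hf_ofReal {x : ℝ} (hx : 0 ≤ x) : hf x = ((x ^ (-(1 / 2) : ℝ) : ℝ) : ℂ) := by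
  rw [hf, Complex.ofReal_cpow hx]

lemma hf_conj {w : ℂ} (hw : w ∈ slitPlane) : hf (starRingEnd ℂ w) = starRingEnd ℂ (hf w) := by
  unfold hf
  rw [Complex.conj_cpow _ _ (Complex.mem_slitPlane_iff_arg.1 hw).1, Complex.conj_ofReal]

lemma hf_mul_conj {w : ℂ} (hw : w ∈ slitPlane) :
    hf w * hf (starRingEnd ℂ w) = ((Complex.normSq w ^ (-(1 / 2) : ℝ) : ℝ) : ℂ) := by
  rw [hf_conj hw, Complex.mul_conj, Complex.normSq_eq_norm_sq, Complex.normSq_eq_norm_sq, norm_hf,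
    ← Real.rpow_natCast, ← Real.rpow_natCast, ← Real.rpow_mul (norm_nonneg _),
    ← Real.rpow_mul (norm_nonneg _), mul_comm]

lemma hf_neg_im {w : ℂ} (hw : w.im < 0) : hf w = I * hf (-w) := by
  have h0 : w ≠ 0 := by rintro rfl; simp at hw
  have ha := Complex.arg_neg_eq_arg_add_pi_of_im_neg hw
  unfold hf
  rw [Complex.cpow_def_of_ne_zero h0, Complex.cpow_def_of_ne_zero (neg_ne_zero.2 h0), Complex.log,
    Complex.log, norm_neg, ha]
  have : I = Complex.exp (π / 2 * I) := by
    rw [Complex.exp_mul_I, Complex.cos_pi_div_two, Complex.sin_pi_div_two]; simp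
  nth_rw 2 [this]
  rw [← Complex.exp_add]
  congr 1
  push_cast
  ring

lemma hf_pos_im {w : ℂ} (hw : 0 < w.im) : hf w = -I * hf (-w) := by
  have h := hf_neg_im (w := -w) (by simpa using hw)
  rw [neg_neg] at h
  rw [h, ← mul_assoc]
  simp

lemma one_sub_exp_slit {s : ℂ} (h : Real.cos s.im ≠ 1) : 1 - Complex.exp s ∈ slitPlane := by
  rw [Complex.mem_slitPlane_iff]
  by_contra hc
  push Not at hc
  obtain ⟨h1, h2⟩ := hc
  simp only [Complex.sub_re, Complex.one_re, Complex.exp_re, Complex.sub_im, Complex.one_im,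
    Complex.exp_im, zero_sub, neg_eq_zero, mul_eq_zero, Real.exp_ne_zero, false_or] at h1 h2
  have h3 := Real.sin_sq_add_cos_sq s.im
  rw [h2] at h3
  have h4 : (Real.cos s.im - 1) * (Real.cos s.im + 1) = 0 := by linarith
  rcases mul_eq_zero.1 h4 with h5 | h5
  · exact h (by linarith)
  · have : Real.cos s.im = -1 := by linarith
    rw [this] at h1
    have := Real.exp_pos s.re
    linarith

lemma cos_ne_one {t : ℝ} (h1 : -(2 * π) < t) (h2 : t < 2 * π) (h0 : t ≠ 0) : Real.cos t ≠ 1 := by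
  rw [Ne, Real.cos_eq_one_iff_of_lt_of_lt h1 h2]; exact h0

lemma norm_one_sub_exp_ge (s : ℂ) : |1 - Real.exp s.re| ≤ ‖1 - Complex.exp s‖ := by
  have := abs_norm_sub_norm_le 1 (Complex.exp s)
  rwa [norm_one, Complex.norm_exp] at this

lemma norm_one_sub_exp_ge' (s : ℂ) :
    |Real.sin (s.im / 2)| * (1 + Real.exp s.re) ≤ ‖1 - Complex.exp s‖ := by
  have hp := Real.exp_pos s.re
  refine abs_le_of_sq_le_sq' ?_ (norm_nonneg _) |>.2
  rw [← Complex.normSq_eq_norm_sq, Complex.normSq_apply, mul_pow, sq_abs]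
  simp only [Complex.sub_re, Complex.one_re, Complex.exp_re, Complex.sub_im, Complex.one_im,
    Complex.exp_im, zero_sub]
  have h1 : Real.sin (s.im / 2) ^ 2 = (1 - Real.cos s.im) / 2 := by
    rw [Real.sin_sq_eq_half_sub, show 2 * (s.im / 2) = s.im by ring]; ring
  have h3 := Real.sin_sq_add_cos_sq s.im
  have h4 := Real.neg_one_le_cos s.im
  rw [h1]
  nlinarith [mul_nonneg (show 0 ≤ 1 + Real.cos s.im by linarith) (sq_nonneg (1 - Real.exp s.re))]

/-- the integrand -/
noncomputable def Gf (m θ : ℝ) (s : ℂ) : ℂ :=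
  Complex.exp ((m + 1) * s) * hf (1 - Complex.exp s) * hf (1 - Complex.exp (2 * θ * I + s))

lemma Gf_diff {m θ : ℝ} (hθ : θ ∈ Ioo 0 π) {s : ℂ} (hs : s.im ∈ Icc (-θ) (π - θ)) (h0 : s.im ≠ 0) :
    DifferentiableAt ℂ (Gf m θ) s := by
  have hpi := Real.pi_pos
  have e1 : 1 - Complex.exp s ∈ slitPlane := one_sub_exp_slit
    (cos_ne_one (by linarith [hs.1, hθ.2]) (by linarith [hs.2, hθ.1]) h0)
  have e2 : 1 - Complex.exp (2 * θ * I + s) ∈ slitPlane := by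
    apply one_sub_exp_slit
    have : (2 * θ * I + s).im = 2 * θ + s.im := by simp
    rw [this]
    refine cos_ne_one ?_ ?_ ?_
    · linarith [hs.1, hθ.1]
    · linarith [hs.2, hθ.2]
    · have := hs.1; have := hθ.1; intro h; linarith
  unfold Gf
  refine DifferentiableAt.mul (DifferentiableAt.mul (by fun_prop) ?_) ?_
  · exact DifferentiableAt.comp (f := fun s => 1 - Complex.exp s) s (hf_diff e1) (by fun_prop)
  · exact DifferentiableAt.comp (f := fun s => 1 - Complex.exp (2 * θ * I + s)) s (hf_diff e2)
      (by fun_prop)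

/-- constant -/
noncomputable def kap (θ : ℝ) : ℝ := min (Real.sin (θ / 2)) (Real.cos (θ / 2))

lemma kap_pos {θ : ℝ} (hθ : θ ∈ Ioo 0 π) : 0 < kap θ :=
  lt_min (Real.sin_pos_of_pos_of_lt_pi (by linarith [hθ.1]) (by linarith [hθ.1, hθ.2]))
    (Real.cos_pos_of_mem_Ioo ⟨by linarith [hθ.1, Real.pi_pos], by linarith [hθ.2]⟩)

lemma kap_le {θ ψ : ℝ} (hθ : θ ∈ Ioo 0 π) (hψ : ψ ∈ Icc θ (π + θ)) : kap θ ≤ |Real.sin (ψ / 2)| := by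
  have hpi := Real.pi_pos
  have hm : ψ / 2 ∈ segment ℝ (θ / 2) (π / 2 + θ / 2) := by
    rw [segment_eq_Icc (by linarith)]; constructor <;> linarith [hψ.1, hψ.2]
  have := strictConcaveOn_sin_Icc.concaveOn.min_le_of_mem_segment
    (x := θ / 2) (y := π / 2 + θ / 2) ⟨by linarith [hθ.1], by linarith [hθ.2]⟩
    ⟨by linarith [hθ.1], by linarith [hθ.2]⟩ hm
  refine le_trans ?_ (le_abs_self _)
  rw [add_comm (π / 2), Real.sin_add_pi_div_two] at this
  exact this

lemma Gf_bound {m θ : ℝ} (hθ : θ ∈ Ioo 0 π) (r y : ℝ) (hr : r ≠ 0) (hy : y ∈ Icc (-θ) (π - θ)) :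
    ‖Gf m θ (r + y * I)‖ ≤ (kap θ) ^ (-(1 / 2) : ℝ) * hw m r := by
  have hk := kap_pos hθ
  have h1 := norm_one_sub_exp_ge (r + y * I)
  have h2 := norm_one_sub_exp_ge' (2 * θ * I + (r + y * I))
  have h3 := kap_le hθ (ψ := 2 * θ + y) ⟨by linarith [hy.1], by linarith [hy.2]⟩
  have i1 : (2 * θ * I + (r + y * I)).im = 2 * θ + y := by simp
  have i2 : (2 * θ * I + (r + y * I) : ℂ).re = r := by simp
  have i3 : (r + y * I : ℂ).re = r := by simp
  rw [i1, i2] at h2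
  rw [i3] at h1
  have hne : 0 < |1 - Real.exp r| := by
    rw [abs_pos, sub_ne_zero]; intro h; exact hr (Real.exp_eq_one_iff _ |>.1 h.symm)
  unfold Gf hw
  rw [norm_mul, norm_mul, norm_hf, norm_hf, Complex.norm_exp]
  have i4 : (((m : ℂ) + 1) * (r + y * I)).re = (m + 1) * r := by simp
  rw [i4]
  have g1 : ‖1 - Complex.exp (r + y * I)‖ ^ (-(1 / 2) : ℝ) ≤ |1 - Real.exp r| ^ (-(1 / 2) : ℝ) :=
    Real.rpow_le_rpow_of_nonpos hne h1 (by norm_num)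
  have g2 : ‖1 - Complex.exp (2 * θ * I + (r + y * I))‖ ^ (-(1 / 2) : ℝ) ≤
      (kap θ * (1 + Real.exp r)) ^ (-(1 / 2) : ℝ) := by
    refine Real.rpow_le_rpow_of_nonpos (by positivity) (le_trans ?_ h2) (by norm_num)
    gcongr
  rw [Real.mul_rpow hk.le (by positivity)] at g2
  calc _ ≤ Real.exp ((m + 1) * r) * |1 - Real.exp r| ^ (-(1 / 2) : ℝ) *
        (kap θ ^ (-(1 / 2) : ℝ) * (1 + Real.exp r) ^ (-(1 / 2) : ℝ)) := by gcongr
    _ = _ := by ring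

lemma Gf_shift {m θ : ℝ} (h1 : -1 < m) (h2 : m < 0) (hθ : θ ∈ Ioo 0 π) {a b : ℝ} (hab : a ≤ b)
    (ha : -θ ≤ a) (hb : b ≤ π - θ) (h0 : 0 ∉ Icc a b) :
    ∫ r : ℝ, Gf m θ (r + a * I) = ∫ r : ℝ, Gf m θ (r + b * I) := by
  refine shift_lines (h := fun r => (kap θ) ^ (-(1 / 2) : ℝ) * hw m r) hab ?_ ?_
    ((hw_int h1 h2).const_mul _) ?_ ?_
  · intro s hs
    exact Gf_diff hθ ⟨ha.trans hs.1, hs.2.trans hb⟩ fun h => h0 (h ▸ hs)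
  · intro r y hr hy
    exact Gf_bound hθ r y hr ⟨ha.trans hy.1, hy.2.trans hb⟩
  · simpa using (hw_top h2).const_mul ((kap θ) ^ (-(1 / 2) : ℝ))
  · simpa using (hw_bot h1).const_mul ((kap θ) ^ (-(1 / 2) : ℝ))

lemma Gf_int {m θ : ℝ} (h1 : -1 < m) (h2 : m < 0) (hθ : θ ∈ Ioo 0 π) {y : ℝ}
    (hy : y ∈ Icc (-θ) (π - θ)) (h0 : y ≠ 0) : Integrable (fun r : ℝ => Gf m θ (r + y * I)) := by
  refine ((hw_int h1 h2).const_mul ((kap θ) ^ (-(1 / 2) : ℝ))).mono' ?_ ?_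
  · refine Continuous.aestronglyMeasurable (continuous_iff_continuousAt.2 fun r => ?_)
    exact ContinuousAt.comp (f := fun r : ℝ => (r : ℂ) + y * I)
      (Gf_diff hθ (by simpa using hy) (by simpa using h0)).continuousAt (by fun_prop)
  · filter_upwards [Measure.ae_ne volume (0 : ℝ)] with r hr using Gf_bound hθ r y hr hy

end L3

namespace L3

open Set Filter Topology

lemma Gf_line {m θ y : ℝ} (h : Complex.exp ((2 * θ + y) * I) = Complex.exp (-(y * I)))
    (hy : Real.cos y ≠ 1) :
    ∫ r : ℝ, Gf m θ (r + y * I) = Complex.exp ((m + 1) * y * I) * MM m (-Real.cos y) := by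
  unfold MM
  rw [← integral_complex_ofReal, ← MeasureTheory.integral_const_mul]
  refine integral_congr_ae (Eventually.of_forall fun r => ?_)
  have e1 : 1 - Complex.exp (r + y * I) ∈ slitPlane := one_sub_exp_slit (by simpa using hy)
  have e2 : 1 - Complex.exp (2 * θ * I + (r + y * I)) =
      starRingEnd ℂ (1 - Complex.exp (r + y * I)) := by
    rw [map_sub, map_one, ← Complex.exp_conj, map_add, map_mul, Complex.conj_I, Complex.conj_ofReal,
      Complex.conj_ofReal, mul_neg, Complex.exp_add (r : ℂ), ← h, ← Complex.exp_add]
    congr 2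
    ring
  have e3 : Complex.normSq (1 - Complex.exp (r + y * I)) =
      1 + 2 * (-Real.cos y) * Real.exp r + Real.exp r ^ 2 := by
    rw [Complex.normSq_apply]
    simp only [Complex.sub_re, Complex.one_re, Complex.exp_re, Complex.sub_im, Complex.one_im,
      Complex.exp_im, zero_sub]
    simp only [Complex.add_re, Complex.ofReal_re, Complex.mul_re, Complex.I_re, Complex.ofReal_im,
      Complex.I_im, Complex.add_im, Complex.mul_im]
    have := Real.sin_sq_add_cos_sq y
    simp only [mul_zero, mul_one, sub_zero, add_zero, zero_add]
    linear_combination (Real.exp r ^ 2) * this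
  simp only [Gf]
  rw [e2, mul_assoc, hf_mul_conj e1, e3, Complex.ofReal_mul, ← mul_assoc]
  congr 1
  rw [Complex.ofReal_exp, ← Complex.exp_add]
  congr 1
  push_cast
  ring

/-- the half-line integral -/
noncomputable def FF (m : ℝ) (q : ℂ) : ℂ :=
  ∫ r in Iio (0 : ℝ), ((Real.exp ((m + 1) * r) * (1 - Real.exp r) ^ (-(1 / 2) : ℝ) : ℝ) : ℂ) *
    hf (1 - q * Real.exp r)

/-- the branch on the right -/
noncomputable def Kf (m θ : ℝ) (s : ℂ) : ℂ :=
  Complex.exp ((m + 1) * s) * hf (-(1 - Complex.exp s)) * hf (1 - Complex.exp (2 * θ * I + s))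

lemma slit2 {θ : ℝ} (hθ : θ ∈ Ioo 0 π) (r : ℝ) : 1 - Complex.exp (2 * θ * I + r) ∈ slitPlane := by
  apply one_sub_exp_slit
  have : (2 * θ * I + r : ℂ).im = 2 * θ := by simp
  rw [this]
  exact cos_ne_one (by linarith [hθ.1, Real.pi_pos]) (by linarith [hθ.2])
    (by have := hθ.1; intro h; linarith)

lemma Gf_cont {m θ : ℝ} (hθ : θ ∈ Ioo 0 π) {r : ℝ} (hr : r < 0) : ContinuousAt (Gf m θ) r := by
  have e1 : 1 - Complex.exp r ∈ slitPlane := by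
    rw [← Complex.ofReal_exp, ← Complex.ofReal_one, ← Complex.ofReal_sub, Complex.ofReal_mem_slitPlane]
    have := Real.exp_lt_one_iff.2 hr
    linarith
  refine DifferentiableAt.continuousAt (𝕜 := ℂ) ?_
  unfold Gf
  refine DifferentiableAt.mul (DifferentiableAt.mul (by fun_prop) ?_) ?_
  · exact DifferentiableAt.comp (f := fun s => 1 - Complex.exp s) _ (hf_diff e1) (by fun_prop)
  · exact DifferentiableAt.comp (f := fun s => 1 - Complex.exp (2 * θ * I + s)) _
      (hf_diff (slit2 hθ r)) (by fun_prop)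

lemma Kf_cont {m θ : ℝ} (hθ : θ ∈ Ioo 0 π) {r : ℝ} (hr : 0 < r) : ContinuousAt (Kf m θ) r := by
  have e1 : -(1 - Complex.exp r) ∈ slitPlane := by
    rw [← Complex.ofReal_exp, ← Complex.ofReal_one, ← Complex.ofReal_sub, ← Complex.ofReal_neg,
      Complex.ofReal_mem_slitPlane]
    have := Real.one_lt_exp_iff.2 hr
    linarith
  refine DifferentiableAt.continuousAt (𝕜 := ℂ) ?_
  unfold Kf
  refine DifferentiableAt.mul (DifferentiableAt.mul (by fun_prop) ?_) ?_
  · exact DifferentiableAt.comp (f := fun s => -(1 - Complex.exp s)) _ (hf_diff e1) (by fun_prop)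
  · exact DifferentiableAt.comp (f := fun s => 1 - Complex.exp (2 * θ * I + s)) _
      (hf_diff (slit2 hθ r)) (by fun_prop)

lemma Gf_eq_Kf_pos (m θ : ℝ) (r : ℝ) {y : ℝ} (h1 : 0 < y) (h2 : y < π) :
    Gf m θ (r + y * I) = I * Kf m θ (r + y * I) := by
  unfold Gf Kf
  rw [hf_neg_im (w := 1 - Complex.exp (r + y * I))]
  · ring
  · simp only [Complex.sub_im, Complex.one_im, Complex.exp_im, zero_sub]
    simp only [Complex.add_re, Complex.ofReal_re, Complex.mul_re, Complex.I_re, Complex.ofReal_im,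
      Complex.I_im, Complex.add_im, Complex.mul_im]
    have := Real.sin_pos_of_pos_of_lt_pi h1 h2
    simp only [mul_zero, mul_one, sub_zero, add_zero, zero_add]
    have : 0 < Real.exp r * Real.sin y := by positivity
    linarith

lemma Gf_eq_Kf_neg (m θ : ℝ) (r : ℝ) {y : ℝ} (h1 : y < 0) (h2 : -π < y) :
    Gf m θ (r + y * I) = -I * Kf m θ (r + y * I) := by
  unfold Gf Kf
  rw [hf_pos_im (w := 1 - Complex.exp (r + y * I))]
  · ring
  · simp only [Complex.sub_im, Complex.one_im, Complex.exp_im, zero_sub]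
    simp only [Complex.add_re, Complex.ofReal_re, Complex.mul_re, Complex.I_re, Complex.ofReal_im,
      Complex.I_im, Complex.add_im, Complex.mul_im]
    have := Real.sin_neg_of_neg_of_neg_pi_lt h1 h2
    simp only [mul_zero, mul_one, sub_zero, add_zero, zero_add]
    have : Real.exp r * Real.sin y < 0 := mul_neg_of_pos_of_neg (Real.exp_pos r) this
    linarith

lemma FF_lim {m θ : ℝ} (h1 : -1 < m) (h2 : m < 0) (hθ : θ ∈ Ioo 0 π) :
    Tendsto (fun ε : ℝ => ∫ r : ℝ, (Gf m θ (r + ε * I) + Gf m θ (r + (-ε : ℝ) * I))) (𝓝[>] 0)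
      (𝓝 (∫ r : ℝ, (Iio (0 : ℝ)).indicator (fun r : ℝ => 2 * Gf m θ r) r)) := by
  have hpi := Real.pi_pos
  have hev : ∀ᶠ ε in 𝓝[>] (0 : ℝ), ε ∈ Ioo 0 (min θ (π - θ)) :=
    Ioo_mem_nhdsGT (lt_min hθ.1 (by linarith [hθ.2]))
  have hl : ∀ (r : ℝ), Tendsto (fun ε : ℝ => (r : ℂ) + ε * I) (𝓝[>] 0) (𝓝 (r : ℂ)) := by
    intro r
    have : Continuous (fun ε : ℝ => (r : ℂ) + ε * I) := by fun_prop
    have := this.tendsto 0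
    simp only [Complex.ofReal_zero, zero_mul, add_zero] at this
    exact this.mono_left nhdsWithin_le_nhds
  have hl' : ∀ (r : ℝ), Tendsto (fun ε : ℝ => (r : ℂ) + (-ε : ℝ) * I) (𝓝[>] 0) (𝓝 (r : ℂ)) := by
    intro r
    have : Continuous (fun ε : ℝ => (r : ℂ) + (-ε : ℝ) * I) := by fun_prop
    have := this.tendsto 0
    simp only [neg_zero, Complex.ofReal_zero, zero_mul, add_zero] at this
    exact this.mono_left nhdsWithin_le_nhds
  refine MeasureTheory.tendsto_integral_filter_of_dominated_convergence
    (fun r => 2 * ((kap θ) ^ (-(1 / 2) : ℝ) * hw m r)) ?_ ?_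
    (((hw_int h1 h2).const_mul _).const_mul _) ?_
  · filter_upwards [hev] with ε hε
    have a1 := hε.2.trans_le (min_le_left _ _)
    have a2 := hε.2.trans_le (min_le_right _ _)
    exact ((Gf_int h1 h2 hθ ⟨by linarith [hθ.1, hε.1], a2.le⟩ hε.1.ne').add
      (Gf_int h1 h2 hθ (y := -ε) ⟨by linarith, by linarith [hε.1, hθ.2]⟩
        (neg_ne_zero.2 hε.1.ne'))).aestronglyMeasurable
  · filter_upwards [hev] with ε hε
    have a1 := hε.2.trans_le (min_le_left _ _)
    have a2 := hε.2.trans_le (min_le_right _ _)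
    filter_upwards [Measure.ae_ne volume (0 : ℝ)] with r hr
    refine (norm_add_le _ _).trans ?_
    have b1 := Gf_bound (m := m) hθ r ε hr ⟨by linarith [hθ.1, hε.1], a2.le⟩
    have b2 := Gf_bound (m := m) hθ r (-ε) hr ⟨by linarith, by linarith [hε.1, hθ.2]⟩
    linarith
  · filter_upwards [Measure.ae_ne volume (0 : ℝ)] with r hr
    rcases lt_or_gt_of_ne hr with h | h
    · rw [indicator_of_mem (by exact h), two_mul]
      exact ((Gf_cont hθ h).tendsto.comp (hl r)).add ((Gf_cont hθ h).tendsto.comp (hl' r))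
    · rw [indicator_of_notMem (by simpa using h.le)]
      have t := (((Kf_cont (m := m) hθ h).tendsto.comp (hl r)).const_mul I).add
        (((Kf_cont (m := m) hθ h).tendsto.comp (hl' r)).const_mul (-I))
      rw [show I * Kf m θ r + -I * Kf m θ r = 0 by ring] at t
      refine t.congr' ?_
      filter_upwards [hev] with ε hε
      have a1 := hε.2.trans_le (min_le_left _ _)
      simp only [Function.comp]
      rw [Gf_eq_Kf_pos m θ r hε.1 (by linarith [hθ.2]),
        Gf_eq_Kf_neg m θ r (y := -ε) (by linarith [hε.1]) (by linarith [hθ.2])]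

lemma FF_val {m θ : ℝ} (h1 : -1 < m) (h2 : m < 0) (hθ : θ ∈ Ioo 0 π) :
    2 * FF m (Complex.exp (2 * θ * I)) = Complex.exp (-((m + 1) * θ * I)) *
      (MM m (-Real.cos θ) - Complex.exp (m * π * I) * MM m (Real.cos θ)) := by
  have hpi := Real.pi_pos
  have hev : ∀ᶠ ε in 𝓝[>] (0 : ℝ), ε ∈ Ioo 0 (min θ (π - θ)) :=
    Ioo_mem_nhdsGT (lt_min hθ.1 (by linarith [hθ.2]))
  have ht := FF_lim h1 h2 hθ
  have j1 : ∫ r : ℝ, Gf m θ (r + (-θ : ℝ) * I) =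
      Complex.exp (-((m + 1) * θ * I)) * MM m (-Real.cos θ) := by
    rw [Gf_line, Real.cos_neg]
    · congr 2; push_cast; ring
    · congr 1; push_cast; ring
    · exact cos_ne_one (by linarith [hθ.2]) (by linarith [hθ.1]) (by linarith [hθ.1] : -θ < 0).ne
  have j2 : ∫ r : ℝ, Gf m θ (r + (π - θ : ℝ) * I) =
      -(Complex.exp (-((m + 1) * θ * I)) * Complex.exp (m * π * I)) * MM m (Real.cos θ) := by
    rw [Gf_line, Real.cos_pi_sub, neg_neg]
    · congr 1
      rw [← Complex.exp_add, ← mul_neg_one, ← Complex.exp_pi_mul_I, ← Complex.exp_add]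
      congr 1; push_cast; ring
    · have : ((2 * θ + (π - θ : ℝ)) * I : ℂ) = -((π - θ : ℝ) * I) + 2 * π * I := by push_cast; ring
      rw [this, Complex.exp_add, Complex.exp_two_pi_mul_I, mul_one]
    · exact cos_ne_one (by linarith [hθ.2]) (by linarith [hθ.1]) (by linarith [hθ.2] : 0 < π - θ).ne'
  have hc : ∀ᶠ ε : ℝ in 𝓝[>] (0 : ℝ), Complex.exp (-((m + 1) * θ * I)) *
      (MM m (-Real.cos θ) - Complex.exp (m * π * I) * MM m (Real.cos θ)) =
      ∫ r : ℝ, (Gf m θ (r + ε * I) + Gf m θ (r + (-ε : ℝ) * I)) := by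
    filter_upwards [hev] with ε hε
    have a1 := hε.2.trans_le (min_le_left _ _)
    have a2 := hε.2.trans_le (min_le_right _ _)
    rw [MeasureTheory.integral_add (Gf_int h1 h2 hθ ⟨by linarith [hθ.1, hε.1], a2.le⟩ hε.1.ne')
      (Gf_int h1 h2 hθ (y := -ε) ⟨by linarith, by linarith [hε.1, hθ.2]⟩ (neg_ne_zero.2 hε.1.ne')),
      Gf_shift h1 h2 hθ a2.le (by linarith [hθ.1, hε.1]) le_rfl (fun h => absurd h.1 (not_le.2 hε.1)),
      ← Gf_shift h1 h2 hθ (a := -θ) (b := -ε) (by linarith) le_rfl (by linarith [hε.1, hθ.2])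
        (fun h => absurd h.2 (not_le.2 (by linarith [hε.1]))), j1, j2]
    ring
  have := tendsto_nhds_unique ht (tendsto_const_nhds.congr' hc)
  rw [← this, MeasureTheory.integral_indicator measurableSet_Iio, FF, ← MeasureTheory.integral_const_mul]
  refine setIntegral_congr_fun measurableSet_Iio fun r hr => ?_
  have : Real.exp r < 1 := Real.exp_lt_one_iff.2 hr
  simp only [Gf]
  rw [Complex.exp_add, ← Complex.ofReal_exp r, ← Complex.ofReal_one, ← Complex.ofReal_sub,
    hf_ofReal (by linarith)]
  push_cast
  ring

end L3

namespace L3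

open Set Filter Topology

lemma par_diff {α : Type*} [MeasurableSpace α] {μ : Measure α} {F : ℂ → α → ℂ} {U : Set ℂ}
    (hm : ∀ z ∈ U, AEStronglyMeasurable (F z) μ)
    (hd : ∀ᵐ a ∂μ, DifferentiableOn ℂ (fun z => F z a) U)
    (hb : ∀ z₀ ∈ U, ∃ r > 0, Metric.ball z₀ r ⊆ U ∧ ∃ g : α → ℝ, Integrable g μ ∧
      ∀ᵐ a ∂μ, ∀ z ∈ Metric.ball z₀ r, ‖F z a‖ ≤ g a) :
    DifferentiableOn ℂ (fun z => ∫ a, F z a ∂μ) U := by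
  intro z₀ hz₀
  obtain ⟨r, hr, hU, g, hg, hgb⟩ := hb z₀ hz₀
  have hz1 : z₀ ∈ Metric.ball z₀ r := Metric.mem_ball_self hr
  have hnhds : Metric.ball z₀ r ∈ 𝓝 z₀ := Metric.ball_mem_nhds _ hr
  have hda : ∀ᵐ a ∂μ, ∀ z ∈ Metric.ball z₀ r, HasDerivAt (fun z => F z a) (deriv (fun z => F z a) z) z := by
    filter_upwards [hd] with a ha z hz
    exact ((ha.mono hU).differentiableAt (Metric.isOpen_ball.mem_nhds hz)).hasDerivAt
  refine ((hasDerivAt_integral_of_dominated_loc_of_deriv_le (F' := fun z a => deriv (fun z => F z a) z)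
    (bound := fun a => g a / (r / 4))
    (s := Metric.ball z₀ (r / 2)) (Metric.ball_mem_nhds _ (by positivity)) ?_ ?_ ?_ ?_ (hg.div_const _)
    ?_).2.differentiableAt).differentiableWithinAt
  · filter_upwards [hnhds] with z hz using hm z (hU hz)
  · exact hg.mono' (hm z₀ hz₀) (hgb.mono fun a ha => ha z₀ hz1)
  · -- measurability of the derivative
    have hseq : Tendsto (fun n : ℕ => ((r / 2 / (n + 1) : ℝ) : ℂ)) atTop (𝓝[≠] 0) := by
      refine tendsto_nhdsWithin_iff.2 ⟨?_, Eventually.of_forall fun n => ?_⟩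
      · have := (tendsto_one_div_add_atTop_nhds_zero_nat (𝕜 := ℝ)).const_mul (r / 2)
        rw [mul_zero] at this
        have h2 := (Complex.continuous_ofReal.tendsto 0).comp this
        simp only [Complex.ofReal_zero] at h2
        refine h2.congr fun n => ?_
        simp only [Function.comp]
        congr 1; ring
      · have : 0 < r / 2 / (n + 1) := by positivity
        exact Complex.ofReal_ne_zero.2 this.ne'
    refine aestronglyMeasurable_of_tendsto_ae (u := atTop)
      (f := fun (n : ℕ) a => ((r / 2 / (n + 1) : ℝ) : ℂ)⁻¹ • (F (z₀ + (r / 2 / (n + 1) : ℝ)) a - F z₀ a)) ?_ ?_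
    · intro n
      refine AEStronglyMeasurable.const_smul (f := fun a => F (z₀ + (r / 2 / (n + 1) : ℝ)) a - F z₀ a)
        (AEStronglyMeasurable.sub (hm (z₀ + (r / 2 / (n + 1) : ℝ)) (hU ?_)) (hm z₀ hz₀)) (((r / 2 / (n + 1) : ℝ) : ℂ)⁻¹)
      rw [Metric.mem_ball, dist_eq_norm, add_sub_cancel_left, Complex.norm_real,
        Real.norm_of_nonneg (by positivity)]
      have : r / 2 / ((n : ℝ) + 1) ≤ r / 2 := div_le_self (by positivity) (by simp)
      linarith
    · filter_upwards [hda] with a ha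
      exact (ha z₀ hz1).tendsto_slope_zero.comp hseq
  · filter_upwards [hgb, hda] with a ha hda z hz
    have hz' : dist z z₀ < r / 2 := hz
    refine Complex.norm_deriv_le_of_forall_mem_sphere_norm_le (by positivity) ?_ ?_
    · refine DifferentiableOn.diffContOnCl fun w hw => ?_
      have hw2 : w ∈ Metric.closedBall z (r / 4) := Metric.closure_ball_subset_closedBall hw
      refine (hda w ?_).differentiableAt.differentiableWithinAt
      rw [Metric.mem_closedBall] at hw2
      have := dist_triangle w z z₀
      rw [Metric.mem_ball]; linarith
    · intro w hw
      apply ha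
      rw [Metric.mem_sphere] at hw
      have := dist_triangle w z z₀
      rw [Metric.mem_ball]; linarith
  · filter_upwards [hda] with a ha z hz
    exact ha z (Metric.ball_subset_ball (by linarith) hz)

/-- weights -/
noncomputable def ww (m β r : ℝ) : ℝ := Real.exp ((m + 1) * r) * (1 - Real.exp r) ^ β

lemma ww_int {m β : ℝ} (hm : -1 < m) (hβ : -1 < β) (hβ1 : β ≤ 0) : IntegrableOn (ww m β) (Iio 0) := by
  have i1 : IntegrableOn (fun r => Real.exp (-(m + 1) * r)) (Ioi 0) :=
    integrableOn_exp_mul_Ioi (by linarith) 0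
  have i2 : IntegrableOn (fun r : ℝ => Real.exp (-(m + 1) * r) * r ^ β) (Ioi 0) := by
    have := integrableOn_rpow_mul_exp_neg_mul_rpow (p := 1) (s := β) (b := m + 1) hβ one_pos (by linarith)
    refine this.congr_fun (fun r hr => ?_) measurableSet_Ioi
    simp only [Real.rpow_one]; ring
  have h3 : IntegrableOn (fun r => ww m β (-r)) (Ioi 0) := by
    refine Integrable.mono' (i1.add i2) ?_ ?_
    · unfold ww
      exact (by fun_prop : Measurable _).aestronglyMeasurable
    · refine (ae_restrict_iff' measurableSet_Ioi).2 (Eventually.of_forall fun r hr => ?_)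
      have hr0 : 0 < r := hr
      have h1 : Real.exp (-r) < 1 := Real.exp_lt_one_iff.2 (by linarith)
      unfold ww
      rw [Real.norm_of_nonneg (mul_nonneg (Real.exp_nonneg _) (Real.rpow_nonneg (by linarith) _))]
      simp only [Pi.add_apply]
      rw [← mul_one_add, show (m + 1) * -r = -(m + 1) * r by ring]
      gcongr
      have h := one_sub_exp_ge hr0
      have h3 : (1 - Real.exp (-r)) ^ β ≤ (r / (1 + r)) ^ β :=
        Real.rpow_le_rpow_of_nonpos (by positivity) h hβ1
      refine h3.trans ?_
      have e : ∀ x : ℝ, 0 ≤ x → x ^ β = x⁻¹ ^ (-β) := fun x hx => by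
        rw [Real.inv_rpow hx, ← Real.rpow_neg hx, neg_neg]
      rw [e _ (by positivity), e r hr0.le, inv_div, add_div, div_self hr0.ne', one_div, add_comm]
      refine (Real.rpow_add_le_add_rpow (by positivity) (by positivity) (by linarith) (by linarith)).trans ?_
      rw [Real.one_rpow, add_comm]
  have := h3.comp_neg
  simpa using this

lemma one_sub_mul_slit {q : ℂ} (hq : ‖q‖ ≤ 1) {r : ℝ} (hr : r < 0) : 1 - q * Real.exp r ∈ slitPlane := by
  left
  have h1 := Real.exp_lt_one_iff.2 hr
  have h2 := (Complex.re_le_norm q).trans hq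
  simp only [Complex.sub_re, Complex.one_re, Complex.re_mul_ofReal]
  nlinarith [Real.exp_pos r]

lemma FF_meas (m : ℝ) (q : ℂ) : Measurable (fun r : ℝ =>
    ((Real.exp ((m + 1) * r) * (1 - Real.exp r) ^ (-(1 / 2) : ℝ) : ℝ) : ℂ) * hf (1 - q * Real.exp r)) := by
  unfold hf
  fun_prop

lemma FF_diff {m : ℝ} (hm : -1 < m) : DifferentiableOn ℂ (FF m) (Metric.ball 0 1) := by
  unfold FF
  refine par_diff (fun q _ => (FF_meas m q).aestronglyMeasurable) ?_ ?_
  · refine (ae_restrict_iff' measurableSet_Iio).2 (Eventually.of_forall fun r hr q hq => ?_)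
    have h1 := one_sub_mul_slit (q := q) (by simpa using (Metric.mem_ball.1 hq).le) hr
    refine (DifferentiableAt.const_mul ?_ _).differentiableWithinAt
    exact DifferentiableAt.comp (f := fun q : ℂ => 1 - q * Real.exp r) _ (hf_diff h1) (by fun_prop)
  · intro q₀ hq₀
    have h0 : ‖q₀‖ < 1 := by simpa using hq₀
    have hsub : ∀ z ∈ Metric.ball q₀ ((1 - ‖q₀‖) / 2), ‖z‖ ≤ (1 + ‖q₀‖) / 2 := by
      intro z hz
      rw [Metric.mem_ball, dist_eq_norm] at hz
      have := norm_sub_norm_le z q₀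
      linarith
    refine ⟨(1 - ‖q₀‖) / 2, by linarith, ?_, fun r => ww m (-(1 / 2)) r * ((1 - ‖q₀‖) / 2) ^ (-(1 / 2) : ℝ),
      (ww_int hm (by norm_num) (by norm_num)).mul_const _, ?_⟩
    · intro z hz
      have := hsub z hz
      rw [Metric.mem_ball, dist_zero_right]; linarith
    · refine (ae_restrict_iff' measurableSet_Iio).2 (Eventually.of_forall fun r hr z hz => ?_)
      have h1 : Real.exp r < 1 := Real.exp_lt_one_iff.2 hr
      have h2 := hsub z hz
      rw [norm_mul, norm_hf, Complex.norm_real, Real.norm_of_nonneg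
        (mul_nonneg (Real.exp_nonneg _) (Real.rpow_nonneg (by linarith) _))]
      unfold ww
      refine mul_le_mul_of_nonneg_left ?_ (mul_nonneg (Real.exp_nonneg _) (Real.rpow_nonneg (by linarith) _))
      refine Real.rpow_le_rpow_of_nonpos (by linarith) ?_ (by norm_num)
      have h3 := norm_sub_norm_le (1 : ℂ) (z * Real.exp r)
      rw [norm_one, norm_mul, Complex.norm_real, Real.norm_of_nonneg (Real.exp_nonneg _)] at h3
      have h4 : ‖z‖ * Real.exp r ≤ ‖z‖ * 1 := by gcongr
      linarith

/-- points on circles -/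
noncomputable def qq (ρ θ : ℝ) : ℂ := ρ * Complex.exp (2 * θ * I)

lemma norm_qq {ρ : ℝ} (h : 0 ≤ ρ) (θ : ℝ) : ‖qq ρ θ‖ = ρ := by
  unfold qq
  rw [norm_mul, show (2 * θ * I : ℂ) = ((2 * θ : ℝ) : ℂ) * I by push_cast; ring,
    Complex.norm_exp_ofReal_mul_I, Complex.norm_real, Real.norm_of_nonneg h, mul_one]

lemma qq_ge {ρ : ℝ} (h0 : 0 < ρ) {θ : ℝ} (hθ : θ ∈ Ioo 0 π) (r : ℝ) :
    Real.sin θ ≤ ‖1 - qq ρ θ * Real.exp r‖ := by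
  have hs := Real.sin_pos_of_pos_of_lt_pi hθ.1 hθ.2
  have e : qq ρ θ * Real.exp r = Complex.exp (((Real.log ρ + r : ℝ) : ℂ) + ((2 * θ : ℝ) : ℂ) * I) := by
    unfold qq
    rw [Complex.exp_add, ← Complex.ofReal_exp (Real.log ρ + r), Real.exp_add, Real.exp_log h0]
    push_cast; ring
  have := norm_one_sub_exp_ge' (((Real.log ρ + r : ℝ) : ℂ) + ((2 * θ : ℝ) : ℂ) * I)
  rw [e]
  refine le_trans ?_ this
  simp only [Complex.add_im, Complex.ofReal_im, Complex.mul_im, Complex.ofReal_re, Complex.I_im,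
    Complex.I_re, mul_one, mul_zero, add_zero, zero_add]
  rw [mul_div_cancel_left₀ _ (two_ne_zero), abs_of_pos hs]
  exact le_mul_of_one_le_right hs.le (by have := Real.exp_pos (((Real.log ρ + r : ℝ) : ℂ) + ((2 * θ : ℝ) : ℂ) * I).re; linarith)

lemma FF_bound_int {m δ ρ : ℝ} (hδ : 0 < δ) (hδ1 : δ < 1 / 2) (h0 : 0 < ρ) (h1 : ρ ≤ 1)
    {θ : ℝ} (hθ : θ ∈ Ioo 0 π) {r : ℝ} (hr : r < 0) :
    ‖((Real.exp ((m + 1) * r) * (1 - Real.exp r) ^ (-(1 / 2) : ℝ) : ℝ) : ℂ) * hf (1 - qq ρ θ * Real.exp r)‖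
      ≤ ww m (-1 + δ) r * Real.sin θ ^ (-δ) := by
  have hs := Real.sin_pos_of_pos_of_lt_pi hθ.1 hθ.2
  have he : Real.exp r < 1 := Real.exp_lt_one_iff.2 hr
  have hge := qq_ge h0 hθ r
  have hge2 : 1 - Real.exp r ≤ ‖1 - qq ρ θ * Real.exp r‖ := by
    have h3 := norm_sub_norm_le (1 : ℂ) (qq ρ θ * Real.exp r)
    rw [norm_one, norm_mul, norm_qq h0.le, Complex.norm_real, Real.norm_of_nonneg (Real.exp_nonneg _)] at h3
    have h4 : ρ * Real.exp r ≤ 1 * Real.exp r := by gcongr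
    linarith
  have hp : 0 < 1 - Real.exp r := by linarith
  rw [norm_mul, norm_hf, Complex.norm_real, Real.norm_of_nonneg (by positivity)]
  have hn : 0 < ‖1 - qq ρ θ * Real.exp r‖ := by linarith
  have e1 : ‖1 - qq ρ θ * Real.exp r‖ ^ (-(1 / 2) : ℝ) ≤
      (1 - Real.exp r) ^ (-(1 / 2) + δ) * Real.sin θ ^ (-δ) := by
    rw [show (-(1 / 2) : ℝ) = (-(1 / 2) + δ) + (-δ) by ring, Real.rpow_add hn,
      show (-(1 / 2) + δ) + (-δ) + δ = -(1 / 2) + δ by ring]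
    have a1 : ‖1 - qq ρ θ * Real.exp r‖ ^ (-(1 / 2) + δ) ≤ (1 - Real.exp r) ^ (-(1 / 2) + δ) :=
      Real.rpow_le_rpow_of_nonpos hp hge2 (by linarith)
    have a2 : ‖1 - qq ρ θ * Real.exp r‖ ^ (-δ) ≤ Real.sin θ ^ (-δ) :=
      Real.rpow_le_rpow_of_nonpos hs hge (by linarith)
    gcongr
  calc _ ≤ Real.exp ((m + 1) * r) * (1 - Real.exp r) ^ (-(1 / 2) : ℝ) *
        ((1 - Real.exp r) ^ (-(1 / 2) + δ) * Real.sin θ ^ (-δ)) := by gcongr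
    _ = Real.exp ((m + 1) * r) * ((1 - Real.exp r) ^ (-(1 / 2) : ℝ) *
        (1 - Real.exp r) ^ (-(1 / 2) + δ)) * Real.sin θ ^ (-δ) := by ring
    _ = _ := by
      rw [← Real.rpow_add hp, ww, show (-(1 / 2) + (-(1 / 2) + δ) : ℝ) = -1 + δ by ring]

lemma FF_bound {m δ ρ : ℝ} (hm : -1 < m) (hδ : 0 < δ) (hδ1 : δ < 1 / 2) (h0 : 0 < ρ) (h1 : ρ ≤ 1)
    {θ : ℝ} (hθ : θ ∈ Ioo 0 π) :
    ‖FF m (qq ρ θ)‖ ≤ (∫ r in Iio (0 : ℝ), ww m (-1 + δ) r) * Real.sin θ ^ (-δ) := by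
  unfold FF
  rw [← MeasureTheory.integral_mul_const]
  refine norm_integral_le_of_norm_le ((ww_int hm (by linarith) (by linarith)).mul_const _) ?_
  exact (ae_restrict_iff' measurableSet_Iio).2
    (Eventually.of_forall fun r hr => FF_bound_int hδ hδ1 h0 h1 hθ hr)

lemma FF_tendsto {m : ℝ} (hm : -1 < m) {θ : ℝ} (hθ : θ ∈ Ioo 0 π) :
    Tendsto (fun ρ => FF m (qq ρ θ)) (𝓝[<] 1) (𝓝 (FF m (qq 1 θ))) := by
  have hev : ∀ᶠ ρ in 𝓝[<] (1 : ℝ), ρ ∈ Ioo 0 1 := Ioo_mem_nhdsLT one_pos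
  unfold FF
  refine MeasureTheory.tendsto_integral_filter_of_dominated_convergence
    (fun r => ww m (-1 + 1 / 4) r * Real.sin θ ^ (-(1 / 4) : ℝ))
    (Eventually.of_forall fun ρ => (FF_meas m _).aestronglyMeasurable) ?_
    ((ww_int hm (by norm_num) (by norm_num)).mul_const _) ?_
  · filter_upwards [hev] with ρ hρ
    exact (ae_restrict_iff' measurableSet_Iio).2
      (Eventually.of_forall fun r hr => FF_bound_int (by norm_num) (by norm_num) hρ.1 hρ.2.le hθ hr)
  · refine (ae_restrict_iff' measurableSet_Iio).2 (Eventually.of_forall fun r hr => ?_)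
    refine Tendsto.const_mul _ ?_
    have hc : Tendsto (fun ρ : ℝ => 1 - qq ρ θ * Real.exp r) (𝓝[<] 1) (𝓝 (1 - qq 1 θ * Real.exp r)) := by
      have : Continuous (fun ρ : ℝ => 1 - qq ρ θ * Real.exp r) := by unfold qq; fun_prop
      exact (this.tendsto 1).mono_left nhdsWithin_le_nhds
    exact (hf_diff (one_sub_mul_slit (norm_qq zero_le_one θ).le hr)).continuousAt.tendsto.comp hc

end L3

namespace L3

open Set Filter Topology

lemma cosmap_image : (fun θ : ℝ => (1 - Real.cos θ) / 2) '' Ioo 0 π = Ioo 0 1 := by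
  ext z
  constructor
  · rintro ⟨θ, hθ, rfl⟩
    have h1 := Real.cos_lt_cos_of_nonneg_of_le_pi le_rfl hθ.2.le hθ.1
    have h2 := cos_gt_neg_one (by linarith [hθ.1, Real.pi_pos]) hθ.2
    rw [Real.cos_zero] at h1
    constructor <;> simp only <;> linarith
  · intro hz
    refine ⟨Real.arccos (1 - 2 * z), ⟨Real.arccos_pos.2 (by linarith [hz.1]), ?_⟩, ?_⟩
    · refine lt_of_le_of_ne (Real.arccos_le_pi _) fun h => ?_
      rw [Real.arccos_eq_pi] at h
      linarith [hz.2]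
    · simp only
      rw [Real.cos_arccos (by linarith [hz.2]) (by linarith [hz.1])]; ring

lemma cosmap_inj : InjOn (fun θ : ℝ => (1 - Real.cos θ) / 2) (Ioo 0 π) := by
  intro a ha b hb h
  simp only at h
  exact Real.injOn_cos ⟨ha.1.le, ha.2.le⟩ ⟨hb.1.le, hb.2.le⟩ (by linarith)

lemma cosmap_deriv : ∀ θ ∈ Ioo (0 : ℝ) π,
    HasDerivWithinAt (fun θ : ℝ => (1 - Real.cos θ) / 2) (Real.sin θ / 2) (Ioo 0 π) θ := fun θ _ => by
  have := (((Real.hasDerivAt_cos θ).const_sub 1).div_const 2).hasDerivWithinAt (s := Ioo 0 π)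
  rwa [neg_neg] at this

lemma cosmap_w (α : ℝ) {θ : ℝ} (hθ : θ ∈ Ioo 0 π) :
    |Real.sin θ / 2| * ((1 - Real.cos θ) / 2 * (1 - (1 - Real.cos θ) / 2)) ^ (α - 1) =
      (Real.sin θ / 2) ^ (2 * α - 1) := by
  have hs := Real.sin_pos_of_pos_of_lt_pi hθ.1 hθ.2
  have h := Real.sin_sq_add_cos_sq θ
  have hp : 0 < Real.sin θ / 2 := by positivity
  have e : (1 - Real.cos θ) / 2 * (1 - (1 - Real.cos θ) / 2) = (Real.sin θ / 2) ^ (2 : ℝ) := by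
    rw [Real.rpow_two]; linear_combination (-1 / 4) * h
  rw [e, ← Real.rpow_mul hp.le, abs_of_pos hp]
  nth_rw 1 [← Real.rpow_one (Real.sin θ / 2)]
  rw [← Real.rpow_add hp]
  congr 1; ring

lemma cosmap_int (f : ℝ → ℂ) (α : ℝ) :
    ∫ z in Ioo (0 : ℝ) 1, f z * (((z * (1 - z)) ^ (α - 1) : ℝ) : ℂ) =
    ∫ θ in Ioo (0 : ℝ) π, f ((1 - Real.cos θ) / 2) * (((Real.sin θ / 2) ^ (2 * α - 1) : ℝ) : ℂ) := by
  rw [← cosmap_image, integral_image_eq_integral_abs_deriv_smul measurableSet_Ioo cosmap_deriv cosmap_inj]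
  refine setIntegral_congr_fun measurableSet_Ioo fun θ hθ => ?_
  rw [← cosmap_w α hθ, Complex.real_smul]
  push_cast
  ring

lemma sin_int {p : ℝ} (hp : -1 < p) : IntegrableOn (fun θ : ℝ => Real.sin θ ^ p) (Ioo 0 π) := by
  have hb := (beta_int (a := (p + 1) / 2) (b := (p + 1) / 2) (by linarith) (by linarith)).1
  rw [← cosmap_image, integrableOn_image_iff_integrableOn_abs_deriv_smul measurableSet_Ioo cosmap_deriv
    cosmap_inj] at hb
  have h3 : IntegrableOn _ (Ioo 0 π) := hb.const_mul (2 ^ p)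
  refine h3.congr_fun (fun θ hθ => ?_) measurableSet_Ioo
  have hs := Real.sin_pos_of_pos_of_lt_pi hθ.1 hθ.2
  have hm : (1 - Real.cos θ) / 2 ∈ Ioo (0 : ℝ) 1 := by
    rw [← cosmap_image]; exact ⟨θ, hθ, rfl⟩
  simp only
  rw [← Real.mul_rpow hm.1.le (by linarith [hm.2]), smul_eq_mul, cosmap_w _ hθ,
    show 2 * ((p + 1) / 2) - 1 = p by ring, ← Real.mul_rpow (by norm_num) (by positivity)]
  congr 1; ring

/-- contour integrand -/
noncomputable def Psi (ν : ℝ) (q : ℂ) : ℂ := FF ν q ^ 2 * FF (-1 - ν) q * (1 - q) ^ (ν : ℂ)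

lemma Psi_diff {ν : ℝ} (h1 : -1 < ν) (h2 : ν < 0) {q : ℂ} (hq : ‖q‖ < 1) :
    DifferentiableAt ℂ (Psi ν) q := by
  have hm : Metric.ball (0 : ℂ) 1 ∈ 𝓝 q := Metric.isOpen_ball.mem_nhds (by simpa using hq)
  have d1 := (FF_diff h1).differentiableAt hm
  have d2 := (FF_diff (m := -1 - ν) (by linarith)).differentiableAt hm
  unfold Psi
  refine ((d1.pow 2).mul d2).mul (DifferentiableAt.cpow_const (by fun_prop) ?_)
  left
  have := Complex.re_le_norm q
  simp only [Complex.sub_re, Complex.one_re]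
  linarith

lemma circ_zero {ν : ℝ} (h1 : -1 < ν) (h2 : ν < 0) {ρ : ℝ} (hρ : ρ ∈ Ioo (0 : ℝ) 1) :
    ∫ θ in Ioo (0 : ℝ) π, Psi ν (qq ρ θ) * qq ρ θ = 0 := by
  have h := Complex.circleIntegral_eq_zero_of_differentiable_on_off_countable (R := ρ) (c := 0) (s := ∅)
    (f := Psi ν) hρ.1.le countable_empty
    (fun z hz => (Psi_diff h1 h2 (by
      have : ‖z‖ ≤ ρ := by simpa using hz
      linarith [hρ.2])).continuousAt.continuousWithinAt)
    (fun z hz => Psi_diff h1 h2 (by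
      have : ‖z‖ < ρ := by simpa using hz.1
      linarith [hρ.2]))
  have h3 := intervalIntegral.integral_comp_mul_left (a := 0) (b := π) (c := 2)
    (fun θ => deriv (circleMap 0 ρ) θ • Psi ν (circleMap 0 ρ θ)) two_ne_zero
  rw [circleIntegral] at h
  rw [mul_zero, h, smul_zero, intervalIntegral.integral_of_le Real.pi_pos.le, integral_Ioc_eq_integral_Ioo] at h3
  have h4 : ∫ θ in Ioo (0 : ℝ) π, Psi ν (qq ρ θ) * qq ρ θ * I = 0 := by
    rw [← h3]
    refine setIntegral_congr_fun measurableSet_Ioo fun θ _ => ?_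
    have e : circleMap 0 ρ (2 * θ) = qq ρ θ := by
      simp [circleMap, qq]
    simp only [deriv_circleMap, smul_eq_mul]
    rw [e]; ring
  rw [MeasureTheory.integral_mul_const] at h4
  exact (mul_eq_zero.1 h4).resolve_right Complex.I_ne_zero

lemma one_sub_qq_ge {ρ : ℝ} (h0 : 0 < ρ) {θ : ℝ} (hθ : θ ∈ Ioo 0 π) : Real.sin θ ≤ ‖1 - qq ρ θ‖ := by
  have := qq_ge h0 hθ 0
  simpa using this

lemma circ_one {ν : ℝ} (h1 : -1 < ν) (h2 : ν < 0) :
    ∫ θ in Ioo (0 : ℝ) π, Psi ν (qq 1 θ) * qq 1 θ = 0 := by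
  have hev : ∀ᶠ ρ in 𝓝[<] (1 : ℝ), ρ ∈ Ioo 0 1 := Ioo_mem_nhdsLT one_pos
  set δ := (ν + 1) / 6 with hδ
  have hδ0 : 0 < δ := by rw [hδ]; linarith
  have hδ1 : δ < 1 / 2 := by rw [hδ]; linarith
  set C1 := ∫ r in Iio (0 : ℝ), ww ν (-1 + δ) r
  set C2 := ∫ r in Iio (0 : ℝ), ww (-1 - ν) (-1 + δ) r
  have ht : Tendsto (fun ρ : ℝ => ∫ θ in Ioo (0 : ℝ) π, Psi ν (qq ρ θ) * qq ρ θ) (𝓝[<] 1)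
      (𝓝 (∫ θ in Ioo (0 : ℝ) π, Psi ν (qq 1 θ) * qq 1 θ)) := by
    refine MeasureTheory.tendsto_integral_filter_of_dominated_convergence
      (fun θ => C1 ^ 2 * C2 * Real.sin θ ^ (ν - 3 * δ)) ?_ ?_
      ((sin_int (by linarith)).const_mul _) ?_
    · filter_upwards [hev] with ρ hρ
      refine Continuous.aestronglyMeasurable (continuous_iff_continuousAt.2 fun θ => ?_)
      have hq : Continuous (fun θ : ℝ => qq ρ θ) := by unfold qq; fun_prop
      refine ContinuousAt.mul ?_ hq.continuousAt
      exact ContinuousAt.comp (f := fun θ : ℝ => qq ρ θ)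
        (Psi_diff h1 h2 (by rw [norm_qq hρ.1.le]; exact hρ.2)).continuousAt hq.continuousAt
    · filter_upwards [hev] with ρ hρ
      refine (ae_restrict_iff' measurableSet_Ioo).2 (Eventually.of_forall fun θ hθ => ?_)
      have hs := Real.sin_pos_of_pos_of_lt_pi hθ.1 hθ.2
      have b1 := FF_bound (m := ν) h1 hδ0 hδ1 hρ.1 hρ.2.le hθ
      have b2 := FF_bound (m := -1 - ν) (by linarith) hδ0 hδ1 hρ.1 hρ.2.le hθ
      have b3 : ‖(1 - qq ρ θ) ^ (ν : ℂ)‖ ≤ Real.sin θ ^ ν := by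
        rw [Complex.norm_cpow_real]
        exact Real.rpow_le_rpow_of_nonpos hs (one_sub_qq_ge hρ.1 hθ) h2.le
      unfold Psi
      rw [norm_mul, norm_mul, norm_mul, norm_pow, norm_qq hρ.1.le]
      have hC1 : 0 ≤ C1 * Real.sin θ ^ (-δ) := (norm_nonneg _).trans b1
      have hC2 : 0 ≤ C2 * Real.sin θ ^ (-δ) := (norm_nonneg _).trans b2
      calc _ ≤ (C1 * Real.sin θ ^ (-δ)) ^ 2 * (C2 * Real.sin θ ^ (-δ)) * Real.sin θ ^ ν * 1 := by
            gcongr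
            · exact hρ.1.le
            · exact hρ.2.le
        _ = C1 ^ 2 * C2 * (Real.sin θ ^ (-δ) * Real.sin θ ^ (-δ) * Real.sin θ ^ (-δ) * Real.sin θ ^ ν) := by
            ring
        _ = _ := by
            rw [← Real.rpow_add hs, ← Real.rpow_add hs, ← Real.rpow_add hs]
            congr 2; ring
    · refine (ae_restrict_iff' measurableSet_Ioo).2 (Eventually.of_forall fun θ hθ => ?_)
      have hs := Real.sin_pos_of_pos_of_lt_pi hθ.1 hθ.2
      have hq : Tendsto (fun ρ : ℝ => qq ρ θ) (𝓝[<] 1) (𝓝 (qq 1 θ)) := by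
        have : Continuous (fun ρ : ℝ => qq ρ θ) := by unfold qq; fun_prop
        exact (this.tendsto 1).mono_left nhdsWithin_le_nhds
      refine Tendsto.mul ?_ hq
      refine (((FF_tendsto h1 hθ).pow 2).mul (FF_tendsto (by linarith) hθ)).mul ?_
      refine Tendsto.cpow (tendsto_const_nhds.sub hq) tendsto_const_nhds ?_
      have hge := one_sub_qq_ge one_pos hθ
      rw [Complex.mem_slitPlane_iff]
      by_contra hc
      push Not at hc
      have hre : (qq 1 θ).re ≤ 1 := (Complex.re_le_norm _).trans (norm_qq zero_le_one θ).le
      have h0 : 1 - qq 1 θ = 0 := by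
        apply Complex.ext
        · simp only [Complex.sub_re, Complex.one_re, Complex.zero_re] at hc ⊢
          linarith [hc.1]
        · exact hc.2
      rw [h0, norm_zero] at hge
      linarith
  have h0 : Tendsto (fun ρ : ℝ => ∫ θ in Ioo (0 : ℝ) π, Psi ν (qq ρ θ) * qq ρ θ) (𝓝[<] 1) (𝓝 0) := by
    refine tendsto_const_nhds.congr' ?_
    filter_upwards [hev] with ρ hρ using (circ_zero h1 h2 hρ).symm
  exact tendsto_nhds_unique ht h0

lemma one_sub_qq_pow (ν : ℝ) {θ : ℝ} (hθ : θ ∈ Ioo 0 π) :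
    (1 - qq 1 θ) ^ (ν : ℂ) = (((4 : ℝ) ^ ν : ℝ) : ℂ) * (((Real.sin θ / 2) ^ ν : ℝ) : ℂ) *
      Complex.exp (ν * (θ - π / 2) * I) := by
  have hs := Real.sin_pos_of_pos_of_lt_pi hθ.1 hθ.2
  have hp : 0 < 4 * (Real.sin θ / 2) := by positivity
  have e : 1 - qq 1 θ = Complex.exp ((Real.log (4 * (Real.sin θ / 2)) : ℝ) + ((θ - π / 2 : ℝ) : ℂ) * I) := by
    rw [Complex.exp_add, ← Complex.ofReal_exp, Real.exp_log hp, Complex.exp_mul_I, ← Complex.ofReal_cos,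
      ← Complex.ofReal_sin, Real.cos_sub_pi_div_two, Real.sin_sub_pi_div_two, qq,
      show (2 * θ * I : ℂ) = ((2 * θ : ℝ) : ℂ) * I by push_cast; ring, Complex.exp_mul_I,
      ← Complex.ofReal_cos, ← Complex.ofReal_sin, Real.cos_two_mul, Real.sin_two_mul]
    have := Real.sin_sq_add_cos_sq θ
    have h2 : ((Real.sin θ : ℂ)) ^ 2 + (Real.cos θ : ℂ) ^ 2 = 1 := by exact_mod_cast this
    push_cast at h2 ⊢
    linear_combination (-2) * h2
  rw [e, Complex.cpow_def_of_ne_zero (Complex.exp_ne_zero _), Complex.log_exp, ← Complex.ofReal_mul,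
    ← Real.mul_rpow (by norm_num) (by positivity), Real.rpow_def_of_pos hp, Complex.ofReal_exp,
    ← Complex.exp_add]
  · congr 1; push_cast; ring
  · simp; linarith [hθ.1, Real.pi_pos]
  · simp; linarith [hθ.2, Real.pi_pos]

lemma FF_val' {m : ℝ} (h1 : -1 < m) (h2 : m < 0) {θ : ℝ} (hθ : θ ∈ Ioo 0 π) :
    FF m (qq 1 θ) = ((∫ r, bb (m + 1) 1 r : ℝ) : ℂ) / 2 * Complex.exp (-((m + 1) * θ * I)) *
      ((SS (m * (m + 1)) (1 - (1 - Real.cos θ) / 2) : ℝ) - Complex.exp (m * π * I) *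
        (SS (m * (m + 1)) ((1 - Real.cos θ) / 2) : ℝ)) := by
  have hm : (1 - Real.cos θ) / 2 ∈ Ioo (0 : ℝ) 1 := by
    rw [← cosmap_image]; exact ⟨θ, hθ, rfl⟩
  have h := FF_val h1 h2 hθ
  rw [MM_eq h1 h2 ⟨by linarith [hm.1, hm.2], by linarith [hm.1, hm.2]⟩,
    MM_eq h1 h2 ⟨by linarith [hm.1, hm.2], by linarith [hm.1, hm.2]⟩,
    show (1 - -Real.cos θ) / 2 = 1 - (1 - Real.cos θ) / 2 by ring] at h
  have e : qq 1 θ = Complex.exp (2 * θ * I) := by simp [qq]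
  rw [e]
  push_cast at h ⊢
  linear_combination (1 / 2) * h

lemma contour {α : ℝ} (h0 : 0 < α) (h1 : α < 1 / 2) :
    ∫ z in Ioo (0 : ℝ) 1, (((SS (la α) (1 - z) : ℝ) : ℂ) - Complex.exp ((2 * α - 1) * π * I) * (SS (la α) z : ℝ)) ^ 2 *
      ((SS (la α) (1 - z) : ℝ) + Complex.exp (-((2 * α - 1) * π * I)) * (SS (la α) z : ℝ)) *
      (((z * (1 - z)) ^ (α - 1) : ℝ) : ℂ) = 0 := by
  have hn1 : -1 < 2 * α - 1 := by linarith
  have hn2 : 2 * α - 1 < 0 := by linarith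
  rw [cosmap_int (fun z => (((SS (la α) (1 - z) : ℝ) : ℂ) - Complex.exp ((2 * α - 1) * π * I) * (SS (la α) z : ℝ)) ^ 2 *
      ((SS (la α) (1 - z) : ℝ) + Complex.exp (-((2 * α - 1) * π * I)) * (SS (la α) z : ℝ)))]
  have hc := circ_one hn1 hn2
  have p1 := bb_pos_int (p := 2 * α - 1 + 1) (m := 1) (by linarith) (by push_cast; linarith)
  have p2 := bb_pos_int (p := -1 - (2 * α - 1) + 1) (m := 1) (by linarith) (by push_cast; linarith)
  set c1 := ∫ r, bb (2 * α - 1 + 1) 1 r with hc1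
  set c2 := ∫ r, bb (-1 - (2 * α - 1) + 1) 1 r with hc2
  set K : ℂ := ((c1 : ℂ) / 2) ^ 2 * (c2 / 2) * (((4 : ℝ) ^ (2 * α - 1) : ℝ) : ℂ) *
    Complex.exp (-((2 * α - 1) * (π / 2) * I)) with hK
  have hK0 : K ≠ 0 := by
    have : (((4 : ℝ) ^ (2 * α - 1) : ℝ) : ℂ) ≠ 0 := Complex.ofReal_ne_zero.2 (by positivity)
    have a1 : (c1 : ℂ) ≠ 0 := Complex.ofReal_ne_zero.2 p1.ne'
    have a2 : (c2 : ℂ) ≠ 0 := Complex.ofReal_ne_zero.2 p2.ne'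
    simp [hK, a1, a2, this, Complex.exp_ne_zero]
  refine (mul_eq_zero.1 ?_).resolve_left hK0
  rw [← hc, ← MeasureTheory.integral_const_mul]
  refine setIntegral_congr_fun measurableSet_Ioo fun θ hθ => ?_
  simp only [Psi]
  rw [FF_val' hn1 hn2 hθ, FF_val' (m := -1 - (2 * α - 1)) (by linarith) (by linarith) hθ,
    one_sub_qq_pow _ hθ, ← hc1, ← hc2]
  rw [show (2 * α - 1) * (2 * α - 1 + 1) = la α by unfold la; ring,
    show (-1 - (2 * α - 1)) * (-1 - (2 * α - 1) + 1) = la α by unfold la; ring]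
  have e1 : Complex.exp ((-1 - (2 * α - 1) : ℝ) * π * I) = -Complex.exp (-((2 * α - 1) * π * I)) := by
    have e0 : Complex.exp (-(π * I)) = -1 := by rw [Complex.exp_neg, Complex.exp_pi_mul_I]; norm_num
    rw [← mul_neg_one (Complex.exp _), ← e0, ← Complex.exp_add]
    congr 1; push_cast; ring
  have e2 : Complex.exp (-(((2 * α - 1 : ℝ) + 1) * θ * I)) ^ 2 *
      Complex.exp (-(((-1 - (2 * α - 1) : ℝ) + 1) * θ * I)) *
      Complex.exp ((2 * α - 1 : ℝ) * (θ - π / 2) * I) * qq 1 θ =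
      Complex.exp (-((2 * α - 1) * (π / 2) * I)) := by
    rw [qq, Complex.ofReal_one, one_mul, ← Complex.exp_nat_mul, ← Complex.exp_add, ← Complex.exp_add,
      ← Complex.exp_add]
    congr 1; push_cast; ring
  rw [e1, hK, ← e2]
  push_cast
  ring

end L3

namespace L3

open Set Filter Topology

lemma refl_int (f : ℝ → ℝ) : ∫ z in Ioo (0 : ℝ) 1, f (1 - z) = ∫ z in Ioo (0 : ℝ) 1, f z := by
  rw [← integral_Ioc_eq_integral_Ioo, ← integral_Ioc_eq_integral_Ioo,
    ← intervalIntegral.integral_of_le zero_le_one, ← intervalIntegral.integral_of_le zero_le_one,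
    intervalIntegral.integral_comp_sub_left (fun z => f z)]
  simp

lemma a_val {α : ℝ} (h0 : 0 < α) (h1 : α < 1 / 2) :
    ∫ z in Ioo (0 : ℝ) 1, SS (la α) z * SS (la α) z * SS (la α) z * (z * (1 - z)) ^ (α - 1) =
      (3 - 2 * Real.cos ((2 * α - 1) * π)) *
        (Real.Gamma α ^ 5 / (Real.Gamma (2 * α) ^ 4 * Real.Gamma (1 - α) ^ 3)) := by
  have hpi := Real.pi_pos
  set P : ℝ → ℝ := SS (la α) with hP
  set Q : ℝ → ℝ := fun z => SS (la α) (1 - z) with hQ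
  set C := lC ‖la α‖ * (1 + 1 / (α / 6))
  have cP : ContinuousOn P (Ioo 0 1) := SS_contOn _
  have cQ : ContinuousOn Q (Ioo 0 1) :=
    ContinuousOn.comp (g := P) cP (by fun_prop) (fun z hz => ⟨by linarith [hz.2], by linarith [hz.1]⟩)
  have bP : ∀ z ∈ Ioo (0 : ℝ) 1, ‖P z‖ ≤ C * (z * (1 - z)) ^ (-(α / 6)) := fun z hz =>
    SS_v_bound _ (by linarith) hz
  have bQ : ∀ z ∈ Ioo (0 : ℝ) 1, ‖Q z‖ ≤ C * (z * (1 - z)) ^ (-(α / 6)) := fun z hz => by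
    have := bP (1 - z) ⟨by linarith [hz.2], by linarith [hz.1]⟩
    rwa [show (1 - z) * (1 - (1 - z)) = z * (1 - z) by ring] at this
  have i1 := (triple_int h0 cP cP cP bP bP bP).ofReal (𝕜 := ℂ)
  have i2 := (triple_int h0 cP cP cQ bP bP bQ).ofReal (𝕜 := ℂ)
  have i3 := (triple_int h0 cP cQ cQ bP bQ bQ).ofReal (𝕜 := ℂ)
  have i4 := (triple_int h0 cQ cQ cQ bQ bQ bQ).ofReal (𝕜 := ℂ)
  have hb := b_val h0 h1
  set B := Real.Gamma α ^ 5 / (Real.Gamma (2 * α) ^ 4 * Real.Gamma (1 - α) ^ 3)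
  set A := ∫ z in Ioo (0 : ℝ) 1, P z * P z * P z * (z * (1 - z)) ^ (α - 1) with hA
  have v1 : ∫ z in Ioo (0 : ℝ) 1, ((P z * P z * P z * (z * (1 - z)) ^ (α - 1) : ℝ) : ℂ) = A :=
    integral_complex_ofReal
  have v2 : ∫ z in Ioo (0 : ℝ) 1, ((P z * P z * Q z * (z * (1 - z)) ^ (α - 1) : ℝ) : ℂ) = B := by
    rw [integral_complex_ofReal, ← hb]
    congr 2; funext z; simp only [hP, hQ]; ring
  have v3 : ∫ z in Ioo (0 : ℝ) 1, ((P z * Q z * Q z * (z * (1 - z)) ^ (α - 1) : ℝ) : ℂ) = B := by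
    rw [integral_complex_ofReal, ← hb, ← refl_int]
    congr 2; funext z; simp only [hP, hQ]
    rw [show (1 - z) * (1 - (1 - z)) = z * (1 - z) by ring, sub_sub_cancel]; ring
  have v4 : ∫ z in Ioo (0 : ℝ) 1, ((Q z * Q z * Q z * (z * (1 - z)) ^ (α - 1) : ℝ) : ℂ) = A := by
    rw [integral_complex_ofReal, hA, ← refl_int]
    congr 2; funext z; simp only [hP, hQ]
    rw [show (1 - z) * (1 - (1 - z)) = z * (1 - z) by ring, sub_sub_cancel]
  have hc := contour h0 h1
  set ω := Complex.exp ((2 * α - 1) * π * I) with hω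
  set ω' := Complex.exp (-((2 * α - 1) * π * I)) with hω'
  have hωω : ω * ω' = 1 := by rw [hω, hω', ← Complex.exp_add, add_neg_cancel, Complex.exp_zero]
  have hsum : ω + ω' = 2 * Complex.cos ((2 * α - 1) * π) := by
    rw [Complex.two_cos, hω, hω', neg_mul]
  have hne : 1 + ω ≠ 0 := by
    intro h
    have h3 : (1 + ω).re = 1 + Real.cos ((2 * α - 1) * π) := by
      rw [hω, show ((2 * α - 1) * π * I : ℂ) = (((2 * α - 1) * π : ℝ) : ℂ) * I by push_cast; ring,
        Complex.add_re, Complex.exp_ofReal_mul_I_re, Complex.one_re]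
    rw [h] at h3
    have := cos_gt_neg_one (t := (2 * α - 1) * π) (by nlinarith) (by nlinarith)
    rw [← h3] at this
    simp at this
  have hexp : (∫ z in Ioo (0 : ℝ) 1, ((Q z : ℂ) - ω * (P z : ℝ)) ^ 2 * ((Q z : ℝ) + ω' * (P z : ℝ)) *
      (((z * (1 - z)) ^ (α - 1) : ℝ) : ℂ)) = (A : ℂ) + ω * A + (ω' - 2 * ω) * B + (ω ^ 2 - 2) * B := by
    have j3 := i3.const_mul (ω' - 2 * ω)
    have j2 := i2.const_mul (ω ^ 2 - 2)
    have j1 := i1.const_mul ω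
    have s1 := MeasureTheory.integral_add i4 j1
    have s2 := MeasureTheory.integral_add (i4.add j1) j3
    have s3 := MeasureTheory.integral_add ((i4.add j1).add j3) j2
    simp only [Pi.add_apply] at s1 s2 s3
    rw [s2, s1, MeasureTheory.integral_const_mul, MeasureTheory.integral_const_mul,
      MeasureTheory.integral_const_mul] at s3
    simp only [Complex.coe_algebraMap] at s3
    rw [v4, v1, v2, v3] at s3
    rw [← s3]
    refine integral_congr_ae (Eventually.of_forall fun z => ?_)
    simp only
    push_cast
    linear_combination (-2 * (Q z : ℂ) * (P z : ℂ) ^ 2 + ω * (P z : ℂ) ^ 3) * ((((z * (1 - z)) ^ (α - 1) : ℝ) : ℂ)) * hωω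
  rw [hexp] at hc
  have hfin : (1 + ω) * ((A : ℂ) - (3 - (ω + ω')) * B) = 0 := by
    linear_combination hc + (B : ℂ) * hωω
  have h5 := (mul_eq_zero.1 hfin).resolve_left hne
  rw [hsum] at h5
  have h6 : ((A - (3 - 2 * Real.cos ((2 * α - 1) * π)) * B : ℝ) : ℂ) = 0 := by
    push_cast; exact h5
  have := Complex.ofReal_eq_zero.1 h6
  linarith

lemma gamma_id {α : ℝ} (h0 : 0 < α) (h1 : α < 1 / 2) :
    1 / π * (Real.cos ((2 * α - 1) * π / 2) / 2 ^ (2 * α - 1)) ^ 3 *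
      (Real.Gamma α / Real.Gamma (α + 1 / 2)) ^ 4 =
    2 * 4 ^ (α - 1) * (Real.Gamma α ^ 5 / (Real.Gamma (2 * α) ^ 4 * Real.Gamma (1 - α) ^ 3)) := by
  have hpi := Real.pi_pos
  have g1 := Real.Gamma_pos_of_pos h0
  have g2 := Real.Gamma_pos_of_pos (show 0 < α + 1 / 2 by linarith)
  have g3 := Real.Gamma_pos_of_pos (show 0 < 2 * α by linarith)
  have g4 := Real.Gamma_pos_of_pos (show 0 < 1 - α by linarith)
  have r1 := Real.Gamma_mul_Gamma_add_half α
  have r2 := Real.Gamma_mul_Gamma_one_sub α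
  have hs : 0 < Real.sin (π * α) := Real.sin_pos_of_pos_of_lt_pi (by positivity) (by nlinarith)
  have e1 : Real.cos ((2 * α - 1) * π / 2) = π / (Real.Gamma α * Real.Gamma (1 - α)) := by
    rw [show (2 * α - 1) * π / 2 = π * α - π / 2 by ring, Real.cos_sub_pi_div_two, r2]
    field_simp
  have e2 : Real.Gamma (α + 1 / 2) = Real.Gamma (2 * α) * 2 ^ (1 - 2 * α) * √π / Real.Gamma α := by
    rw [← r1]; field_simp
  have e3 : (4 : ℝ) ^ (α - 1) = (2 ^ (2 * α - 1)) / 2 := by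
    rw [show (4 : ℝ) = 2 ^ (2 : ℝ) by norm_num, ← Real.rpow_mul (by norm_num),
      show 2 * (α - 1) = (2 * α - 1) - 1 by ring, Real.rpow_sub (by norm_num), Real.rpow_one]
  have e4 : (2 : ℝ) ^ (1 - 2 * α) = (2 ^ (2 * α - 1))⁻¹ := by
    rw [← Real.rpow_neg (by norm_num)]; congr 1; ring
  have e5 : √π ^ 2 = π := Real.sq_sqrt hpi.le
  have e6 : √π ^ 4 = π ^ 2 := by rw [show √π ^ 4 = (√π ^ 2) ^ 2 by ring, e5]
  have hsq : 0 < √π := Real.sqrt_pos.2 hpi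
  rw [e1, e2, e3, e4]
  have ht : (0 : ℝ) < 2 ^ (2 * α - 1) := by positivity
  set t : ℝ := 2 ^ (2 * α - 1)
  field_simp
  rw [e6]
  try ring

/-- the left side, up to a factor -/
noncomputable def HH (ν : ℂ) : ℂ := ∫ z in Ioo (0 : ℝ) 1, SS (ν * (ν + 1)) (z : ℂ) ^ 3 *
  ((4 * (z * (1 - z)) : ℝ) : ℂ) ^ ((ν - 1) / 2)

/-- the right side -/
noncomputable def RR (ν : ℂ) : ℂ := ((3 - 2 * Complex.cos (ν * π)) / π) *
  (Complex.cos (ν * π / 2) / 2 ^ ν) ^ 3 * (Complex.Gamma ((1 + ν)/2) / Complex.Gamma (1 + ν/2)) ^ 4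

lemma real_case {α : ℝ} (h0 : 0 < α) (h1 : α < 1 / 2) :
    2 * HH ((2 * α - 1 : ℝ) : ℂ) = RR ((2 * α - 1 : ℝ) : ℂ) := by
  have hR : RR ((2 * α - 1 : ℝ) : ℂ) = (((3 - 2 * Real.cos ((2 * α - 1) * π)) *
      (1 / π * (Real.cos ((2 * α - 1) * π / 2) / 2 ^ (2 * α - 1)) ^ 3 *
      (Real.Gamma α / Real.Gamma (α + 1 / 2)) ^ 4) : ℝ) : ℂ) := by
    unfold RR
    have a1 : ((1 : ℂ) + (2 * α - 1 : ℝ)) / 2 = (α : ℝ) := by push_cast; ring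
    have a2 : (1 : ℂ) + (2 * α - 1 : ℝ) / 2 = ((α + 1 / 2 : ℝ) : ℂ) := by push_cast; ring
    have a3 : (2 : ℂ) ^ ((2 * α - 1 : ℝ) : ℂ) = ((2 ^ (2 * α - 1) : ℝ) : ℂ) := by
      rw [Complex.ofReal_cpow (by norm_num)]; norm_num
    rw [a1, a2, a3, Complex.Gamma_ofReal, Complex.Gamma_ofReal, ← Complex.ofReal_mul,
      show ((2 * α - 1) * π : ℝ) / (2 : ℂ) = (((2 * α - 1) * π / 2 : ℝ) : ℂ) by push_cast; ring,
      ← Complex.ofReal_cos, ← Complex.ofReal_cos]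
    push_cast
    ring
  have hL : HH ((2 * α - 1 : ℝ) : ℂ) = ((4 ^ (α - 1) * ∫ z in Ioo (0 : ℝ) 1, SS (la α) z * SS (la α) z *
      SS (la α) z * (z * (1 - z)) ^ (α - 1) : ℝ) : ℂ) := by
    unfold HH
    rw [← MeasureTheory.integral_const_mul, ← integral_complex_ofReal]
    refine setIntegral_congr_fun measurableSet_Ioo fun z hz => ?_
    have hv : 0 < z * (1 - z) := mul_pos hz.1 (by linarith [hz.2])
    have a1 : ((2 * α - 1 : ℝ) : ℂ) * (((2 * α - 1 : ℝ) : ℂ) + 1) = (la α : ℝ) := by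
      unfold la; push_cast; ring
    have a2 : (((2 * α - 1 : ℝ) : ℂ) - 1) / 2 = ((α - 1 : ℝ) : ℂ) := by push_cast; ring
    rw [a1, a2, ← SS_ofReal, ← Complex.ofReal_cpow (by positivity), Real.mul_rpow (by norm_num) hv.le]
    push_cast
    ring
  rw [hL, hR, a_val h0 h1, gamma_id h0 h1]
  push_cast
  ring

end L3

namespace L3

open Set Filter Topology

lemma SS_diff_l {z : ℂ} (hz : ‖z‖ < 1) : Differentiable ℂ (fun l : ℂ => SS l z) := by
  intro l₀
  have h : DifferentiableOn ℂ (fun l : ℂ => SS l z) (Metric.ball 0 (‖l₀‖ + 1)) := by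
    unfold SS
    refine Complex.differentiableOn_tsum_of_summable_norm (u := fun n => lC (‖l₀‖ + 1) * ‖z‖ ^ n)
      ((summable_geometric_of_lt_one (norm_nonneg _) hz).mul_left _) ?_ Metric.isOpen_ball ?_
    · intro n
      unfold lco
      refine Differentiable.differentiableOn ?_
      refine Differentiable.mul_const ?_ _
      refine Differentiable.fun_finsetProd fun k _ => ?_
      fun_prop
    · intro n l hl
      have hl' : ‖l‖ < ‖l₀‖ + 1 := by simpa using hl
      rw [norm_mul, norm_pow]
      gcongr
      exact (lco_bound l n).trans (lC_mono (norm_nonneg _) hl'.le)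
  exact h.differentiableAt (Metric.isOpen_ball.mem_nhds (by simp))

lemma HH_diff : DifferentiableOn ℂ HH {ν : ℂ | -1 < ν.re} := by
  unfold HH
  refine par_diff ?_ ?_ ?_
  · intro ν _
    refine ContinuousOn.aestronglyMeasurable (fun z hz => ?_) measurableSet_Ioo
    have hv : 0 < 4 * (z * (1 - z)) := by have := hz.1; have : 0 < 1 - z := by linarith [hz.2]
                                          positivity
    have hn : ‖(z : ℂ)‖ < 1 := by rw [Complex.norm_real, Real.norm_of_nonneg hz.1.le]; exact hz.2
    refine ContinuousAt.continuousWithinAt ?_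
    refine ContinuousAt.mul (ContinuousAt.pow ?_ 3) ?_
    · exact ContinuousAt.comp (f := fun z : ℝ => (z : ℂ)) (SS_hasDerivAt _ hn).continuousAt (by fun_prop)
    · refine ContinuousAt.cpow (by fun_prop) continuousAt_const ?_
      exact Complex.ofReal_mem_slitPlane.2 hv
  · refine (ae_restrict_iff' measurableSet_Ioo).2 (Eventually.of_forall fun z hz => ?_)
    have hv : 0 < 4 * (z * (1 - z)) := by have := hz.1; have : 0 < 1 - z := by linarith [hz.2]
                                          positivity
    have hn : ‖(z : ℂ)‖ < 1 := by rw [Complex.norm_real, Real.norm_of_nonneg hz.1.le]; exact hz.2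
    refine Differentiable.differentiableOn ?_
    refine Differentiable.mul (Differentiable.pow ?_ 3) ?_
    · exact Differentiable.comp (g := fun l : ℂ => SS l (z : ℂ)) (f := fun ν : ℂ => ν * (ν + 1))
        (SS_diff_l hn) (by fun_prop)
    · intro ν
      exact DifferentiableAt.const_cpow (by fun_prop) (Or.inl (Complex.ofReal_ne_zero.2 hv.ne'))
  · intro ν₀ hν₀
    have hν : -1 < ν₀.re := hν₀
    set a := (ν₀.re + 1) / 4 with ha
    have ha0 : 0 < a := by rw [ha]; linarith
    have hre : ∀ ν ∈ Metric.ball ν₀ (min 1 (2 * a)), 2 * a - 1 < ν.re := by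
      intro ν h
      rw [Metric.mem_ball, dist_eq_norm] at h
      have h1 := (Complex.abs_re_le_norm (ν - ν₀)).trans_lt (h.trans_le (min_le_right _ _))
      rw [Complex.sub_re] at h1
      have := (abs_lt.1 h1).1
      rw [ha] at this ⊢
      linarith
    set R := (‖ν₀‖ + 1) * (‖ν₀‖ + 2) with hR
    have hl : ∀ ν ∈ Metric.ball ν₀ (min 1 (2 * a)), ‖ν * (ν + 1)‖ ≤ R := by
      intro ν h
      rw [Metric.mem_ball, dist_eq_norm] at h
      have h1 := h.trans_le (min_le_left _ _)
      have h2 := norm_sub_norm_le ν ν₀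
      have h3 := norm_add_le ν 1
      rw [norm_one] at h3
      rw [norm_mul, hR]
      gcongr <;> linarith
    set C := lC R * (1 + 1 / (a / 6)) with hC
    have hC0 : 0 < C := by
      have := lC_pos (show 0 ≤ R by positivity)
      positivity
    refine ⟨min 1 (2 * a), by positivity, ?_, fun z => C ^ 3 * 4 ^ (a - 1) * (z ^ (a - 1) * (1 - z) ^ (a / 2 - 1)),
      (beta_int ha0 (half_pos ha0)).1.const_mul _, ?_⟩
    · intro ν h
      have := hre ν h
      simp only [mem_setOf_eq]; linarith
    · refine (ae_restrict_iff' measurableSet_Ioo).2 (Eventually.of_forall fun z hz ν h => ?_)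
      have hz0 := hz.1
      have hz1 : 0 < 1 - z := by linarith [hz.2]
      have hv : 0 < 4 * (z * (1 - z)) := by positivity
      have hv1 : 4 * (z * (1 - z)) ≤ 1 := by nlinarith [sq_nonneg (1 - 2 * z)]
      have hn : ‖(z : ℂ)‖ = z := by rw [Complex.norm_real, Real.norm_of_nonneg hz.1.le]
      have b1 := SS_bound (ν * (ν + 1)) (z := (z : ℂ)) (by rw [hn]; exact hz.2) (d := a / 6) (by positivity)
      rw [hn] at b1
      have b2 : ‖SS (ν * (ν + 1)) (z : ℂ)‖ ≤ C * (1 - z) ^ (-(a / 6)) := by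
        refine b1.trans ?_
        have := lC_mono (norm_nonneg _) (hl ν h)
        rw [hC]
        gcongr
      have b3 : ‖((4 * (z * (1 - z)) : ℝ) : ℂ) ^ ((ν - 1) / 2)‖ ≤ (4 * (z * (1 - z))) ^ (a - 1) := by
        rw [Complex.norm_cpow_eq_rpow_re_of_pos hv]
        refine Real.rpow_le_rpow_of_exponent_ge hv hv1 ?_
        have e : ((ν - 1) / 2).re = (ν.re - 1) / 2 := by simp
        rw [e]
        linarith [hre ν h]
      rw [norm_mul, norm_pow]
      calc _ ≤ (C * (1 - z) ^ (-(a / 6))) ^ 3 * (4 * (z * (1 - z))) ^ (a - 1) := by gcongr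
        _ = C ^ 3 * 4 ^ (a - 1) * (z ^ (a - 1) *
            ((1 - z) ^ (-(a / 6)) * (1 - z) ^ (-(a / 6)) * (1 - z) ^ (-(a / 6)) * (1 - z) ^ (a - 1))) := by
          rw [Real.mul_rpow (by norm_num) (by positivity), Real.mul_rpow hz0.le hz1.le]; ring
        _ = _ := by
          rw [← Real.rpow_add hz1, ← Real.rpow_add hz1, ← Real.rpow_add hz1]
          congr 3; ring

lemma Gamma_diff_re {s : ℂ} (hs : 0 < s.re) : DifferentiableAt ℂ Complex.Gamma s := by
  refine Complex.differentiableAt_Gamma s fun m h => ?_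
  rw [h] at hs
  simp at hs
  have : (0 : ℝ) ≤ m := m.cast_nonneg
  linarith

lemma RR_diff : DifferentiableOn ℂ RR {ν : ℂ | -1 < ν.re} := by
  intro ν hν
  have hν' : -1 < ν.re := hν
  refine DifferentiableAt.differentiableWithinAt ?_
  have r1 : 0 < ((1 + ν) / 2).re := by
    have : ((1 + ν) / 2).re = (1 + ν.re) / 2 := by simp
    rw [this]; linarith
  have r2 : 0 < (1 + ν / 2).re := by
    have : (1 + ν / 2).re = 1 + ν.re / 2 := by simp
    rw [this]; linarith
  unfold RR
  refine DifferentiableAt.mul (DifferentiableAt.mul (by fun_prop) (DifferentiableAt.pow ?_ 3))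
    (DifferentiableAt.pow ?_ 4)
  · refine DifferentiableAt.div (by fun_prop) ?_ ?_
    · exact DifferentiableAt.const_cpow (by fun_prop) (Or.inl two_ne_zero)
    · exact fun h => two_ne_zero (Complex.cpow_eq_zero_iff _ _ |>.1 h).1
  · refine DifferentiableAt.div ?_ ?_ (Complex.Gamma_ne_zero_of_re_pos r2)
    · exact DifferentiableAt.comp (f := fun ν : ℂ => (1 + ν) / 2) _ (Gamma_diff_re r1) (by fun_prop)
    · exact DifferentiableAt.comp (f := fun ν : ℂ => 1 + ν / 2) _ (Gamma_diff_re r2) (by fun_prop)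

lemma HH_eq {ν : ℂ} (hν : -1 < ν.re) : 2 * HH ν = RR ν := by
  have hopen : IsOpen {ν : ℂ | -1 < ν.re} := isOpen_lt continuous_const Complex.continuous_re
  have a1 : AnalyticOnNhd ℂ (fun ν => 2 * HH ν) {ν : ℂ | -1 < ν.re} :=
    (HH_diff.const_mul 2).analyticOnNhd hopen
  have a2 := RR_diff.analyticOnNhd hopen
  refine a1.eqOn_of_preconnected_of_frequently_eq a2 (convex_halfSpace_re_gt (-1)).isPreconnected
    (z₀ := ((-1 / 2 : ℝ) : ℂ)) ?_ ?_ hν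
  · simp only [mem_setOf_eq, Complex.ofReal_re]; norm_num
  · have ht : Tendsto (fun x : ℝ => (x : ℂ)) (𝓝[≠] (-1 / 2 : ℝ)) (𝓝[≠] ((-1 / 2 : ℝ) : ℂ)) := by
      refine tendsto_nhdsWithin_iff.2 ⟨?_, ?_⟩
      · exact (Complex.continuous_ofReal.tendsto _).mono_left nhdsWithin_le_nhds
      · filter_upwards [self_mem_nhdsWithin] with x hx
        exact fun h => hx (Complex.ofReal_injective h)
    refine ht.frequently (Eventually.frequently ?_)
    have : Ioo (-1 : ℝ) 0 ∈ 𝓝[≠] (-1 / 2 : ℝ) :=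
      mem_nhdsWithin_of_mem_nhds (Ioo_mem_nhds (by norm_num) (by norm_num))
    filter_upwards [this] with x hx
    have h := real_case (α := (x + 1) / 2) (by linarith [hx.1]) (by linarith [hx.2])
    rwa [show 2 * ((x + 1) / 2) - 1 = x by ring] at h

lemma lhs_eq (ν : ℂ) :
    (∫ x in (-1:ℝ)..1, (legendreP ν (x : ℂ)) ^ 3 * ((1 - (x:ℂ) ^ 2) ^ ((ν - 1)/2))) = 2 * HH ν := by
  have h := intervalIntegral.integral_comp_sub_mul (a := 0) (b := 1) (c := 2)
    (fun x : ℝ => (legendreP ν (x : ℂ)) ^ 3 * ((1 - (x:ℂ) ^ 2) ^ ((ν - 1)/2))) two_ne_zero 1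
  norm_num only at h
  rw [intervalIntegral.integral_of_le zero_le_one, integral_Ioc_eq_integral_Ioo] at h
  have h2 : HH ν = ∫ z in Ioo (0 : ℝ) 1, (legendreP ν ((1 - 2 * z : ℝ) : ℂ)) ^ 3 *
      ((1 - ((1 - 2 * z : ℝ):ℂ) ^ 2) ^ ((ν - 1)/2)) := by
    unfold HH
    refine setIntegral_congr_fun measurableSet_Ioo fun z _ => ?_
    simp only [legendreP_eq]
    have e1 : (1 - ((1 - 2 * z : ℝ) : ℂ)) / 2 = z := by push_cast; ring
    have e2 : 1 - ((1 - 2 * z : ℝ):ℂ) ^ 2 = ((4 * (z * (1 - z)) : ℝ) : ℂ) := by push_cast; ring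
    rw [e1, e2]
  rw [h2, h, Complex.real_smul, ← mul_assoc]
  norm_num

end L3

theorem stmt7 (ν : ℂ) (hν : -1 < ν.re) :
    (∫ x in (-1:ℝ)..1, (legendreP ν (x : ℂ)) ^ 3 * ((1 - (x:ℂ) ^ 2) ^ ((ν - 1)/2)))
      = ((3 - 2 * Complex.cos (ν * π)) / π) * (Complex.cos (ν * π / 2) / 2 ^ ν) ^ 3 *
        (Complex.Gamma ((1 + ν)/2) / Complex.Gamma (1 + ν/2)) ^ 4 := by
  exact (L3.lhs_eq ν).trans (L3.HH_eq hν)
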